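/- For all integers r, d and g with r ≥ 1, 2r ≤ d and d ≤ r + g − 2, there exists a metric graph Γ of genus g and an effective divisor D on Γ of degree d such that rk(D) = r and D is a free divisor on Γ. -/

import Mathlib

noncomputable section

/-- The star with `n` rays of radius `r` in the complex plane:
`{ z ∈ ℂ : z = t·e^{2πik/n}, t ∈ [0,r], k ∈ ℤ }`. -/
def starSet (n : ℕ) (r : ℝ) : Set ℂ :=
  {z | ∃ t ∈ Set.Icc (0 : ℝ) r, ∃ k : ℤ,
    z = (t : ℂ) * Complex.exp (2 * (Real.pi : ℂ) * Complex.I * (k : ℂ) / (n : ℂ))}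

/-- `P` has a neighbourhood isometric to a star with `n` rays of some radius `r > 0`,
with `P` corresponding to `0`. -/
def HasStarNbhd (Γ : Type*) [MetricSpace Γ] (P : Γ) (n : ℕ) : Prop :=
  ∃ r > (0 : ℝ), ∃ U ∈ nhds P, ∃ φ : Γ → ℂ,
    φ P = 0 ∧ φ '' U = starSet n r ∧
    ∀ x ∈ U, ∀ y ∈ U, dist (φ x) (φ y) = dist x y

/-- A metric graph: a compact connected metric space in which every point has a
neighbourhood isometric to a star with `n ≥ 1` rays. -/
def IsMetricGraph (Γ : Type*) [MetricSpace Γ] : Prop :=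
  CompactSpace Γ ∧ ConnectedSpace Γ ∧ ∀ P : Γ, ∃ n : ℕ, 1 ≤ n ∧ HasStarNbhd Γ P n

/-- The valence of a point: the number of rays of a star neighbourhood. -/
noncomputable def valence (Γ : Type*) [MetricSpace Γ] (P : Γ) : ℕ :=
  sInf {n : ℕ | 1 ≤ n ∧ HasStarNbhd Γ P n}

/-- A vertex is a point of valence different from `2`. -/
def IsVertex (Γ : Type*) [MetricSpace Γ] (P : Γ) : Prop := valence Γ P ≠ 2

/-- The genus of a metric graph: `#edges - #vertices + 1`, the edges being the connected
components of the complement of the vertex set. -/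
noncomputable def graphGenus (Γ : Type*) [MetricSpace Γ] : ℤ :=
  (Nat.card (ConnectedComponents {P : Γ // ¬ IsVertex Γ P}) : ℤ)
    - (Nat.card {P : Γ // IsVertex Γ P} : ℤ) + 1

/-- A divisor on `Γ` : a finitely supported formal `ℤ`-linear combination of points. -/
abbrev Divisor (Γ : Type*) : Type _ := Γ →₀ ℤ

/-- The degree of a divisor. -/
def divDeg {Γ : Type*} (D : Divisor Γ) : ℤ := D.sum fun _ n => n

/-- A divisor is effective if all its coefficients are nonnegative. -/
def Effective {Γ : Type*} (D : Divisor Γ) : Prop := ∀ P : Γ, 0 ≤ D P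

/-- An arc based at `P` : an isometric parametrization of a segment emanating from `P`. -/
def IsArcAt {Γ : Type*} [MetricSpace Γ] (P : Γ) (τ : ℝ → Γ) : Prop :=
  τ 0 = P ∧ ∃ a > (0 : ℝ), ∀ s ∈ Set.Icc (0 : ℝ) a, ∀ t ∈ Set.Icc (0 : ℝ) a,
    dist (τ s) (τ t) = |s - t|

/-- Two arcs are equivalent (define the same tangent direction) when they agree near `0`. -/
def ArcEquiv {Γ : Type*} (τ τ' : ℝ → Γ) : Prop :=
  ∃ ε > (0 : ℝ), ∀ t ∈ Set.Icc (0 : ℝ) ε, τ t = τ' t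

/-- `f` has (one-sided) slope `s` along the arc `τ`. -/
def HasSlopeAlong {Γ : Type*} (f : Γ → ℝ) (τ : ℝ → Γ) (s : ℤ) : Prop :=
  ∃ ε > (0 : ℝ), ∀ t ∈ Set.Icc (0 : ℝ) ε, f (τ t) = f (τ 0) + (s : ℝ) * t

/-- A rational function on a metric graph: continuous and piecewise affine with
integer slopes, i.e. having an integer slope along every arc. -/
def IsRational (Γ : Type*) [MetricSpace Γ] (f : Γ → ℝ) : Prop :=
  Continuous f ∧ ∀ (P : Γ) (τ : ℝ → Γ), IsArcAt P τ → ∃ s : ℤ, HasSlopeAlong f τ s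

/-- `div f` has coefficient `m` at `P`: the sum of the slopes of `f` in all tangent
directions emanating from `P` equals `m`. -/
def HasOrderAt (Γ : Type*) [MetricSpace Γ] (f : Γ → ℝ) (P : Γ) (m : ℤ) : Prop :=
  ∃ (n : ℕ) (τ : Fin n → ℝ → Γ) (s : Fin n → ℤ),
    (∀ i, IsArcAt P (τ i)) ∧
    Pairwise (fun i j => ¬ ArcEquiv (τ i) (τ j)) ∧
    (∀ σ : ℝ → Γ, IsArcAt P σ → ∃ i, ArcEquiv σ (τ i)) ∧
    (∀ i, HasSlopeAlong f (τ i) (s i)) ∧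
    m = ∑ i, s i

/-- Linear equivalence of divisors: `D₂ - D₁ = div f` for some rational function `f`. -/
def LinEquiv (Γ : Type*) [MetricSpace Γ] (D₁ D₂ : Divisor Γ) : Prop :=
  ∃ f : Γ → ℝ, IsRational Γ f ∧ ∀ P : Γ, HasOrderAt Γ f P (D₂ P - D₁ P)

/-- `D` is linearly equivalent to an effective divisor. -/
def EquivEffective (Γ : Type*) [MetricSpace Γ] (D : Divisor Γ) : Prop :=
  ∃ D' : Divisor Γ, Effective D' ∧ LinEquiv Γ D D'

/-- For every effective divisor `E` of degree `r`, `D - E` is linearly equivalent to an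
effective divisor. -/
def RankGE (Γ : Type*) [MetricSpace Γ] (D : Divisor Γ) (r : ℕ) : Prop :=
  ∀ E : Divisor Γ, Effective E → divDeg E = (r : ℤ) → EquivEffective Γ (D - E)

/-- The rank of a divisor: `-1` if `D` is not equivalent to an effective divisor, and
otherwise the largest `r ≥ 0` such that `D - E` is equivalent to an effective divisor
for every effective `E` of degree `r`. -/
noncomputable def divRank (Γ : Type*) [MetricSpace Γ] (D : Divisor Γ) : ℤ :=
  sSup (insert (-1) {n : ℤ | ∃ r : ℕ, n = (r : ℤ) ∧ RankGE Γ D r})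

/-- The arc `τ` immediately leaves the set `X`. -/
def ArcLeaves {Γ : Type*} (X : Set Γ) (τ : ℝ → Γ) : Prop :=
  ∃ ε > (0 : ℝ), ∀ t ∈ Set.Ioc (0 : ℝ) ε, τ t ∉ X

/-- `P` is a non-saturated boundary point of `X` with respect to `D` : the number of
tangent directions at `P` leaving `X` is strictly greater than `D P`. -/
def NonSaturated (Γ : Type*) [MetricSpace Γ] (D : Divisor Γ) (X : Set Γ) (P : Γ) : Prop :=
  P ∈ frontier X ∧ ∃ (n : ℕ) (τ : Fin n → ℝ → Γ),
    (∀ i, IsArcAt P (τ i)) ∧ (∀ i, ArcLeaves X (τ i)) ∧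
    Pairwise (fun i j => ¬ ArcEquiv (τ i) (τ j)) ∧ D P < (n : ℤ)

/-- `D` is `P₀`-reduced. -/
def IsReducedDivisor (Γ : Type*) [MetricSpace Γ] (D : Divisor Γ) (P₀ : Γ) : Prop :=
  (∀ P : Γ, P ≠ P₀ → 0 ≤ D P) ∧
  ∀ X : Set Γ, IsClosed X → X.Nonempty → P₀ ∉ X → ∃ P, NonSaturated Γ D X P

/-- The restriction of a divisor on `Γ` to a divisor on a subset `S` (with the induced
metric); divisors supported on `S` are identified with divisors on `S` this way. -/
noncomputable def DivRestrict {Γ : Type*} (S : Set Γ) (D : Divisor Γ) : Divisor ↥S :=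
  Finsupp.comapDomain Subtype.val D Subtype.coe_injective.injOn

/-- Linear equivalence computed on the subgraph `S` of `Γ`. -/
def LinEquivOn {Γ : Type*} [MetricSpace Γ] (S : Set Γ) (D₁ D₂ : Divisor Γ) : Prop :=
  LinEquiv ↥S (DivRestrict S D₁) (DivRestrict S D₂)

/-- The rank computed on the subgraph `S` of `Γ`. -/
noncomputable def divRankOn {Γ : Type*} [MetricSpace Γ] (S : Set Γ) (D : Divisor Γ) : ℤ :=
  divRank ↥S (DivRestrict S D)

/-- A free divisor: effective, of rank at least one, and removing any point decreases
the rank. -/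
def IsFreeDivisor (Γ : Type*) [MetricSpace Γ] (D : Divisor Γ) : Prop :=
  Effective D ∧ 1 ≤ divRank Γ D ∧
  ∀ P : Γ, divRank Γ (D - Finsupp.single P 1) < divRank Γ D

/-- The canonical divisor `K_Γ = Σ_P (val(P) - 2)·P`. -/
def IsCanonical (Γ : Type*) [MetricSpace Γ] (K : Divisor Γ) : Prop :=
  ∀ P : Γ, K P = (valence Γ P : ℤ) - 2

/-- A very special divisor: effective with `rk(D) > 0` and `rk(K_Γ - D) > 0`. -/
def VerySpecial (Γ : Type*) [MetricSpace Γ] (D : Divisor Γ) : Prop :=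
  Effective D ∧ 0 < divRank Γ D ∧
  ∃ K : Divisor Γ, IsCanonical Γ K ∧ 0 < divRank Γ (K - D)

/-- `φ` is an `L`-periodic locally isometric parametrization of the circle `S ⊆ Γ`
of circumference `L`. -/
def CircleParam {Γ : Type*} [MetricSpace Γ] (S : Set Γ) (L : ℝ) (φ : ℝ → Γ) : Prop :=
  0 < L ∧ (∀ t : ℝ, φ (t + L) = φ t) ∧ Set.range φ = S ∧
  ∀ s t : ℝ, |s - t| ≤ L / 2 → dist (φ s) (φ t) = |s - t|

/-- `S` is a metric circle inside `Γ`. -/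
def IsCircleSet {Γ : Type*} [MetricSpace Γ] (S : Set Γ) : Prop :=
  ∃ (L : ℝ) (φ : ℝ → Γ), CircleParam S L φ

end
/-- A bundled metric graph. -/
structure MetricGraph : Type 1 where
  carrier : Type
  [ms : MetricSpace carrier]
  graph : IsMetricGraph carrier

attribute [instance] MetricGraph.ms

/-- A metric graph `G` obtained from a metric graph `G₀` by attaching a loop `γ`
(a metric circle) at a point `v ∈ G₀`. -/
structure LoopAttachment : Type 1 where
  G : Type
  [ms : MetricSpace G]
  graph : IsMetricGraph G
  G₀ : Set G
  γ : Set G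
  v : G
  hv : v ∈ G₀
  closed₀ : IsClosed G₀
  closedγ : IsClosed γ
  cover : G₀ ∪ γ = Set.univ
  meet : G₀ ∩ γ = {v}
  graph₀ : IsMetricGraph ↥G₀
  circleγ : IsCircleSet γ

attribute [instance] LoopAttachment.ms

section

open Set Filter Topology

/-- A family of arcs at `P` representing every tangent direction exactly once. -/
def CompleteArcs {Γ ι : Type*} [MetricSpace Γ] (P : Γ) (τ : ι → ℝ → Γ) : Prop :=
  (∀ i, IsArcAt P (τ i)) ∧ Pairwise (fun i j => ¬ ArcEquiv (τ i) (τ j)) ∧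
    ∀ σ : ℝ → Γ, IsArcAt P σ → ∃ i, ArcEquiv σ (τ i)

section Arcs

variable {Γ ι κ : Type*}

lemma ArcEquiv.symm {τ σ : ℝ → Γ} (h : ArcEquiv τ σ) : ArcEquiv σ τ := by
  obtain ⟨ε, hε, h⟩ := h
  exact ⟨ε, hε, fun t ht => (h t ht).symm⟩

lemma ArcEquiv.trans {τ σ ρ : ℝ → Γ} (h : ArcEquiv τ σ) (h' : ArcEquiv σ ρ) : ArcEquiv τ ρ := by
  obtain ⟨ε, hε, h⟩ := h
  obtain ⟨ε', hε', h'⟩ := h'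
  refine ⟨min ε ε', lt_min hε hε', fun t ht => ?_⟩
  rw [h t ⟨ht.1, ht.2.trans (min_le_left _ _)⟩, h' t ⟨ht.1, ht.2.trans (min_le_right _ _)⟩]

lemma HasSlopeAlong.congr {f : Γ → ℝ} {τ σ : ℝ → Γ} {s : ℤ} (h : HasSlopeAlong f τ s)
    (e : ArcEquiv τ σ) : HasSlopeAlong f σ s := by
  obtain ⟨ε, hε, h⟩ := h
  obtain ⟨δ, hδ, e⟩ := e
  refine ⟨min ε δ, lt_min hε hδ, fun t ht => ?_⟩
  rw [← e t ⟨ht.1, ht.2.trans (min_le_right _ _)⟩, ← e 0 ⟨le_rfl, hδ.le⟩,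
    h t ⟨ht.1, ht.2.trans (min_le_left _ _)⟩]

lemma HasSlopeAlong.add {f g : Γ → ℝ} {τ : ℝ → Γ} {s s' : ℤ} (h : HasSlopeAlong f τ s)
    (h' : HasSlopeAlong g τ s') : HasSlopeAlong (f + g) τ (s + s') := by
  obtain ⟨ε, hε, h⟩ := h
  obtain ⟨δ, hδ, h'⟩ := h'
  refine ⟨min ε δ, lt_min hε hδ, fun t ht => ?_⟩
  rw [Pi.add_apply, h t ⟨ht.1, ht.2.trans (min_le_left _ _)⟩,
    h' t ⟨ht.1, ht.2.trans (min_le_right _ _)⟩, Pi.add_apply]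
  push_cast
  ring

lemma HasSlopeAlong.neg {f : Γ → ℝ} {τ : ℝ → Γ} {s : ℤ} (h : HasSlopeAlong f τ s) :
    HasSlopeAlong (-f) τ (-s) := by
  obtain ⟨ε, hε, h⟩ := h
  refine ⟨ε, hε, fun t ht => ?_⟩
  rw [Pi.neg_apply, h t ht, Pi.neg_apply]
  push_cast
  ring

variable [MetricSpace Γ]

lemma CompleteArcs.exists_equiv {P : Γ} {τ : ι → ℝ → Γ} {σ : κ → ℝ → Γ} (h : CompleteArcs P τ)
    (h' : CompleteArcs P σ) : ∃ e : ι ≃ κ, ∀ i, ArcEquiv (τ i) (σ (e i)) := by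
  choose a ha using fun i => h'.2.2 (τ i) (h.1 i)
  have inj : Function.Injective a := by
    intro i j hij
    by_contra hne
    exact h.2.1 hne ((ha i).trans (hij ▸ (ha j).symm))
  have surj : Function.Surjective a := by
    intro k
    obtain ⟨i, hi⟩ := h.2.2 (σ k) (h'.1 k)
    refine ⟨i, ?_⟩
    by_contra hne
    exact h'.2.1 hne ((ha i).symm.trans hi.symm)
  exact ⟨Equiv.ofBijective a ⟨inj, surj⟩, ha⟩

lemma CompleteArcs.comp_equiv {P : Γ} {τ : ι → ℝ → Γ} (h : CompleteArcs P τ) (e : κ ≃ ι) :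
    CompleteArcs P (τ ∘ e) := by
  refine ⟨fun i => h.1 _, fun i j hij => h.2.1 (e.injective.ne hij), fun σ hσ => ?_⟩
  obtain ⟨i, hi⟩ := h.2.2 σ hσ
  exact ⟨e.symm i, by simpa using hi⟩

lemma CompleteArcs.hasOrderAt_iff [Fintype ι] {P : Γ} {τ : ι → ℝ → Γ} (h : CompleteArcs P τ)
    {f : Γ → ℝ} {m : ℤ} :
    HasOrderAt Γ f P m ↔ ∃ s : ι → ℤ, (∀ i, HasSlopeAlong f (τ i) (s i)) ∧ m = ∑ i, s i := by
  constructor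
  · rintro ⟨n, σ, s, h1, h2, h3, hs, rfl⟩
    obtain ⟨e, he⟩ := h.exists_equiv (show CompleteArcs P σ from ⟨h1, h2, h3⟩)
    exact ⟨s ∘ e, fun i => (hs (e i)).congr (he i).symm, (Equiv.sum_comp e s).symm⟩
  · rintro ⟨s, hs, rfl⟩
    have h' := h.comp_equiv (Fintype.equivFin ι).symm
    exact ⟨_, _, s ∘ (Fintype.equivFin ι).symm, h'.1, h'.2.1, h'.2.2, fun i => hs _,
      (Equiv.sum_comp _ s).symm⟩

lemma CompleteArcs.hasSlope {P : Γ} {τ : ι → ℝ → Γ} (h : CompleteArcs P τ)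
    {f : Γ → ℝ} {s : ι → ℤ} (hs : ∀ i, HasSlopeAlong f (τ i) (s i)) {σ : ℝ → Γ}
    (hσ : IsArcAt P σ) : ∃ m : ℤ, HasSlopeAlong f σ m := by
  obtain ⟨i, hi⟩ := h.2.2 σ hσ
  exact ⟨s i, (hs i).congr hi.symm⟩

end Arcs

/-- `φ` identifies the neighbourhood `U` of `P` isometrically with the union of the rays of length
`r` in the directions `A`. -/
structure StarChart {Γ : Type*} [MetricSpace Γ] (P : Γ) (A : Finset ℂ) (r : ℝ) (U : Set Γ)
    (φ : Γ → ℂ) : Prop where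
  pos : 0 < r
  nhds : U ∈ 𝓝 P
  map_base : φ P = 0
  image : φ '' U = {z | ∃ t ∈ Icc (0 : ℝ) r, ∃ u ∈ A, z = t * u}
  isometry : ∀ x ∈ U, ∀ y ∈ U, dist (φ x) (φ y) = dist x y
  unit : ∀ u ∈ A, ‖u‖ = 1

lemma eq_of_norm_sub_eq {u v : ℂ} (hu : ‖u‖ = 1) (hv : ‖v‖ = 1) {s t : ℝ} (hs : 0 < s) (ht : 0 < t)
    (h : ‖(s : ℂ) * u - t * v‖ = |s - t|) : u = v := by
  have h2 : ‖(s : ℂ) * u - t * v‖ ^ 2 = (s - t) ^ 2 := by rw [h, sq_abs]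
  have hu2 : u.re * u.re + u.im * u.im = 1 := by
    rw [← Complex.normSq_apply, ← Complex.sq_norm, hu, one_pow]
  have hv2 : v.re * v.re + v.im * v.im = 1 := by
    rw [← Complex.normSq_apply, ← Complex.sq_norm, hv, one_pow]
  rw [Complex.sq_norm, Complex.normSq_apply] at h2
  simp only [Complex.sub_re, Complex.mul_re, Complex.ofReal_re, Complex.ofReal_im, Complex.sub_im,
    Complex.mul_im, zero_mul, sub_zero, add_zero] at h2
  have h3 : (s * t) * ((u.re - v.re) ^ 2 + (u.im - v.im) ^ 2) = 0 := by
    linear_combination h2 + (s * t - s ^ 2) * hu2 + (s * t - t ^ 2) * hv2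
  have h4 : (u.re - v.re) ^ 2 + (u.im - v.im) ^ 2 = 0 :=
    (mul_eq_zero.1 h3).resolve_left (mul_pos hs ht).ne'
  apply Complex.ext <;> nlinarith [sq_nonneg (u.re - v.re), sq_nonneg (u.im - v.im)]

namespace StarChart

variable {Γ : Type*} [MetricSpace Γ] {P : Γ} {A : Finset ℂ} {r : ℝ} {U : Set Γ} {φ : Γ → ℂ}

/-- The ray of a star chart in a given direction. -/
noncomputable def ray (_ : StarChart P A r U φ) (u : ℂ) (t : ℝ) : Γ :=
  open Classical in if h : ∃ Q ∈ U, φ Q = t * u then h.choose else P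

variable (h : StarChart P A r U φ)

lemma ray_spec {u : ℂ} (hu : u ∈ A) {t : ℝ} (ht : t ∈ Icc 0 r) :
    h.ray u t ∈ U ∧ φ (h.ray u t) = t * u := by
  have hex : ∃ Q ∈ U, φ Q = t * u := by
    have : (t : ℂ) * u ∈ φ '' U := by
      rw [h.image]
      exact ⟨t, ht, u, hu, rfl⟩
    exact this
  unfold ray
  rw [dif_pos hex]
  exact hex.choose_spec

lemma injOn (h : StarChart P A r U φ) : InjOn φ U := fun x hx y hy hxy => by
  rw [← dist_eq_zero, ← h.isometry x hx y hy, hxy, dist_self]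

lemma base_mem (h : StarChart P A r U φ) : P ∈ U := mem_of_mem_nhds h.nhds

lemma ray_zero {u : ℂ} (hu : u ∈ A) : h.ray u 0 = P := by
  have := h.ray_spec hu (t := 0) ⟨le_rfl, h.pos.le⟩
  exact h.injOn this.1 h.base_mem (by rw [this.2, h.map_base]; simp)

lemma isArcAt_ray {u : ℂ} (hu : u ∈ A) : IsArcAt P (h.ray u) := by
  refine ⟨h.ray_zero hu, r, h.pos, fun s hs t ht => ?_⟩
  have h1 := h.ray_spec hu hs
  have h2 := h.ray_spec hu ht
  rw [← h.isometry _ h1.1 _ h2.1, h1.2, h2.2, dist_eq_norm, ← sub_mul, norm_mul, h.unit u hu,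
    mul_one, ← Complex.ofReal_sub, Complex.norm_real, Real.norm_eq_abs]

lemma exists_eq_ray {Q : Γ} (hQ : Q ∈ U) : ∃ u ∈ A, dist Q P ≤ r ∧ Q = h.ray u (dist Q P) := by
  have : φ Q ∈ φ '' U := ⟨Q, hQ, rfl⟩
  rw [h.image] at this
  obtain ⟨t, ht, u, hu, e⟩ := this
  have h1 := h.ray_spec hu ht
  have hd : dist Q P = t := by
    rw [← h.isometry _ hQ _ h.base_mem, h.map_base, e, dist_zero_right, norm_mul, h.unit u hu,
      mul_one, Complex.norm_real, Real.norm_eq_abs, abs_of_nonneg ht.1]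
  refine ⟨u, hu, hd ▸ ht.2, ?_⟩
  rw [hd]
  exact h.injOn hQ h1.1 (e.trans h1.2.symm)

lemma eventually {p : Γ → Prop}
    (hp : ∀ u ∈ A, ∃ ε > (0 : ℝ), ∀ t ∈ Icc (0 : ℝ) ε, p (h.ray u t)) : ∀ᶠ Q in 𝓝 P, p Q := by
  have key : ∀ u ∈ A, ∀ᶠ Q in 𝓝 P, p (h.ray u (dist Q P)) := by
    intro u hu
    obtain ⟨ε, hε, H⟩ := hp u hu
    filter_upwards [Metric.ball_mem_nhds P hε] with Q hQ
    exact H _ ⟨dist_nonneg, (Metric.mem_ball.1 hQ).le⟩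
  filter_upwards [h.nhds, (Finset.eventually_all A).2 key] with Q hQ hall
  obtain ⟨u, hu, -, e⟩ := h.exists_eq_ray hQ
  rw [e]
  exact hall u hu

lemma completeArcs : CompleteArcs P (fun u : A => h.ray u) := by
  refine ⟨fun u => h.isArcAt_ray u.2, ?_, ?_⟩
  · rintro ⟨u, hu⟩ ⟨v, hv⟩ hne ⟨ε, hε, e⟩
    apply hne
    have ht : min ε r ∈ Icc 0 r := ⟨(lt_min hε h.pos).le, min_le_right _ _⟩
    have e1 := e (min ε r) ⟨ht.1, min_le_left _ _⟩
    have e2 : ((min ε r : ℝ) : ℂ) * u = (min ε r : ℝ) * v := by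
      rw [← (h.ray_spec hu ht).2, ← (h.ray_spec hv ht).2]
      exact congrArg φ e1
    have : ((min ε r : ℝ) : ℂ) ≠ 0 := Complex.ofReal_ne_zero.2 (lt_min hε h.pos).ne'
    exact Subtype.ext (mul_left_cancel₀ this e2)
  · rintro σ ⟨h0, a, ha, hσ⟩
    have hd : ∀ t ∈ Icc 0 a, dist (σ t) P = t := by
      intro t ht
      rw [← h0, hσ t ht 0 ⟨le_rfl, ha.le⟩, sub_zero, abs_of_nonneg ht.1]
    obtain ⟨δ, hδ, hball⟩ := Metric.mem_nhds_iff.1 h.nhds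
    set b := min a (δ / 2) with hb
    have hb0 : 0 < b := lt_min ha (by positivity)
    have hmem : ∀ t ∈ Icc 0 b, ∃ u ∈ A, t ≤ r ∧ σ t = h.ray u t := by
      intro t ht
      have hta : t ∈ Icc 0 a := ⟨ht.1, ht.2.trans (min_le_left _ _)⟩
      have hU : σ t ∈ U := by
        apply hball
        rw [Metric.mem_ball, hd t hta]
        have := ht.2.trans (min_le_right a (δ / 2))
        linarith
      have := h.exists_eq_ray hU
      rwa [hd t hta] at this
    obtain ⟨u, hu, hbr, eu⟩ := hmem b ⟨hb0.le, le_rfl⟩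
    refine ⟨⟨u, hu⟩, b, hb0, fun t ht => ?_⟩
    obtain ⟨v, hv, htr, ev⟩ := hmem t ht
    change σ t = h.ray u t
    rcases ht.1.eq_or_lt with rfl | htpos
    · rw [h0, h.ray_zero hu]
    have s1 := h.ray_spec hu (t := b) ⟨hb0.le, hbr⟩
    have s2 := h.ray_spec hv (t := t) ⟨ht.1, htr⟩
    have hdist := hσ b ⟨hb0.le, min_le_left _ _⟩ t ⟨ht.1, ht.2.trans (min_le_left _ _)⟩
    rw [eu, ev, ← h.isometry _ s1.1 _ s2.1, s1.2, s2.2, dist_eq_norm] at hdist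
    rw [ev, eq_of_norm_sub_eq (h.unit u hu) (h.unit v hv) hb0 htpos hdist]

lemma card_eq (h : StarChart P A r U φ) {B : Finset ℂ} {r' : ℝ} {U' : Set Γ} {φ' : Γ → ℂ}
    (h' : StarChart P B r' U' φ') : A.card = B.card := by
  obtain ⟨e, -⟩ := h.completeArcs.exists_equiv h'.completeArcs
  simpa using Fintype.card_congr e

lemma rotate (h : StarChart P A r U φ) {c : ℂ} (hc : ‖c‖ = 1) :
    StarChart P (A.image (c * ·)) r U (fun Q => c * φ Q) where
  pos := h.pos
  nhds := h.nhds
  map_base := by simp [h.map_base]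
  image := by
    have : (fun Q => c * φ Q) '' U = (c * ·) '' (φ '' U) := by rw [image_image]
    rw [this, h.image]
    ext z
    simp only [mem_image, mem_ofPred_eq, Finset.mem_image]
    constructor
    · rintro ⟨_, ⟨t, ht, u, hu, rfl⟩, rfl⟩
      exact ⟨t, ht, c * u, ⟨u, hu, rfl⟩, by ring⟩
    · rintro ⟨t, ht, _, ⟨u, hu, rfl⟩, rfl⟩
      exact ⟨t * u, ⟨t, ht, u, hu, rfl⟩, by ring⟩
  isometry x hx y hy := by
    rw [← h.isometry x hx y hy, dist_eq_norm, dist_eq_norm, ← mul_sub, norm_mul, hc, one_mul]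
  unit u hu := by
    obtain ⟨v, hv, rfl⟩ := Finset.mem_image.1 hu
    rw [norm_mul, hc, h.unit v hv, one_mul]

end StarChart

/-- The directions of the rays of the standard star with `n` rays. -/
noncomputable def starDirs (n : ℕ) : Finset ℂ :=
  (Finset.range n).image fun k : ℕ => Complex.exp (2 * Real.pi * Complex.I / n) ^ k

lemma card_starDirs {n : ℕ} (hn : 1 ≤ n) : (starDirs n).card = n := by
  unfold starDirs
  rw [Finset.card_image_of_injOn, Finset.card_range]
  have := Complex.isPrimitiveRoot_exp n (by omega)
  intro i hi j hj hij
  exact this.pow_inj (by simpa using hi) (by simpa using hj) hij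

lemma starSet_eq {n : ℕ} (hn : 1 ≤ n) (r : ℝ) :
    starSet n r = {z | ∃ t ∈ Icc (0 : ℝ) r, ∃ u ∈ starDirs n, z = t * u} := by
  have hprim := Complex.isPrimitiveRoot_exp n (by omega)
  have hexp : ∀ k : ℤ, Complex.exp (2 * (Real.pi : ℂ) * Complex.I * (k : ℂ) / (n : ℂ)) =
      Complex.exp (2 * Real.pi * Complex.I / n) ^ k := by
    intro k
    rw [← Complex.exp_int_mul]
    congr 1
    ring
  have hn0 : (n : ℤ) ≠ 0 := by omega
  ext z
  unfold starSet starDirs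
  simp only [mem_ofPred_eq, Finset.mem_image, Finset.mem_range]
  constructor
  · rintro ⟨t, ht, k, rfl⟩
    refine ⟨t, ht, _, ⟨(k % n).toNat, ?_, rfl⟩, ?_⟩
    · have := Int.emod_lt_of_pos k (show (0 : ℤ) < n by omega)
      omega
    · rw [hexp]
      congr 1
      have h0 : ((k % n).toNat : ℤ) = k % n := Int.toNat_of_nonneg (Int.emod_nonneg k hn0)
      rw [← zpow_natCast, h0]
      conv_lhs => rw [← Int.emod_add_mul_ediv k n]
      rw [zpow_add₀ (Complex.exp_ne_zero _), zpow_mul, zpow_natCast, hprim.pow_eq_one, one_zpow,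
        mul_one]
  · rintro ⟨t, ht, _, ⟨k, hk, rfl⟩, rfl⟩
    exact ⟨t, ht, k, by rw [hexp, zpow_natCast]⟩

section

variable {Γ : Type*} [MetricSpace Γ] {P : Γ}

lemma HasStarNbhd.exists_starChart {n : ℕ} (hn : 1 ≤ n) (h : HasStarNbhd Γ P n) :
    ∃ r U φ, StarChart P (starDirs n) r U φ := by
  obtain ⟨r, hr, U, hU, φ, h0, him, hiso⟩ := h
  refine ⟨r, U, φ, hr, hU, h0, him.trans (starSet_eq hn r), hiso, fun u hu => ?_⟩
  obtain ⟨k, -, rfl⟩ := Finset.mem_image.1 hu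
  have hprim := Complex.isPrimitiveRoot_exp n (by omega)
  rw [norm_pow, hprim.norm'_eq_one (by omega), one_pow]

lemma StarChart.hasStarNbhd {n : ℕ} (hn : 1 ≤ n) {r : ℝ} {U : Set Γ} {φ : Γ → ℂ}
    (h : StarChart P (starDirs n) r U φ) : HasStarNbhd Γ P n :=
  ⟨r, h.pos, U, h.nhds, φ, h.map_base, h.image.trans (starSet_eq hn r).symm, h.isometry⟩

lemma HasStarNbhd.valence_eq {n : ℕ} (hn : 1 ≤ n) (h : HasStarNbhd Γ P n) : valence Γ P = n := by
  have : {m : ℕ | 1 ≤ m ∧ HasStarNbhd Γ P m} = {n} := by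
    ext m
    constructor
    · rintro ⟨hm, h'⟩
      obtain ⟨r, U, φ, c⟩ := h.exists_starChart hn
      obtain ⟨r', U', φ', c'⟩ := h'.exists_starChart hm
      have := c.card_eq c'
      rw [card_starDirs hn, card_starDirs hm] at this
      exact this.symm
    · rintro rfl
      exact ⟨hn, h⟩
  rw [valence, this, csInf_singleton]

end

section LinearEquivalence

variable {Γ : Type*} [MetricSpace Γ]

lemma IsMetricGraph.exists_completeArcs (hΓ : IsMetricGraph Γ) (P : Γ) :
    ∃ (A : Finset ℂ) (τ : A → ℝ → Γ), CompleteArcs P τ := by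
  obtain ⟨n, hn, h⟩ := hΓ.2.2 P
  obtain ⟨r, U, φ, c⟩ := h.exists_starChart hn
  exact ⟨_, _, c.completeArcs⟩

lemma IsMetricGraph.linEquiv_refl (hΓ : IsMetricGraph Γ) (D : Divisor Γ) : LinEquiv Γ D D := by
  have h0 : ∀ τ : ℝ → Γ, HasSlopeAlong (fun _ : Γ => (0 : ℝ)) τ 0 := fun τ =>
    ⟨1, one_pos, fun t _ => by simp⟩
  refine ⟨fun _ => 0, ⟨continuous_const, fun P τ _ => ⟨0, h0 τ⟩⟩, fun P => ?_⟩
  obtain ⟨A, τ, h⟩ := hΓ.exists_completeArcs P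
  exact h.hasOrderAt_iff.2 ⟨fun _ => 0, fun i => h0 _, by simp⟩

lemma IsMetricGraph.linEquiv_symm (hΓ : IsMetricGraph Γ) {D D' : Divisor Γ}
    (H : LinEquiv Γ D D') : LinEquiv Γ D' D := by
  obtain ⟨f, hf, hD⟩ := H
  refine ⟨-f, ⟨hf.1.neg, fun P τ hτ => ?_⟩, fun P => ?_⟩
  · obtain ⟨s, hs⟩ := hf.2 P τ hτ
    exact ⟨-s, hs.neg⟩
  · obtain ⟨A, τ, h⟩ := hΓ.exists_completeArcs P
    obtain ⟨s, hs, e⟩ := h.hasOrderAt_iff.1 (hD P)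
    refine h.hasOrderAt_iff.2 ⟨fun i => -s i, fun i => (hs i).neg, ?_⟩
    rw [Finset.sum_neg_distrib, ← e]
    ring

lemma IsMetricGraph.linEquiv_add (hΓ : IsMetricGraph Γ) {D₁ D₁' D₂ D₂' : Divisor Γ}
    (H₁ : LinEquiv Γ D₁ D₁') (H₂ : LinEquiv Γ D₂ D₂') : LinEquiv Γ (D₁ + D₂) (D₁' + D₂') := by
  obtain ⟨f, hf, hD⟩ := H₁
  obtain ⟨g, hg, hD'⟩ := H₂
  refine ⟨f + g, ⟨hf.1.add hg.1, fun P τ hτ => ?_⟩, fun P => ?_⟩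
  · obtain ⟨s, hs⟩ := hf.2 P τ hτ
    obtain ⟨s', hs'⟩ := hg.2 P τ hτ
    exact ⟨s + s', hs.add hs'⟩
  · obtain ⟨A, τ, h⟩ := hΓ.exists_completeArcs P
    obtain ⟨s, hs, e⟩ := h.hasOrderAt_iff.1 (hD P)
    obtain ⟨s', hs', e'⟩ := h.hasOrderAt_iff.1 (hD' P)
    refine h.hasOrderAt_iff.2 ⟨fun i => s i + s' i, fun i => (hs i).add (hs' i), ?_⟩
    rw [Finset.sum_add_distrib, ← e, ← e', Finsupp.add_apply, Finsupp.add_apply]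
    ring

lemma LinEquiv.of_sub_eq {D₁ D₁' D₂ D₂' : Divisor Γ} (H : LinEquiv Γ D₁ D₂)
    (h : D₂' - D₁' = D₂ - D₁) : LinEquiv Γ D₁' D₂' := by
  obtain ⟨f, hf, hD⟩ := H
  refine ⟨f, hf, fun P => ?_⟩
  have := DFunLike.congr_fun h P
  rw [Finsupp.sub_apply, Finsupp.sub_apply] at this
  rw [this]
  exact hD P

lemma IsMetricGraph.linEquiv_trans (hΓ : IsMetricGraph Γ) {D₁ D₂ D₃ : Divisor Γ}
    (H₁ : LinEquiv Γ D₁ D₂) (H₂ : LinEquiv Γ D₂ D₃) : LinEquiv Γ D₁ D₃ :=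
  (hΓ.linEquiv_add H₁ H₂).of_sub_eq (by abel)

lemma IsMetricGraph.linEquiv_sum (hΓ : IsMetricGraph Γ) {ι : Type*} (s : Finset ι)
    {D D' : ι → Divisor Γ} (H : ∀ i ∈ s, LinEquiv Γ (D i) (D' i)) :
    LinEquiv Γ (∑ i ∈ s, D i) (∑ i ∈ s, D' i) := by
  classical
  induction s using Finset.induction_on with
  | empty => simpa using hΓ.linEquiv_refl 0
  | insert i s hi ih =>
    rw [Finset.sum_insert hi, Finset.sum_insert hi]
    exact hΓ.linEquiv_add (H i (Finset.mem_insert_self _ _))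
      (ih fun j hj => H j (Finset.mem_insert_of_mem hj))

lemma IsMetricGraph.equivEffective_congr (hΓ : IsMetricGraph Γ) {D D' : Divisor Γ}
    (H : LinEquiv Γ D D') (h : EquivEffective Γ D') : EquivEffective Γ D := by
  obtain ⟨D'', he, h⟩ := h
  exact ⟨D'', he, hΓ.linEquiv_trans H h⟩

lemma EquivEffective.add_effective {D E : Divisor Γ} (h : EquivEffective Γ D) (hE : Effective E) :
    EquivEffective Γ (D + E) := by
  obtain ⟨D', he, h⟩ := h
  refine ⟨D' + E, fun P => ?_, h.of_sub_eq (by abel)⟩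
  rw [Finsupp.add_apply]
  exact add_nonneg (he P) (hE P)

end LinearEquivalence

section Rank

variable {Γ : Type*}

lemma divDeg_add (D E : Divisor Γ) : divDeg (D + E) = divDeg D + divDeg E :=
  Finsupp.sum_add_index' (fun _ => rfl) fun _ _ _ => rfl

lemma divDeg_single (P : Γ) (n : ℤ) : divDeg (Finsupp.single P n) = n :=
  Finsupp.sum_single_index rfl

lemma divDeg_sum {ι : Type*} (s : Finset ι) (D : ι → Divisor Γ) :
    divDeg (∑ i ∈ s, D i) = ∑ i ∈ s, divDeg (D i) := by
  classical
  induction s using Finset.induction_on with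
  | empty => simp [divDeg]
  | insert i s hi ih => rw [Finset.sum_insert hi, Finset.sum_insert hi, divDeg_add, ih]

lemma effective_single (P : Γ) {n : ℤ} (hn : 0 ≤ n) : Effective (Finsupp.single P n) := by
  classical
  intro Q
  rw [Finsupp.single_apply]
  split_ifs <;> simp [hn]

lemma Effective.add {D E : Divisor Γ} (hD : Effective D) (hE : Effective E) : Effective (D + E) :=
  fun P => by
    rw [Finsupp.add_apply]
    exact add_nonneg (hD P) (hE P)

lemma Effective.sum {ι : Type*} {s : Finset ι} {D : ι → Divisor Γ}
    (h : ∀ i ∈ s, Effective (D i)) : Effective (∑ i ∈ s, D i) := fun P => by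
  rw [Finsupp.finsetSum_apply]
  exact Finset.sum_nonneg fun i hi => h i hi P

/-- An effective divisor of positive degree contains a point. -/
lemma Effective.exists_sub {E : Divisor Γ} (hE : Effective E) {n : ℕ}
    (hd : divDeg E = (n + 1 : ℕ)) :
    ∃ (Q : Γ) (E' : Divisor Γ), Effective E' ∧ divDeg E' = n ∧ E = E' + Finsupp.single Q 1 := by
  classical
  have hne : ∃ Q, E Q ≠ 0 := by
    by_contra! hz
    have : E = 0 := Finsupp.ext hz
    rw [this] at hd
    simp [divDeg] at hd
    omega
  obtain ⟨Q, hQ⟩ := hne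
  have hQ1 : 1 ≤ E Q := by
    have := hE Q
    omega
  refine ⟨Q, E - Finsupp.single Q 1, fun R => ?_, ?_, by abel⟩
  · rw [Finsupp.sub_apply, Finsupp.single_apply]
    split_ifs with h
    · subst h
      omega
    · simpa using hE R
  · have := divDeg_add (E - Finsupp.single Q 1) (Finsupp.single Q 1)
    rw [divDeg_single, sub_add_cancel, hd] at this
    push_cast at this
    omega

variable [MetricSpace Γ]

lemma RankGE.of_succ {D : Divisor Γ} {P : Γ} {n : ℕ} (h : RankGE Γ D (n + 1)) :
    RankGE Γ (D - Finsupp.single P 1) n := by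
  intro E hE hd
  have := h (E + Finsupp.single P 1) (hE.add (effective_single P zero_le_one)) (by
    rw [divDeg_add, divDeg_single, hd]; push_cast; rfl)
  have e : D - Finsupp.single P 1 - E = D - (E + Finsupp.single P 1) := by abel
  rwa [e]

lemma RankGE.of_sub {D : Divisor Γ} {P : Γ} {n : ℕ} (h : RankGE Γ (D - Finsupp.single P 1) n) :
    RankGE Γ D n := by
  intro E hE hd
  have := (h E hE hd).add_effective (effective_single P zero_le_one)
  have e : D - E = D - Finsupp.single P 1 - E + Finsupp.single P 1 := by abel
  rwa [e]

lemma RankGE.anti [Nonempty Γ] {D : Divisor Γ} {m n : ℕ} (h : RankGE Γ D n) (hmn : m ≤ n) :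
    RankGE Γ D m := by
  obtain ⟨P⟩ := ‹Nonempty Γ›
  induction n, hmn using Nat.le_induction with
  | base => exact h
  | succ n _ ih => exact ih (h.of_succ (P := P)).of_sub

/-- If no point can be removed without making the divisor fail to have rank at least `r`, then the
divisor has rank exactly `r`, and removing any point lowers the rank. -/
lemma divRank_eq_of_free [Nonempty Γ] {D : Divisor Γ} {r : ℕ} (h : RankGE Γ D r)
    (h' : ∀ P : Γ, ¬ RankGE Γ (D - Finsupp.single P 1) r) :
    divRank Γ D = r ∧ ∀ P : Γ, divRank Γ (D - Finsupp.single P 1) < r := by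
  have lt_of : ∀ {D' : Divisor Γ} {k n : ℕ}, ¬ RankGE Γ D' k → RankGE Γ D' n → n < k := by
    intro D' k n hk hn
    by_contra! hle
    exact hk (hn.anti hle)
  constructor
  · obtain ⟨P⟩ := ‹Nonempty Γ›
    have hsucc : ¬ RankGE Γ D (r + 1) := fun H => h' P H.of_succ
    have : IsGreatest (insert (-1) {n : ℤ | ∃ r : ℕ, n = (r : ℤ) ∧ RankGE Γ D r}) (r : ℤ) := by
      refine ⟨Or.inr ⟨r, rfl, h⟩, ?_⟩
      rintro n (rfl | ⟨k, rfl, hk⟩)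
      · omega
      · have := lt_of hsucc hk
        omega
    exact this.csSup_eq
  · intro P
    have : divRank Γ (D - Finsupp.single P 1) ≤ (r : ℤ) - 1 := by
      refine csSup_le (Set.insert_nonempty _ _) ?_
      rintro n (rfl | ⟨k, rfl, hk⟩)
      · omega
      · have := lt_of (h' P) hk
        omega
    omega

end Rank

instance fact_zero_lt_four : Fact ((0 : ℝ) < 4) := ⟨by norm_num⟩

/-- The circle of circumference `4`. -/
abbrev Circ : Type := AddCircle (4 : ℝ)

/-- The flat cylinder over the circle of circumference `4`. -/
abbrev Cyl : Type := WithLp 2 (Circ × ℝ)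

/-- The representative in `[-2, 2)` of a point of the circle. -/
noncomputable def circLift (x : Circ) : ℝ := AddCircle.equivIco 4 (-2) x

lemma circLift_mem (x : Circ) : circLift x ∈ Ico (-2 : ℝ) 2 := by
  have := (AddCircle.equivIco (4 : ℝ) (-2) x).2
  norm_num at this
  exact this

@[simp] lemma coe_circLift (x : Circ) : ((circLift x : ℝ) : Circ) = x := AddCircle.coe_equivIco

lemma circLift_coe {t : ℝ} (h1 : -2 ≤ t) (h2 : t < 2) : circLift (t : Circ) = t := by
  have : t ∈ Ico (-2 : ℝ) (-2 + 4) := ⟨h1, by linarith⟩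
  unfold circLift
  rw [AddCircle.equivIco_coe_eq this]

lemma norm_circ_coe {t : ℝ} (h : |t| ≤ 2) : ‖(t : Circ)‖ = |t| := by
  rw [AddCircle.norm_coe_eq_abs_iff _ (by norm_num)]
  norm_num
  exact h

lemma abs_circLift (x : Circ) : |circLift x| ≤ 2 := by
  have := circLift_mem x
  exact abs_le.2 ⟨this.1, this.2.le⟩

lemma norm_circ (x : Circ) : ‖x‖ = |circLift x| := by
  conv_lhs => rw [← coe_circLift x]
  exact norm_circ_coe (abs_circLift x)

lemma circ_coe_eq_zero {t : ℝ} (h : |t| < 4) : (t : Circ) = 0 ↔ t = 0 := by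
  constructor
  · intro h0
    obtain ⟨n, hn⟩ := (AddCircle.coe_eq_zero_iff (4 : ℝ)).1 h0
    rw [zsmul_eq_mul] at hn
    rw [← hn, abs_mul, abs_of_pos (show (0 : ℝ) < 4 by norm_num)] at h
    have h1 : |(n : ℝ)| < 1 := by linarith
    have : n = 0 := Int.abs_lt_one_iff.1 (by exact_mod_cast h1)
    rw [← hn, this]
    simp
  · rintro rfl
    simp

lemma circ_coe_eq {s t : ℝ} (h : |s - t| < 4) : (s : Circ) = t ↔ s = t := by
  rw [← sub_eq_zero, ← AddCircle.coe_sub, circ_coe_eq_zero h, sub_eq_zero]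

namespace Ladder

variable (a e : ℕ)

/-- The level of a rung of the ladder. -/
def Rung (y : ℝ) : Prop := ∃ j : ℤ, -(e : ℤ) ≤ j ∧ j ≤ a ∧ y = j

/-- One can move upwards from `(x, y)` inside the ladder. -/
def Up (x : Circ) (y : ℝ) : Prop :=
  (x = 0 ∧ -1 / 2 ≤ y ∧ y < a + 1 / 2) ∨ (x = (1 : ℝ) ∧ -e - 1 / 2 ≤ y ∧ y < 1 / 2)

/-- One can move downwards from `(x, y)` inside the ladder. -/
def Down (x : Circ) (y : ℝ) : Prop :=
  (x = 0 ∧ -1 / 2 < y ∧ y ≤ a + 1 / 2) ∨ (x = (1 : ℝ) ∧ -e - 1 / 2 < y ∧ y ≤ 1 / 2)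

/-- Membership in the ladder in terms of coordinates. -/
def Mem (x : Circ) (y : ℝ) : Prop :=
  Rung a e y ∨ (x = 0 ∧ -1 / 2 ≤ y ∧ y ≤ a + 1 / 2) ∨ (x = (1 : ℝ) ∧ -e - 1 / 2 ≤ y ∧ y ≤ 1 / 2)

/-- The ladder: circles at the levels `-e, …, a` of the cylinder, joined at the levels `0, …, a` by
a vertical segment over `0` and at the levels `-e, …, 0` by a vertical segment over `1`. -/
def space : Set Cyl := {Q | Mem a e Q.fst Q.snd}

open Classical in
/-- The directions, as unit complex numbers, in which one can move from `(x, y)`. -/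
noncomputable def dirs (x : Circ) (y : ℝ) : Finset ℂ :=
  (if Rung a e y then {1, -1} else ∅) ∪
    ((if Up a e x y then {Complex.I} else ∅) ∪ (if Down a e x y then {-Complex.I} else ∅))

variable {a e}

lemma mem_dirs {x : Circ} {y : ℝ} {u : ℂ} : u ∈ dirs a e x y ↔
    (Rung a e y ∧ (u = 1 ∨ u = -1)) ∨ (Up a e x y ∧ u = Complex.I) ∨
      (Down a e x y ∧ u = -Complex.I) := by
  unfold dirs
  split_ifs <;> simp_all <;> tauto

open Classical in
lemma sum_dirs (x : Circ) (y : ℝ) (s : ℂ → ℤ) : ∑ u ∈ dirs a e x y, s u =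
    (if Rung a e y then s 1 + s (-1) else 0) + ((if Up a e x y then s Complex.I else 0) +
      (if Down a e x y then s (-Complex.I) else 0)) := by
  have h1 : (1 : ℂ) ≠ -1 := by norm_num
  have h2 : (1 : ℂ) ≠ Complex.I := fun h => by simpa using congrArg Complex.re h
  have h3 : (1 : ℂ) ≠ -Complex.I := fun h => by simpa using congrArg Complex.re h
  have h4 : (-1 : ℂ) ≠ Complex.I := fun h => by simpa using congrArg Complex.re h
  have h5 : (-1 : ℂ) ≠ -Complex.I := fun h => by simpa using congrArg Complex.re h
  have h6 : Complex.I ≠ -Complex.I := fun h => by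
    have := congrArg Complex.im h
    norm_num at this
  unfold dirs
  rw [Finset.sum_union, Finset.sum_union]
  · split_ifs <;> simp [h1]
  · split_ifs <;> simp [h6]
  · split_ifs <;> simp [h2.symm, h3.symm, h4.symm, h5.symm]

lemma norm_of_mem_dirs {x : Circ} {y : ℝ} {u : ℂ} (h : u ∈ dirs a e x y) : ‖u‖ = 1 := by
  rcases mem_dirs.1 h with ⟨-, rfl | rfl⟩ | ⟨-, rfl⟩ | ⟨-, rfl⟩ <;> simp

lemma exists_int_radius (y : ℝ) : ∃ ε > (0 : ℝ), ∀ q : ℝ, |q| ≤ ε → ∀ j : ℤ, y + q = j → q = 0 := by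
  rcases eq_or_ne (Int.fract y) 0 with h | h
  · refine ⟨1 / 2, by norm_num, fun q hq j hj => ?_⟩
    have hy : y = ⌊y⌋ := by
      have := Int.floor_add_fract y
      rw [h] at this
      linarith
    have hq' : q = ((j - ⌊y⌋ : ℤ) : ℝ) := by
      push_cast
      linarith
    rw [hq', ← Int.cast_abs] at hq
    have : |j - ⌊y⌋| < 1 := by
      have : ((|j - ⌊y⌋| : ℤ) : ℝ) < 1 := by linarith
      exact_mod_cast this
    rw [hq', Int.abs_lt_one_iff.1 this]
    simp
  · have h0 : 0 < Int.fract y := lt_of_le_of_ne (Int.fract_nonneg y) h.symm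
    have h1 := Int.fract_lt_one y
    refine ⟨min (Int.fract y) (1 - Int.fract y) / 2, by
      have := lt_min h0 (sub_pos.2 h1); linarith, fun q hq j hj => ?_⟩
    exfalso
    have hm1 := min_le_left (Int.fract y) (1 - Int.fract y)
    have hm2 := min_le_right (Int.fract y) (1 - Int.fract y)
    have := abs_le.1 hq
    have hy := Int.floor_add_fract y
    have l1 : (⌊y⌋ : ℝ) < j := by linarith
    have l2 : (j : ℝ) < ⌊y⌋ + 1 := by linarith
    have l1' : ⌊y⌋ < j := by exact_mod_cast l1
    have l2' : j < ⌊y⌋ + 1 := by exact_mod_cast l2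
    omega

lemma exists_circ_radius (x b : Circ) :
    ∃ ε > (0 : ℝ), ∀ p : ℝ, |p| ≤ ε → x + (p : ℝ) = b → p = 0 ∧ x = b := by
  rcases eq_or_ne x b with rfl | h
  · refine ⟨1, one_pos, fun p hp h => ?_⟩
    have : ((p : ℝ) : Circ) = 0 := by simpa using h
    rw [circ_coe_eq_zero (by linarith)] at this
    exact ⟨this, rfl⟩
  · have hn : 0 < ‖b - x‖ := norm_pos_iff.2 (sub_ne_zero.2 h.symm)
    refine ⟨min 1 (‖b - x‖ / 2), lt_min one_pos (by linarith), fun p hp hpx => ?_⟩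
    exfalso
    have h1 := hp.trans (min_le_left _ _)
    have h2 := hp.trans (min_le_right _ _)
    have : ‖b - x‖ = |p| := by
      rw [← hpx, add_sub_cancel_left, norm_circ_coe (by linarith)]
    linarith

lemma exists_le_radius (y k : ℝ) : ∃ ε > (0 : ℝ), ∀ q : ℝ, |q| ≤ ε →
    (y < k → y + q < k) ∧ (k < y → k < y + q) := by
  rcases lt_trichotomy y k with h | h | h
  · refine ⟨(k - y) / 2, by linarith, fun q hq => ⟨fun _ => ?_, fun _ => ?_⟩⟩ <;>
    have := abs_le.1 hq <;> linarith
  · exact ⟨1, one_pos, fun q _ =>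
      ⟨fun h' => absurd h' (by linarith), fun h' => absurd h' (by linarith)⟩⟩
  · refine ⟨(y - k) / 2, by linarith, fun q hq => ⟨fun _ => ?_, fun _ => ?_⟩⟩ <;>
    have := abs_le.1 hq <;> linarith

lemma column_iff {lo hi y q : ℝ} (hlo : (y < lo → y + q < lo) ∧ (lo < y → lo < y + q))
    (hhi : (y < hi → y + q < hi) ∧ (hi < y → hi < y + q)) (hq : q ≠ 0) :
    (lo ≤ y + q ∧ y + q ≤ hi) ↔
      (0 < q ∧ lo ≤ y ∧ y < hi) ∨ (q < 0 ∧ lo < y ∧ y ≤ hi) := by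
  constructor
  · rintro ⟨h1, h2⟩
    have h3 : lo ≤ y := by
      by_contra! h
      linarith [hlo.1 h]
    have h4 : y ≤ hi := by
      by_contra! h
      linarith [hhi.2 h]
    rcases lt_or_gt_of_ne hq with h | h
    · exact Or.inr ⟨h, by linarith, h4⟩
    · exact Or.inl ⟨h, h3, by linarith⟩
  · rintro (⟨h, h1, h2⟩ | ⟨h, h1, h2⟩)
    · exact ⟨by linarith, (hhi.1 h2).le⟩
    · exact ⟨(hlo.2 h1).le, by linarith⟩

/-- Near a point, the ladder is the union of the rays in the available directions. -/
lemma exists_radius {x : Circ} {y : ℝ} (hxy : Mem a e x y) : ∃ ε > (0 : ℝ), ε ≤ 1 ∧ ∀ p q : ℝ,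
    |p| ≤ ε → |q| ≤ ε → (Mem a e (x + (p : ℝ)) (y + q) ↔ (p = 0 ∧ q = 0) ∨ (q = 0 ∧ Rung a e y) ∨
      (p = 0 ∧ 0 < q ∧ Up a e x y) ∨ (p = 0 ∧ q < 0 ∧ Down a e x y)) := by
  obtain ⟨ε1, h1, H1⟩ := exists_int_radius y
  obtain ⟨ε2, h2, H2⟩ := exists_circ_radius x 0
  obtain ⟨ε3, h3, H3⟩ := exists_circ_radius x (1 : ℝ)
  obtain ⟨ε4, h4, H4⟩ := exists_le_radius y (-1 / 2)
  obtain ⟨ε5, h5, H5⟩ := exists_le_radius y (a + 1 / 2)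
  obtain ⟨ε6, h6, H6⟩ := exists_le_radius y (-e - 1 / 2)
  obtain ⟨ε7, h7, H7⟩ := exists_le_radius y (1 / 2)
  have hex : ∃ ε > (0 : ℝ), ε ≤ 1 ∧ ε ≤ ε1 ∧ ε ≤ ε2 ∧ ε ≤ ε3 ∧ ε ≤ ε4 ∧ ε ≤ ε5 ∧ ε ≤ ε6 ∧
      ε ≤ ε7 := by
    refine ⟨min 1 (min ε1 (min ε2 (min ε3 (min ε4 (min ε5 (min ε6 ε7)))))), ?_, ?_⟩
    · simp only [gt_iff_lt, lt_min_iff]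
      exact ⟨one_pos, h1, h2, h3, h4, h5, h6, h7⟩
    · simp only [min_le_iff, le_refl, true_or, or_true, and_self]
  obtain ⟨ε, hε, hε0, k1, k2, k3, k4, k5, k6, k7⟩ := hex
  refine ⟨ε, hε, hε0, fun p q hp hq => ?_⟩
  have cA := fun h0 => column_iff (H4 q (hq.trans k4)) (H5 q (hq.trans k5)) h0
  have cB := fun h0 => column_iff (H6 q (hq.trans k6)) (H7 q (hq.trans k7)) h0
  have e0 : x + (p : ℝ) = 0 ↔ p = 0 ∧ x = 0 :=
    ⟨H2 p (hp.trans k2), by rintro ⟨rfl, rfl⟩; simp⟩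
  have e1 : x + (p : ℝ) = (1 : ℝ) ↔ p = 0 ∧ x = (1 : ℝ) :=
    ⟨H3 p (hp.trans k3), by rintro ⟨rfl, rfl⟩; simp⟩
  rcases eq_or_ne q 0 with rfl | hq0
  · simp only [Mem, add_zero, e0, e1, lt_irrefl, and_false, false_and, or_false, and_true, true_and]
    unfold Mem at hxy
    clear H1 H2 H3 H4 H5 H6 H7 cA cB e0 e1
    constructor
    · rintro (h | ⟨⟨h, -⟩, -⟩ | ⟨⟨h, -⟩, -⟩)
      exacts [Or.inr h, Or.inl h, Or.inl h]
    · rintro (rfl | h)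
      · simpa using hxy
      · exact Or.inl h
  · have r0 : ¬ Rung a e (y + q) := by
      rintro ⟨j, -, -, hj⟩
      exact hq0 (H1 q (hq.trans k1) j hj)
    simp only [Mem, r0, e0, e1, cA hq0, cB hq0, Up, Down, hq0]
    clear H1 H2 H3 H4 H5 H6 H7 cA cB e0 e1 r0 hxy hp hq
    simp only [false_or, and_false, false_and]
    constructor
    · rintro (⟨⟨h, h'⟩, ⟨h1, h2, h3⟩ | ⟨h1, h2, h3⟩⟩ | ⟨⟨h, h'⟩, ⟨h1, h2, h3⟩ | ⟨h1, h2, h3⟩⟩)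
      · exact Or.inl ⟨h, h1, Or.inl ⟨h', h2, h3⟩⟩
      · exact Or.inr ⟨h, h1, Or.inl ⟨h', h2, h3⟩⟩
      · exact Or.inl ⟨h, h1, Or.inr ⟨h', h2, h3⟩⟩
      · exact Or.inr ⟨h, h1, Or.inr ⟨h', h2, h3⟩⟩
    · rintro (⟨h, h1, ⟨h', h2, h3⟩ | ⟨h', h2, h3⟩⟩ | ⟨h, h1, ⟨h', h2, h3⟩ | ⟨h', h2, h3⟩⟩)
      · exact Or.inl ⟨⟨h, h'⟩, Or.inl ⟨h1, h2, h3⟩⟩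
      · exact Or.inr ⟨⟨h, h'⟩, Or.inl ⟨h1, h2, h3⟩⟩
      · exact Or.inl ⟨⟨h, h'⟩, Or.inr ⟨h1, h2, h3⟩⟩
      · exact Or.inr ⟨⟨h, h'⟩, Or.inr ⟨h1, h2, h3⟩⟩

variable (a e) in
/-- The ladder as a metric space. -/
abbrev Pt : Type := ↥(space a e)

/-- The horizontal coordinate of a point of the ladder. -/
def Pt.x (P : Pt a e) : Circ := P.1.fst

/-- The vertical coordinate of a point of the ladder. -/
def Pt.y (P : Pt a e) : ℝ := P.1.snd

/-- The point of the ladder with given coordinates. -/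
def pt (x : Circ) (y : ℝ) (h : Mem a e x y) : Pt a e := ⟨WithLp.toLp 2 (x, y), h⟩

@[simp] lemma pt_x (x : Circ) (y : ℝ) (h : Mem a e x y) : (pt x y h).x = x := rfl
@[simp] lemma pt_y (x : Circ) (y : ℝ) (h : Mem a e x y) : (pt x y h).y = y := rfl

lemma Pt.mem (P : Pt a e) : Mem a e P.x P.y := P.2

lemma Pt.ext {P Q : Pt a e} (hx : P.x = Q.x) (hy : P.y = Q.y) : P = Q := by
  apply Subtype.ext
  exact WithLp.ofLp_injective 2 (Prod.ext hx hy)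

lemma dist_eq (P Q : Pt a e) : dist P Q = √(‖P.x - Q.x‖ ^ 2 + (P.y - Q.y) ^ 2) := by
  rw [Subtype.dist_eq, WithLp.prod_dist_eq_of_L2, dist_eq_norm, dist_eq_norm, Real.norm_eq_abs,
    sq_abs]
  rfl

/-- The planar coordinate around the point `P`. -/
noncomputable def chart (P Q : Pt a e) : ℂ := ⟨circLift (Q.x - P.x), Q.y - P.y⟩

lemma x_eq (P Q : Pt a e) : Q.x = P.x + ((chart P Q).re : ℝ) := by simp [chart]

lemma y_eq (P Q : Pt a e) : Q.y = P.y + (chart P Q).im := by simp [chart]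

lemma complex_norm_eq (z : ℂ) : ‖z‖ = √(z.re ^ 2 + z.im ^ 2) := by
  rw [Complex.norm_def, Complex.normSq_apply, sq, sq]

lemma norm_chart (P Q : Pt a e) : ‖chart P Q‖ = dist Q P := by
  rw [complex_norm_eq, dist_eq, norm_circ, sq_abs]
  rfl

lemma dist_chart {P Q R : Pt a e} (hQ : dist Q P ≤ 1) (hR : dist R P ≤ 1) :
    dist (chart P Q) (chart P R) = dist Q R := by
  rw [dist_eq_norm, complex_norm_eq, dist_eq]
  rw [← norm_chart] at hQ hR
  have h1 := (Complex.abs_re_le_norm (chart P Q)).trans hQ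
  have h2 := (Complex.abs_re_le_norm (chart P R)).trans hR
  have e1 : Q.x - R.x = (((chart P Q).re - (chart P R).re : ℝ) : Circ) := by
    rw [x_eq P Q, x_eq P R, AddCircle.coe_sub]
    abel
  have e2 : Q.y - R.y = (chart P Q).im - (chart P R).im := by
    rw [y_eq P Q, y_eq P R]
    ring
  rw [e1, norm_circ_coe ((abs_sub _ _).trans (by linarith)), sq_abs, e2, Complex.sub_re,
    Complex.sub_im]

lemma exists_starChart (P : Pt a e) :
    ∃ r U, StarChart P (dirs a e P.x P.y) r U (chart P) := by
  obtain ⟨ε, hε, hε1, H⟩ := exists_radius P.mem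
  refine ⟨ε, Metric.closedBall P ε, hε, Metric.closedBall_mem_nhds P hε, ?_, ?_, ?_, ?_⟩
  · rw [← norm_eq_zero, norm_chart, dist_self]
  · ext z
    constructor
    · rintro ⟨Q, hQ, rfl⟩
      rw [Metric.mem_closedBall, ← norm_chart] at hQ
      have hre := (Complex.abs_re_le_norm (chart P Q)).trans hQ
      have him := (Complex.abs_im_le_norm (chart P Q)).trans hQ
      have hmem := (H _ _ hre him).1 (by rw [← x_eq, ← y_eq]; exact Q.mem)
      have hne : ∃ u, u ∈ dirs a e P.x P.y := by
        have := P.mem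
        rcases this with h | ⟨h0, h1, h2⟩ | ⟨h0, h1, h2⟩
        · exact ⟨1, mem_dirs.2 (Or.inl ⟨h, Or.inl rfl⟩)⟩
        · rcases h2.lt_or_eq with h3 | h3
          · exact ⟨Complex.I, mem_dirs.2 (Or.inr (Or.inl ⟨Or.inl ⟨h0, h1, h3⟩, rfl⟩))⟩
          · refine ⟨-Complex.I, mem_dirs.2 (Or.inr (Or.inr ⟨Or.inl ⟨h0, ?_, h2⟩, rfl⟩))⟩
            have ha : (0 : ℝ) ≤ a := Nat.cast_nonneg a
            linarith
        · rcases h2.lt_or_eq with h3 | h3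
          · exact ⟨Complex.I, mem_dirs.2 (Or.inr (Or.inl ⟨Or.inr ⟨h0, h1, h3⟩, rfl⟩))⟩
          · refine ⟨-Complex.I, mem_dirs.2 (Or.inr (Or.inr ⟨Or.inr ⟨h0, ?_, h2⟩, rfl⟩))⟩
            have he : (0 : ℝ) ≤ e := Nat.cast_nonneg e
            linarith
      rcases hmem with ⟨h1, h2⟩ | ⟨h1, h2⟩ | ⟨h1, h2, h3⟩ | ⟨h1, h2, h3⟩
      · obtain ⟨u, hu⟩ := hne
        refine ⟨0, ⟨le_rfl, hε.le⟩, u, hu, ?_⟩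
        apply Complex.ext <;> simp [h1, h2]
      · rcases le_total 0 (chart P Q).re with h3 | h3
        · refine ⟨(chart P Q).re, ⟨h3, (abs_le.1 hre).2⟩, 1,
            mem_dirs.2 (Or.inl ⟨h2, Or.inl rfl⟩), ?_⟩
          apply Complex.ext <;> simp [h1]
        · refine ⟨-(chart P Q).re, ⟨by linarith, by linarith [(abs_le.1 hre).1]⟩, -1,
            mem_dirs.2 (Or.inl ⟨h2, Or.inr rfl⟩), ?_⟩
          apply Complex.ext <;> simp [h1]
      · refine ⟨(chart P Q).im, ⟨h2.le, (abs_le.1 him).2⟩, Complex.I,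
          mem_dirs.2 (Or.inr (Or.inl ⟨h3, rfl⟩)), ?_⟩
        apply Complex.ext <;> simp [h1]
      · refine ⟨-(chart P Q).im, ⟨by linarith, by linarith [(abs_le.1 him).1]⟩, -Complex.I,
          mem_dirs.2 (Or.inr (Or.inr ⟨h3, rfl⟩)), ?_⟩
        apply Complex.ext <;> simp [h1]
    · rintro ⟨t, ht, u, hu, rfl⟩
      have hre : |((t : ℂ) * u).re| ≤ ε := by
        refine (Complex.abs_re_le_norm _).trans ?_
        rw [norm_mul, norm_of_mem_dirs hu, mul_one, Complex.norm_real, Real.norm_eq_abs,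
          abs_of_nonneg ht.1]
        exact ht.2
      have him : |((t : ℂ) * u).im| ≤ ε := by
        refine (Complex.abs_im_le_norm _).trans ?_
        rw [norm_mul, norm_of_mem_dirs hu, mul_one, Complex.norm_real, Real.norm_eq_abs,
          abs_of_nonneg ht.1]
        exact ht.2
      have hmem : Mem a e (P.x + (((t : ℂ) * u).re : ℝ)) (P.y + ((t : ℂ) * u).im) := by
        refine (H _ _ hre him).2 ?_
        rcases ht.1.eq_or_lt with rfl | htpos
        · simp
        rcases mem_dirs.1 hu with ⟨h, rfl | rfl⟩ | ⟨h, rfl⟩ | ⟨h, rfl⟩ <;>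
          simp [h, htpos]
      have hchart : chart P (pt _ _ hmem) = t * u := by
        apply Complex.ext
        · have := abs_le.1 hre
          simp only [chart, pt_x, add_sub_cancel_left]
          exact circLift_coe (by linarith) (by linarith)
        · simp [chart]
      refine ⟨pt _ _ hmem, ?_, hchart⟩
      rw [Metric.mem_closedBall, ← norm_chart, hchart, norm_mul, norm_of_mem_dirs hu, mul_one,
        Complex.norm_real, Real.norm_eq_abs, abs_of_nonneg ht.1]
      exact ht.2
  · intro Q hQ R hR
    exact dist_chart ((Metric.mem_closedBall.1 hQ).trans hε1)
      ((Metric.mem_closedBall.1 hR).trans hε1)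
  · exact fun u hu => norm_of_mem_dirs hu

/-- `p Q t` holds for the point `Q` at distance `t` from `P` in direction `u`, for all small
`t ≥ 0`. -/
def Along (P : Pt a e) (u : ℂ) (p : Pt a e → ℝ → Prop) : Prop :=
  ∀ᶠ t in 𝓝[≥] (0 : ℝ), ∀ Q : Pt a e, Q.x = P.x + (t * u.re : ℝ) → Q.y = P.y + t * u.im → p Q t

section Chart

variable {P : Pt a e} {r : ℝ} {U : Set (Pt a e)}

lemma ray_coords (c : StarChart P (dirs a e P.x P.y) r U (chart P)) {u : ℂ}
    (hu : u ∈ dirs a e P.x P.y) {t : ℝ} (ht : t ∈ Icc 0 r) :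
    (c.ray u t).x = P.x + (t * u.re : ℝ) ∧ (c.ray u t).y = P.y + t * u.im := by
  rw [x_eq P (c.ray u t), y_eq P (c.ray u t), (c.ray_spec hu ht).2]
  simp

lemma Along.ray {u : ℂ} {p : Pt a e → ℝ → Prop} (h : Along P u p)
    (c : StarChart P (dirs a e P.x P.y) r U (chart P)) (hu : u ∈ dirs a e P.x P.y) :
    ∃ ε > (0 : ℝ), ∀ t ∈ Icc (0 : ℝ) ε, p (c.ray u t) t := by
  obtain ⟨ε, hε, H⟩ := mem_nhdsGE_iff_exists_Icc_subset.1 h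
  refine ⟨min ε r, lt_min hε c.pos, fun t ht => ?_⟩
  have hc := ray_coords c hu (t := t) ⟨ht.1, ht.2.trans (min_le_right _ _)⟩
  exact H ⟨ht.1, ht.2.trans (min_le_left _ _)⟩ _ hc.1 hc.2

end Chart

lemma eventually_of_along {P : Pt a e} {p : Pt a e → Prop}
    (h : ∀ u ∈ dirs a e P.x P.y, Along P u fun Q _ => p Q) : ∀ᶠ Q in 𝓝 P, p Q := by
  obtain ⟨r, U, c⟩ := exists_starChart P
  exact c.eventually fun u hu => (h u hu).ray c hu

/-- `f` has slope `s u` in every direction `u` at `P`. -/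
def HasSlopes (f : Pt a e → ℝ) (P : Pt a e) (s : ℂ → ℤ) : Prop :=
  ∀ u ∈ dirs a e P.x P.y, Along P u fun Q t => f Q = f P + s u * t

lemma HasSlopes.continuousAt {f : Pt a e → ℝ} {P : Pt a e} {s : ℂ → ℤ} (h : HasSlopes f P s) :
    ContinuousAt f P := by
  rw [Metric.continuousAt_iff']
  intro ε hε
  apply eventually_of_along
  intro u hu
  have h1 : ∀ᶠ t in 𝓝[≥] (0 : ℝ), |(s u : ℝ) * t| < ε := by
    have : Tendsto (fun t : ℝ => |(s u : ℝ) * t|) (𝓝[≥] 0) (𝓝 |(s u : ℝ) * 0|) :=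
      ((continuous_const.mul continuous_id).abs.tendsto 0).mono_left nhdsWithin_le_nhds
    rw [mul_zero, abs_zero] at this
    exact this.eventually_lt_const hε
  filter_upwards [h u hu, h1] with t ht ht' Q hx hy
  rw [ht Q hx hy, Real.dist_eq, add_sub_cancel_left]
  exact ht'

lemma HasSlopes.hasSlopeAlong {f : Pt a e → ℝ} {P : Pt a e} {s : ℂ → ℤ} (h : HasSlopes f P s)
    {r : ℝ} {U : Set (Pt a e)} (c : StarChart P (dirs a e P.x P.y) r U (chart P)) {u : ℂ}
    (hu : u ∈ dirs a e P.x P.y) : HasSlopeAlong f (c.ray u) (s u) := by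
  obtain ⟨ε, hε, H⟩ := (h u hu).ray c hu
  refine ⟨ε, hε, fun t ht => ?_⟩
  rw [c.ray_zero hu]
  exact H t ht

lemma HasSlopes.hasOrderAt {f : Pt a e → ℝ} {P : Pt a e} {s : ℂ → ℤ} (h : HasSlopes f P s) :
    HasOrderAt (Pt a e) f P (∑ u ∈ dirs a e P.x P.y, s u) := by
  obtain ⟨r, U, c⟩ := exists_starChart P
  refine c.completeArcs.hasOrderAt_iff.2 ⟨fun u => s u, fun u => h.hasSlopeAlong c u.2, ?_⟩
  exact (Finset.sum_coe_sort (dirs a e P.x P.y) s).symm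

lemma linEquiv_of_hasSlopes {D D' : Divisor (Pt a e)} (f : Pt a e → ℝ) (s : Pt a e → ℂ → ℤ)
    (h : ∀ P, HasSlopes f P (s P)) (hD : ∀ P, D' P - D P = ∑ u ∈ dirs a e P.x P.y, s P u) :
    LinEquiv (Pt a e) D D' := by
  refine ⟨f, ⟨continuous_iff_continuousAt.2 fun P => (h P).continuousAt, fun P τ hτ => ?_⟩,
    fun P => ?_⟩
  · obtain ⟨r, U, c⟩ := exists_starChart P
    exact c.completeArcs.hasSlope (fun u => (h P).hasSlopeAlong c u.2) hτ
  · rw [hD]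
    exact (h P).hasOrderAt

end Ladder

lemma starDirs_one : starDirs 1 = {1} := by
  simp [starDirs]

lemma starDirs_two : starDirs 2 = {1, -1} := by
  have h : Complex.exp (2 * Real.pi * Complex.I / (2 : ℕ)) = -1 := by
    rw [← Complex.exp_pi_mul_I]
    congr 1
    push_cast
    ring
  unfold starDirs
  rw [h]
  ext z
  simp [Finset.range_add_one, or_comm]

lemma starDirs_four : starDirs 4 = {1, -1, Complex.I, -Complex.I} := by
  have h : Complex.exp (2 * Real.pi * Complex.I / (4 : ℕ)) = Complex.I := by
    conv_rhs => rw [← Complex.exp_pi_div_two_mul_I]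
    congr 1
    push_cast
    ring
  unfold starDirs
  rw [h]
  ext z
  simp [Finset.range_add_one, pow_succ]
  tauto

namespace Ladder

variable {a e : ℕ}

lemma Rung.mem {y : ℝ} (h : Rung a e y) (x : Circ) : Mem a e x y := Or.inl h

lemma mem_columnA {y : ℝ} (h : y ∈ Icc (-1 / 2 : ℝ) (a + 1 / 2)) : Mem a e 0 y :=
  Or.inr (Or.inl ⟨rfl, h⟩)

lemma mem_columnB {y : ℝ} (h : y ∈ Icc (-e - 1 / 2 : ℝ) (1 / 2)) : Mem a e (1 : ℝ) y :=
  Or.inr (Or.inr ⟨rfl, h⟩)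

lemma continuous_pt {X : Type*} [TopologicalSpace X] {f : X → Circ} {g : X → ℝ}
    (hf : Continuous f) (hg : Continuous g) (h : ∀ t, Mem a e (f t) (g t)) :
    Continuous fun t => pt (f t) (g t) (h t) :=
  ((WithLp.prod_continuous_toLp 2 Circ ℝ).comp (hf.prodMk hg)).subtype_mk h

lemma isPreconnected_path {I : Set ℝ} (hI : IsPreconnected I) {f : ℝ → Circ} {g : ℝ → ℝ}
    (hf : Continuous f) (hg : Continuous g) (h : ∀ t ∈ I, Mem a e (f t) (g t)) :
    IsPreconnected {Q : Pt a e | ∃ t ∈ I, Q.x = f t ∧ Q.y = g t} := by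
  have : {Q : Pt a e | ∃ t ∈ I, Q.x = f t ∧ Q.y = g t} =
      range fun t : I => pt (f t) (g t) (h t t.2) := by
    ext Q
    constructor
    · rintro ⟨t, ht, h1, h2⟩
      exact ⟨⟨t, ht⟩, (Pt.ext h1 h2).symm⟩
    · rintro ⟨t, rfl⟩
      exact ⟨t, t.2, rfl, rfl⟩
  rw [this]
  have := isPreconnected_iff_preconnectedSpace.1 hI
  exact isPreconnected_range
    (continuous_pt (hf.comp continuous_subtype_val) (hg.comp continuous_subtype_val) _)

lemma isPreconnected_level {I : Set ℝ} (hI : IsPreconnected I) {y : ℝ} (hy : Rung a e y) :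
    IsPreconnected {Q : Pt a e | Q.y = y ∧ ∃ t ∈ I, Q.x = (t : ℝ)} := by
  convert isPreconnected_path hI (f := fun t => (t : Circ)) (g := fun _ => y)
    (AddCircle.continuous_mk' 4) continuous_const fun _ _ => hy.mem _ using 3
  constructor
  · rintro ⟨h, t, ht, h'⟩
    exact ⟨t, ht, h', h⟩
  · rintro ⟨t, ht, h', h⟩
    exact ⟨h, t, ht, h'⟩

lemma isPreconnected_column {I : Set ℝ} (hI : IsPreconnected I) {x : Circ}
    (h : ∀ t ∈ I, Mem a e x t) : IsPreconnected {Q : Pt a e | Q.x = x ∧ Q.y ∈ I} := by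
  convert isPreconnected_path hI (f := fun _ => x) (g := fun t => t)
    continuous_const continuous_id h using 3
  constructor
  · rintro ⟨h1, h2⟩
    exact ⟨_, h2, h1, rfl⟩
  · rintro ⟨t, ht, h1, h2⟩
    exact ⟨h1, h2 ▸ ht⟩

/-- The first column of the ladder. -/
def columnA : Set (Pt a e) := {Q | Q.x = 0 ∧ Q.y ∈ Icc (-1 / 2 : ℝ) (a + 1 / 2)}

/-- The second column of the ladder. -/
def columnB : Set (Pt a e) := {Q | Q.x = (1 : ℝ) ∧ Q.y ∈ Icc (-e - 1 / 2 : ℝ) (1 / 2)}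

lemma rung_intCast {j : ℤ} : Rung a e j ↔ -(e : ℤ) ≤ j ∧ j ≤ a := by
  constructor
  · rintro ⟨k, h1, h2, h3⟩
    obtain rfl : j = k := by exact_mod_cast h3
    exact ⟨h1, h2⟩
  · rintro ⟨h1, h2⟩
    exact ⟨j, h1, h2, rfl⟩

lemma rung_zero : Rung a e 0 := ⟨0, by omega, by omega, by simp⟩

/-- The part of the ladder consisting of the columns and the arcs `I j` of the levels `j`. -/
def skeleton (I : ℤ → Set ℝ) : Set (Pt a e) :=
  {Q | ∃ j : ℤ, Q.y = j ∧ ∃ t ∈ I j, Q.x = (t : ℝ)} ∪ (columnA ∪ columnB)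

lemma isPreconnected_skeleton {I : ℤ → Set ℝ} (hI : ∀ j, IsPreconnected (I j))
    (h0 : ∀ j, 0 ∈ I j) (h1 : ∀ j, 1 ∈ I j) : IsPreconnected (skeleton I : Set (Pt a e)) := by
  have ha : (0 : ℝ) ≤ a := Nat.cast_nonneg a
  have he : (0 : ℝ) ≤ e := Nat.cast_nonneg e
  have cA : IsPreconnected (columnA : Set (Pt a e)) :=
    isPreconnected_column isPreconnected_Icc fun _ ht => mem_columnA ht
  have cB : IsPreconnected (columnB : Set (Pt a e)) :=
    isPreconnected_column isPreconnected_Icc fun _ ht => mem_columnB ht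
  let L : ℤ → Set (Pt a e) := fun j => {Q | Q.y = j ∧ ∃ t ∈ I j, Q.x = (t : ℝ)}
  have cL : ∀ j : ℤ, Rung a e j → IsPreconnected (L j) := fun j hj => isPreconnected_level (hI j) hj
  have hL : ∀ j, L j ⊆ skeleton I := fun j Q hQ => Or.inl ⟨j, hQ⟩
  have hA : (columnA : Set (Pt a e)) ⊆ skeleton I := fun Q hQ => Or.inr (Or.inl hQ)
  have hB : (columnB : Set (Pt a e)) ⊆ skeleton I := fun Q hQ => Or.inr (Or.inr hQ)
  let v : Pt a e := pt 0 0 (rung_zero.mem _)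
  let w : Pt a e := pt (1 : ℝ) 0 (rung_zero.mem _)
  have vA : v ∈ (columnA : Set (Pt a e)) := ⟨rfl, by norm_num [v], by simp only [v, pt_y]; linarith⟩
  have wB : w ∈ (columnB : Set (Pt a e)) :=
    ⟨rfl, by simp only [w, pt_y]; linarith, by norm_num [w]⟩
  have vL : v ∈ L 0 := ⟨by simp [v], 0, h0 0, by simp [v]⟩
  have wL : w ∈ L 0 := ⟨by simp [w], 1, h1 0, by simp [w]⟩
  have c0 : IsPreconnected (L 0 ∪ columnB) :=
    (cL 0 (by simpa using rung_zero)).union w wL wB cB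
  refine isPreconnected_of_forall v fun Q hQ => ?_
  rcases hQ with ⟨j, hQ⟩ | hQ | hQ
  · have hj : Rung a e j := by
      rcases Q.mem with h | ⟨-, h2, h3⟩ | ⟨-, h2, h3⟩
      · rwa [hQ.1] at h
      · rw [hQ.1] at h2 h3
        have h2' : (-1 : ℝ) < j := by linarith
        have h3' : (j : ℝ) < a + 1 := by linarith
        rw [rung_intCast]
        have h2' : (-1 : ℤ) < j := by exact_mod_cast h2'
        have h3' : j < a + 1 := by exact_mod_cast h3'
        omega
      · rw [hQ.1] at h2 h3
        have h2' : (-e - 1 : ℝ) < j := by linarith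
        have h3' : (j : ℝ) < 1 := by linarith
        rw [rung_intCast]
        have h2' : (-e - 1 : ℤ) < j := by exact_mod_cast h2'
        have h3' : j < 1 := by exact_mod_cast h3'
        omega
    have hj' := rung_intCast.1 hj
    rcases le_or_gt 0 j with hj0 | hj0
    · have hjR : (0 : ℝ) ≤ j := by exact_mod_cast hj0
      have hja : (j : ℝ) ≤ a := by exact_mod_cast hj'.2
      refine ⟨columnA ∪ L j, union_subset hA (hL j), Or.inl vA, Or.inr hQ,
        cA.union (pt 0 j (hj.mem _)) ⟨rfl, ?_, ?_⟩ ⟨rfl, 0, h0 j, by simp⟩ (cL j hj)⟩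
      · simp only [pt_y]; linarith
      · simp only [pt_y]; linarith
    · have hjR : (j : ℝ) ≤ 0 := by exact_mod_cast hj0.le
      have hja : (-e : ℝ) ≤ j := by exact_mod_cast hj'.1
      refine ⟨(L 0 ∪ columnB) ∪ L j, union_subset (union_subset (hL 0) hB) (hL j),
        Or.inl (Or.inl vL),
        Or.inr hQ, c0.union (pt (1 : ℝ) j (hj.mem _)) (Or.inr ⟨rfl, ?_, ?_⟩)
          ⟨rfl, 1, h1 j, by simp⟩ (cL j hj)⟩
      · simp only [pt_y]; linarith
      · simp only [pt_y]; linarith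
  · exact ⟨columnA, hA, vA, hQ, cA⟩
  · exact ⟨L 0 ∪ columnB, union_subset (hL 0) hB, Or.inl vL, Or.inr hQ, c0⟩

lemma skeleton_univ : skeleton (fun _ => univ) = (univ : Set (Pt a e)) := by
  refine eq_univ_of_forall fun Q => ?_
  rcases Q.mem with ⟨j, -, -, h⟩ | h | h
  · exact Or.inl ⟨j, h, circLift Q.x, mem_univ _, (coe_circLift _).symm⟩
  · exact Or.inr (Or.inl h)
  · exact Or.inr (Or.inr h)

instance : Nonempty (Pt a e) := ⟨pt 0 0 (rung_zero.mem _)⟩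

instance : CompactSpace (Pt a e) := by
  rw [← isCompact_univ_iff]
  have : (univ : Set (Pt a e)) = (⋃ j : Icc (-(e : ℤ)) a,
      range fun x => pt x (j : ℤ) ((rung_intCast.2 j.2).mem _)) ∪
      ((range fun t : Icc (-1 / 2 : ℝ) (a + 1 / 2) => pt 0 t (mem_columnA t.2)) ∪
      (range fun t : Icc (-e - 1 / 2 : ℝ) (1 / 2) =>
        pt (1 : ℝ) t (mem_columnB t.2))) := by
    refine (eq_univ_of_forall fun Q => ?_).symm
    rcases Q.mem with ⟨j, h1, h2, h⟩ | h | h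
    · exact Or.inl (mem_iUnion.2 ⟨⟨j, h1, h2⟩, Q.x, Pt.ext rfl h.symm⟩)
    · exact Or.inr (Or.inl ⟨⟨Q.y, h.2⟩, Pt.ext h.1.symm rfl⟩)
    · exact Or.inr (Or.inr ⟨⟨Q.y, h.2⟩, Pt.ext h.1.symm rfl⟩)
  rw [this]
  refine (isCompact_iUnion fun j => isCompact_range ?_).union
    ((isCompact_range ?_).union (isCompact_range ?_))
  · exact continuous_pt continuous_id continuous_const _
  · exact continuous_pt continuous_const continuous_subtype_val _
  · exact continuous_pt continuous_const continuous_subtype_val _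

instance : ConnectedSpace (Pt a e) where
  isPreconnected_univ := by
    rw [← skeleton_univ]
    exact isPreconnected_skeleton (fun _ => isPreconnected_univ) (fun _ => mem_univ _)
      fun _ => mem_univ _
  toNonempty := inferInstance

lemma not_int_half (j k : ℤ) : (j : ℝ) ≠ k + 1 / 2 := by
  intro h
  have h1 : (2 * j : ℝ) = 2 * k + 1 := by linarith
  have h2 : 2 * j = 2 * k + 1 := by exact_mod_cast h1
  omega

lemma Rung.up_iff_down {y : ℝ} (hy : Rung a e y) (x : Circ) : Up a e x y ↔ Down a e x y := by
  obtain ⟨j, -, -, rfl⟩ := hy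
  have h1 : (-1 / 2 : ℝ) ≠ j := by
    have := not_int_half j (-1)
    push_cast at this
    intro h
    exact this (by linarith)
  have h2 : (j : ℝ) ≠ a + 1 / 2 := by simpa using not_int_half j a
  have h3 : (-e - 1 / 2 : ℝ) ≠ j := by
    have := not_int_half j (-e - 1)
    push_cast at this
    intro h
    exact this (by linarith)
  have h4 : (j : ℝ) ≠ 1 / 2 := by simpa using not_int_half j 0
  unfold Up Down
  rw [h1.le_iff_lt, h2.le_iff_lt, h3.le_iff_lt, h4.le_iff_lt]

lemma up_or_down_or_rung (P : Pt a e) :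
    Rung a e P.y ∨ Up a e P.x P.y ∨ Down a e P.x P.y := by
  have ha : (0 : ℝ) ≤ a := Nat.cast_nonneg a
  have he : (0 : ℝ) ≤ e := Nat.cast_nonneg e
  rcases P.mem with h | ⟨h0, h1, h2⟩ | ⟨h0, h1, h2⟩
  · exact Or.inl h
  · rcases h2.lt_or_eq with h3 | h3
    · exact Or.inr (Or.inl (Or.inl ⟨h0, h1, h3⟩))
    · exact Or.inr (Or.inr (Or.inl ⟨h0, by linarith, h2⟩))
  · rcases h2.lt_or_eq with h3 | h3
    · exact Or.inr (Or.inl (Or.inr ⟨h0, h1, h3⟩))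
    · exact Or.inr (Or.inr (Or.inr ⟨h0, by linarith, h2⟩))

lemma I_ne_neg_I : Complex.I ≠ -Complex.I := fun h => by
  have := congrArg Complex.im h
  norm_num at this

lemma hasStarNbhd (P : Pt a e) :
    1 ≤ (dirs a e P.x P.y).card ∧ HasStarNbhd (Pt a e) P (dirs a e P.x P.y).card := by
  obtain ⟨r, U, c⟩ := exists_starChart P
  have key : ∃ (n : ℕ) (w : ℂ), 1 ≤ n ∧ ‖w‖ = 1 ∧
      (dirs a e P.x P.y).image (w * ·) = starDirs n := by
    by_cases hR : Rung a e P.y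
    · by_cases hU : Up a e P.x P.y
      · refine ⟨4, 1, by norm_num, by simp, ?_⟩
        have hD := (hR.up_iff_down _).1 hU
        rw [starDirs_four]
        ext z
        simp [dirs, hR, hU, hD]
        tauto
      · have hD : ¬ Down a e P.x P.y := fun h => hU ((hR.up_iff_down _).2 h)
        refine ⟨2, 1, by norm_num, by simp, ?_⟩
        rw [starDirs_two]
        ext z
        simp [dirs, hR, hU, hD]
    · by_cases hU : Up a e P.x P.y
      · by_cases hD : Down a e P.x P.y
        · refine ⟨2, -Complex.I, by norm_num, by simp, ?_⟩
          rw [starDirs_two]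
          ext z
          simp [dirs, hR, hU, hD]
        · refine ⟨1, -Complex.I, by norm_num, by simp, ?_⟩
          rw [starDirs_one]
          ext z
          simp [dirs, hR, hU, hD]
      · have hD : Down a e P.x P.y := by
          rcases up_or_down_or_rung P with h | h | h
          exacts [absurd h hR, absurd h hU, h]
        refine ⟨1, Complex.I, by norm_num, by simp, ?_⟩
        rw [starDirs_one]
        ext z
        simp [dirs, hR, hU, hD]
  obtain ⟨n, w, hn, hw, h⟩ := key
  have hw0 : w ≠ 0 := by
    rintro rfl
    simp at hw
  have hcard : (dirs a e P.x P.y).card = n := by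
    rw [← card_starDirs hn, ← h, Finset.card_image_of_injective _ (mul_right_injective₀ hw0)]
  have c' := c.rotate hw
  rw [h] at c'
  rw [hcard]
  exact ⟨hn, c'.hasStarNbhd hn⟩

variable (a e) in
lemma isMetricGraph : IsMetricGraph (Pt a e) :=
  ⟨inferInstance, inferInstance, fun P => ⟨_, hasStarNbhd P⟩⟩

lemma isVertex_iff (P : Pt a e) : IsVertex (Pt a e) P ↔ (dirs a e P.x P.y).card ≠ 2 := by
  unfold IsVertex
  rw [(hasStarNbhd P).2.valence_eq (hasStarNbhd P).1]

open Classical in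
lemma card_dirs (x : Circ) (y : ℝ) : (dirs a e x y).card = (if Rung a e y then 2 else 0) +
    ((if Up a e x y then 1 else 0) + (if Down a e x y then 1 else 0)) := by
  have := sum_dirs (a := a) (e := e) x y fun _ => 1
  simp only [Finset.sum_const, nsmul_eq_mul, mul_one] at this
  split_ifs at this ⊢ <;> omega

end Ladder

/-- The slope at distance `z` from `m`, to the right if `u = 1` and to the left otherwise, of the
function `min ‖x - m‖ t` on the circle. -/
noncomputable def clampSlope (t z : ℝ) (u : ℂ) : ℤ :=
  if u = 1 then
    if 0 ≤ z then if z < t then 1 else 0 else if -t ≤ z then -1 else 0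
  else
    if 0 < z then if z ≤ t then -1 else 0 else
      if z = -2 then if 2 ≤ t then -1 else 0 else if -t < z then 1 else 0

lemma clamp_slope {t : ℝ} (ht : 0 < t) (ht2 : t ≤ 2) (x m : Circ) {u : ℂ} (hu : u = 1 ∨ u = -1) :
    ∃ ε > (0 : ℝ), ∀ s ∈ Icc 0 ε, min ‖x + (s * u.re : ℝ) - m‖ t =
      min ‖x - m‖ t + clampSlope t (circLift (x - m)) u * s := by
  obtain ⟨h1, h2⟩ := circLift_mem (x - m)
  have hx : ∀ s : ℝ, x + (s : ℝ) - m = ((circLift (x - m) + s : ℝ) : Circ) := by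
    intro s
    rw [AddCircle.coe_add, coe_circLift]
    abel
  simp only [hx]
  rw [norm_circ (x - m)]
  generalize circLift (x - m) = z at h1 h2
  have hne : ¬ (-1 : ℂ) = 1 := by norm_num
  rcases hu with rfl | rfl
  · simp only [Complex.one_re, mul_one, clampSlope, if_true]
    rcases le_or_gt 0 z with hz | hz
    · rw [if_pos hz]
      split_ifs with h
      · refine ⟨t - z, by linarith, fun s ⟨hs0, hs⟩ => ?_⟩
        rw [norm_circ_coe (by rw [abs_of_nonneg (by linarith)]; linarith),
          abs_of_nonneg (by linarith), abs_of_nonneg hz, min_eq_left (by linarith),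
          min_eq_left (by linarith)]
        push_cast
        ring
      · refine ⟨2 - z, by linarith, fun s ⟨hs0, hs⟩ => ?_⟩
        rw [norm_circ_coe (by rw [abs_of_nonneg (by linarith)]; linarith),
          abs_of_nonneg (by linarith), abs_of_nonneg hz, min_eq_right (by linarith),
          min_eq_right (by linarith)]
        simp
    · rw [if_neg (by linarith)]
      split_ifs with h
      · refine ⟨-z, by linarith, fun s ⟨hs0, hs⟩ => ?_⟩
        rw [norm_circ_coe (by rw [abs_of_nonpos (by linarith)]; linarith),
          abs_of_nonpos (by linarith), abs_of_neg hz, min_eq_left (by linarith),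
          min_eq_left (by linarith)]
        push_cast
        ring
      · refine ⟨-z - t, by linarith, fun s ⟨hs0, hs⟩ => ?_⟩
        rw [norm_circ_coe (by rw [abs_of_nonpos (by linarith)]; linarith),
          abs_of_nonpos (by linarith), abs_of_neg hz, min_eq_right (by linarith),
          min_eq_right (by linarith)]
        simp
  · simp only [Complex.neg_re, Complex.one_re, mul_neg, mul_one, clampSlope, if_neg hne]
    rcases lt_or_ge 0 z with hz | hz
    · rw [if_pos hz]
      split_ifs with h
      · refine ⟨z, by linarith, fun s ⟨hs0, hs⟩ => ?_⟩
        rw [norm_circ_coe (by rw [abs_of_nonneg (by linarith)]; linarith),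
          abs_of_nonneg (by linarith), abs_of_pos hz, min_eq_left (by linarith),
          min_eq_left (by linarith)]
        push_cast
        ring
      · refine ⟨z - t, by linarith, fun s ⟨hs0, hs⟩ => ?_⟩
        rw [norm_circ_coe (by rw [abs_of_nonneg (by linarith)]; linarith),
          abs_of_nonneg (by linarith), abs_of_pos hz, min_eq_right (by linarith),
          min_eq_right (by linarith)]
        simp
    · rw [if_neg (by linarith)]
      rcases eq_or_ne z (-2) with rfl | hz2
      · rw [if_pos rfl]
        have hflip : ∀ s : ℝ, ((-2 + -s : ℝ) : Circ) = ((2 - s : ℝ) : Circ) := by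
          intro s
          have : (2 - s : ℝ) = (-2 + -s) + 4 := by ring
          rw [this, AddCircle.coe_add_period]
        simp only [hflip]
        split_ifs with h
        · refine ⟨2, by linarith, fun s ⟨hs0, hs⟩ => ?_⟩
          rw [norm_circ_coe (by rw [abs_of_nonneg (by linarith)]; linarith),
            abs_of_nonneg (by linarith), abs_of_neg (by norm_num), min_eq_left (by linarith),
            min_eq_left (by linarith)]
          push_cast
          ring
        · refine ⟨2 - t, by linarith, fun s ⟨hs0, hs⟩ => ?_⟩
          rw [norm_circ_coe (by rw [abs_of_nonneg (by linarith)]; linarith),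
            abs_of_nonneg (by linarith), abs_of_neg (by norm_num), min_eq_right (by linarith),
            min_eq_right (by linarith)]
          simp
      · rw [if_neg hz2]
        have h1' : -2 < z := lt_of_le_of_ne h1 hz2.symm
        split_ifs with h
        · refine ⟨t + z, by linarith, fun s ⟨hs0, hs⟩ => ?_⟩
          rw [norm_circ_coe (by rw [abs_of_nonpos (by linarith)]; linarith),
            abs_of_nonpos (by linarith), abs_of_nonpos hz, min_eq_left (by linarith),
            min_eq_left (by linarith)]
          push_cast
          ring
        · refine ⟨2 + z, by linarith, fun s ⟨hs0, hs⟩ => ?_⟩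
          rw [norm_circ_coe (by rw [abs_of_nonpos (by linarith)]; linarith),
            abs_of_nonpos (by linarith), abs_of_nonpos hz, min_eq_right (by linarith),
            min_eq_right (by linarith)]
          simp

open Classical in
lemma clampSlope_add {t : ℝ} (ht : 0 < t) (ht2 : t ≤ 2) (x m : Circ) :
    clampSlope t (circLift (x - m)) 1 + clampSlope t (circLift (x - m)) (-1) =
      (if x = m then 2 else 0) - ((if x = m + (t : ℝ) then 1 else 0) +
        (if x = m - (t : ℝ) then 1 else 0)) := by
  obtain ⟨h1, h2⟩ := circLift_mem (x - m)
  have e0 : x = m ↔ circLift (x - m) = 0 := by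
    conv_rhs => rw [← circ_coe_eq_zero (abs_lt.2 ⟨by linarith, by linarith⟩), coe_circLift,
      sub_eq_zero]
  have e1 : x = m + (t : ℝ) ↔ (circLift (x - m) = t ∨ (circLift (x - m) = -2 ∧ t = 2)) := by
    rw [← sub_eq_iff_eq_add', ← coe_circLift (x - m), circLift_coe h1 h2]
    rcases ht2.eq_or_lt with rfl | h
    · have : ((2 : ℝ) : Circ) = ((-2 : ℝ) : Circ) := by
        rw [← AddCircle.coe_add_period 4 (-2)]
        norm_num
      rw [this, circ_coe_eq (abs_lt.2 ⟨by linarith, by linarith⟩)]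
      constructor
      · exact fun h => Or.inr ⟨h, rfl⟩
      · rintro (h | h)
        · linarith
        · exact h.1
    · rw [circ_coe_eq (abs_lt.2 ⟨by linarith, by linarith⟩)]
      constructor
      · exact Or.inl
      · rintro (h | h)
        · exact h
        · linarith
  have e2 : x = m - (t : ℝ) ↔ circLift (x - m) = -t := by
    rw [show x = m - (t : ℝ) ↔ x - m = ((-t : ℝ) : Circ) by
      rw [AddCircle.coe_neg, sub_eq_iff_eq_add', sub_eq_add_neg], ← coe_circLift (x - m),
      circLift_coe h1 h2, circ_coe_eq (abs_lt.2 ⟨by linarith, by linarith⟩)]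
  simp only [e0, e1, e2]
  generalize circLift (x - m) = z at h1 h2
  have hne : ¬ (-1 : ℂ) = 1 := by norm_num
  simp only [clampSlope, if_true, if_neg hne]
  split_ifs <;> first | rfl | (exfalso; grind)

namespace Ladder

variable {a e : ℕ}

lemma along_of_forall {P : Pt a e} {u : ℂ} {p : Pt a e → ℝ → Prop} {ε : ℝ} (hε : 0 < ε)
    (h : ∀ t ∈ Icc 0 ε, ∀ Q : Pt a e, Q.x = P.x + (t * u.re : ℝ) → Q.y = P.y + t * u.im → p Q t) :
    Along P u p := by
  filter_upwards [Icc_mem_nhdsGE hε] with t ht using h t ht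

/-- The retraction of the ladder onto its level `j`, in terms of the horizontal coordinate. -/
noncomputable def retract (j : ℤ) (Q : Pt a e) : Circ :=
  if Q.y = j then Q.x else if 0 < j then 0 else if j < 0 then ((1 : ℝ) : Circ) else
    if 1 ≤ Q.y then 0 else if Q.y ≤ -1 then ((1 : ℝ) : Circ) else Q.x

lemma Up.x_eq_zero {x : Circ} {y : ℝ} (h : Up a e x y) (hy : 1 / 2 ≤ y) : x = 0 := by
  rcases h with h | h
  · exact h.1
  · linarith [h.2.2]

lemma Down.x_eq_zero {x : Circ} {y : ℝ} (h : Down a e x y) (hy : 1 / 2 < y) : x = 0 := by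
  rcases h with h | h
  · exact h.1
  · linarith [h.2.2]

lemma Up.x_eq_one {x : Circ} {y : ℝ} (h : Up a e x y) (hy : y < -1 / 2) : x = (1 : ℝ) := by
  rcases h with h | h
  · linarith [h.2.1]
  · exact h.1

lemma Down.x_eq_one {x : Circ} {y : ℝ} (h : Down a e x y) (hy : y ≤ -1 / 2) : x = (1 : ℝ) := by
  rcases h with h | h
  · linarith [h.2.1]
  · exact h.1

lemma retract_of_eq {j : ℤ} {Q : Pt a e} (h : Q.y = j) : retract j Q = Q.x := if_pos h

lemma retract_of_pos {j : ℤ} {Q : Pt a e} (h : Q.y ≠ j) (hj : 0 < j) : retract j Q = 0 := by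
  rw [retract, if_neg h, if_pos hj]

lemma retract_of_neg {j : ℤ} {Q : Pt a e} (h : Q.y ≠ j) (hj : j < 0) :
    retract j Q = (1 : ℝ) := by
  rw [retract, if_neg h, if_neg (by omega), if_pos hj]

lemma retract_zero_of_ge {Q : Pt a e} (h : 1 ≤ Q.y) : retract 0 Q = 0 := by
  rw [retract, if_neg (by push_cast; linarith), if_neg (by omega), if_neg (by omega), if_pos h]

lemma retract_zero_of_le {Q : Pt a e} (h : Q.y ≤ -1) : retract 0 Q = (1 : ℝ) := by
  rw [retract, if_neg (by push_cast; linarith), if_neg (by omega), if_neg (by omega),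
    if_neg (by linarith), if_pos h]

lemma retract_of_vertical {j : ℤ} {P Q : Pt a e} (hx : Q.x = P.x)
    (hPj : 0 < j → (P.y = j ∨ Q.y = j) → P.x = 0)
    (hPj' : j < 0 → (P.y = j ∨ Q.y = j) → P.x = (1 : ℝ))
    (h1 : (1 ≤ P.y ∨ 1 ≤ Q.y) → P.x = 0)
    (h2 : (P.y ≤ -1 ∨ Q.y ≤ -1) → P.x = (1 : ℝ))
    (h3 : ¬ (1 ≤ P.y ∧ Q.y ≤ -1)) (h4 : ¬ (P.y ≤ -1 ∧ 1 ≤ Q.y)) :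
    retract j Q = retract j P := by
  unfold retract
  rw [hx]
  split_ifs <;> grind

lemma retract_along {j : ℤ} {P : Pt a e} {u : ℂ} (hu : u ∈ dirs a e P.x P.y)
    (h : P.y = j → ¬ (u = 1 ∨ u = -1)) : Along P u fun Q _ => retract j Q = retract j P := by
  rcases mem_dirs.1 hu with ⟨hR, hu⟩ | ⟨hU, rfl⟩ | ⟨hD, rfl⟩
  · have hPj : P.y ≠ j := fun h' => h h' hu
    obtain ⟨k, -, -, hk⟩ := hR
    refine along_of_forall one_pos fun t ht Q hx hy => ?_
    have hy : Q.y = P.y := by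
      rcases hu with rfl | rfl <;> simpa using hy
    rcases lt_trichotomy j 0 with hj | rfl | hj
    · rw [retract_of_neg hPj hj, retract_of_neg (hy ▸ hPj) hj]
    · rw [hk] at hPj hy
      have hPj : k ≠ 0 := by exact_mod_cast hPj
      rcases lt_or_gt_of_ne hPj with h0 | h0
      · have : (k : ℝ) ≤ -1 := by exact_mod_cast (by omega : k ≤ -1)
        rw [retract_zero_of_le (by linarith), retract_zero_of_le (by linarith)]
      · have : (1 : ℝ) ≤ k := by exact_mod_cast (by omega : 1 ≤ k)
        rw [retract_zero_of_ge (by linarith), retract_zero_of_ge (by linarith)]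
    · rw [retract_of_pos hPj hj, retract_of_pos (hy ▸ hPj) hj]
  · refine along_of_forall (ε := 1 / 4) (by norm_num) fun t ht Q hx hy => ?_
    simp only [Complex.I_re, mul_zero, AddCircle.coe_zero, add_zero, Complex.I_im, mul_one] at hx hy
    obtain ⟨ht0, ht1⟩ := ht
    have j1 : 0 < j → (1 : ℝ) ≤ j := fun h => by exact_mod_cast h
    have j2 : j < 0 → (j : ℝ) ≤ -1 := fun h => by exact_mod_cast (by omega : j ≤ -1)
    refine retract_of_vertical hx (fun h0 h => hU.x_eq_zero ?_) (fun h0 h => hU.x_eq_one ?_)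
      (fun h => hU.x_eq_zero ?_) (fun h => hU.x_eq_one ?_) (fun h => ?_) (fun h => ?_)
    · rcases h with h | h <;> linarith [j1 h0]
    · rcases h with h | h <;> linarith [j2 h0]
    · rcases h with h | h <;> linarith
    · rcases h with h | h <;> linarith
    · linarith
    · linarith
  · refine along_of_forall (ε := 1 / 4) (by norm_num) fun t ht Q hx hy => ?_
    simp only [Complex.neg_re, Complex.I_re, mul_zero, neg_zero, AddCircle.coe_zero, add_zero,
      Complex.neg_im, Complex.I_im, mul_neg, mul_one] at hx hy
    obtain ⟨ht0, ht1⟩ := ht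
    have j1 : 0 < j → (1 : ℝ) ≤ j := fun h => by exact_mod_cast h
    have j2 : j < 0 → (j : ℝ) ≤ -1 := fun h => by exact_mod_cast (by omega : j ≤ -1)
    refine retract_of_vertical hx (fun h0 h => hD.x_eq_zero ?_) (fun h0 h => hD.x_eq_one ?_)
      (fun h => hD.x_eq_zero ?_) (fun h => hD.x_eq_one ?_) (fun h => ?_) (fun h => ?_)
    · rcases h with h | h <;> linarith [j1 h0]
    · rcases h with h | h <;> linarith [j2 h0]
    · rcases h with h | h <;> linarith
    · rcases h with h | h <;> linarith
    · linarith
    · linarith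

open Classical in
/-- The point with horizontal coordinate `x` on the level `j` of the ladder, if there is such a
level. -/
noncomputable def lev (x : Circ) (j : ℤ) : Pt a e :=
  if h : Rung a e j then pt x j (h.mem x) else pt 0 0 (rung_zero.mem 0)

lemma lev_eq {x : Circ} {j : ℤ} (h : Rung a e j) : lev x j = pt x j (h.mem x) := dif_pos h

lemma lev_x {x : Circ} {j : ℤ} (h : Rung a e j) : (lev x j : Pt a e).x = x := by
  rw [lev_eq h, pt_x]

lemma lev_y {x : Circ} {j : ℤ} (h : Rung a e j) : (lev x j : Pt a e).y = j := by
  rw [lev_eq h, pt_y]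

lemma eq_lev_iff {x : Circ} {j : ℤ} (h : Rung a e j) (Q : Pt a e) :
    lev x j = Q ↔ Q.x = x ∧ Q.y = j := by
  constructor
  · rintro rfl
    exact ⟨lev_x h, lev_y h⟩
  · rintro ⟨h1, h2⟩
    exact Pt.ext ((lev_x h).trans h1.symm) ((lev_y h).trans h2.symm)

/-- The divisor consisting of one point. -/
noncomputable abbrev chip {Γ : Type*} (P : Γ) : Divisor Γ := Finsupp.single P 1

/-- Two chips at the point `m` of a level can be moved apart at equal speed. -/
lemma linEquiv_symmetric {j : ℤ} (hj : Rung a e j) (m : Circ) {t : ℝ} (ht : 0 < t) (ht2 : t ≤ 2) :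
    LinEquiv (Pt a e) (chip (lev (m + (t : ℝ)) j) + chip (lev (m - (t : ℝ)) j))
      (chip (lev m j) + chip (lev m j)) := by
  classical
  refine linEquiv_of_hasSlopes (fun Q => min ‖retract j Q - m‖ t)
    (fun P u => if P.y = j ∧ (u = 1 ∨ u = -1) then clampSlope t (circLift (P.x - m)) u else 0)
    (fun P u hu => ?_) fun P => ?_
  · beta_reduce
    split_ifs with h
    · obtain ⟨ε, hε, H⟩ := clamp_slope ht ht2 P.x m h.2
      refine along_of_forall hε fun s hs Q hx hy => ?_
      have hy : Q.y = j := by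
        rcases h.2 with rfl | rfl <;> simpa [h.1] using hy
      rw [retract_of_eq hy, retract_of_eq h.1, hx, H s hs]
    · filter_upwards [retract_along (j := j) hu fun h1 h2 => h ⟨h1, h2⟩] with t ht Q hx hy
      rw [ht Q hx hy]
      simp
  · rw [sum_dirs]
    have n1 : Complex.I ≠ 1 := fun h => by simpa using congrArg Complex.re h
    have n2 : Complex.I ≠ -1 := fun h => by simpa using congrArg Complex.re h
    have n3 : -Complex.I ≠ 1 := fun h => by simpa using congrArg Complex.re h
    have n4 : -Complex.I ≠ -1 := fun h => by simpa using congrArg Complex.re h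
    simp only [Finsupp.add_apply, Finsupp.single_apply, eq_lev_iff hj, n1, n2, n3, n4, or_self,
      and_false, if_false, ite_self, add_zero, true_or, or_true, and_true]
    by_cases hP : P.y = j
    · have hR : Rung a e P.y := hP ▸ hj
      rw [if_pos hR, if_pos hP, if_pos hP, clampSlope_add ht ht2]
      simp only [hP, and_true]
      split_ifs <;> rfl
    · simp [hP]

lemma linEquiv_level {j : ℤ} (hj : Rung a e j) {A B C D : Circ} (h : A + B = C + D) :
    LinEquiv (Pt a e) (chip (lev A j) + chip (lev B j)) (chip (lev C j) + chip (lev D j)) := by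
  have hΓ := isMetricGraph a e
  have key : ∀ (m : Circ) (t : ℝ), |t| ≤ 2 → LinEquiv (Pt a e)
      (chip (lev (m + (t : ℝ)) j) + chip (lev (m - (t : ℝ)) j))
      (chip (lev m j) + chip (lev m j)) := by
    intro m t ht
    rcases lt_trichotomy t 0 with h0 | rfl | h0
    · rw [abs_of_neg h0] at ht
      have := linEquiv_symmetric hj m (neg_pos.2 h0) ht
      rw [AddCircle.coe_neg, ← sub_eq_add_neg, sub_neg_eq_add] at this
      rwa [add_comm]
    · simpa using hΓ.linEquiv_refl _
    · exact linEquiv_symmetric hj m h0 (by rwa [abs_of_pos h0] at ht)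
  let m : Circ := ((circLift A + circLift B) / 2 : ℝ)
  have hm : m + m = A + B := by
    rw [← AddCircle.coe_add, add_halves, AddCircle.coe_add, coe_circLift, coe_circLift]
  have key' : ∀ X Y : Circ, X + Y = m + m → LinEquiv (Pt a e)
      (chip (lev X j) + chip (lev Y j)) (chip (lev m j) + chip (lev m j)) := by
    intro X Y hXY
    have h1 : m + (circLift (X - m) : ℝ) = X := by rw [coe_circLift]; abel
    have h2 : m - (circLift (X - m) : ℝ) = Y := by
      rw [coe_circLift, eq_sub_of_add_eq hXY]
      abel
    have := key m (circLift (X - m)) (abs_circLift _)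
    rwa [h1, h2] at this
  exact hΓ.linEquiv_trans (key' A B hm.symm) (hΓ.linEquiv_symm (key' C D (h ▸ hm.symm)))

/-- A chip on a column can be moved to the bottom of the column; `h` is a height function which is
only changing along the column. -/
lemma linEquiv_bottom {c : Set (Pt a e)} {h : Pt a e → ℝ} (hc : InjOn h c)
    (hv : ∀ P ∈ c, ∀ u, u = Complex.I ∨ u = -Complex.I → u ∈ dirs a e P.x P.y →
      Along P u fun Q t => h Q = h P + u.im * t)
    (hh : ∀ P, ∀ u ∈ dirs a e P.x P.y, ¬ (P ∈ c ∧ (u = Complex.I ∨ u = -Complex.I)) →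
      Along P u fun Q _ => h Q = h P) {L Y : Pt a e} (hL : L ∈ c) (hY : Y ∈ c) (hLY : h L < h Y)
    (hU : ∀ P ∈ c, h P < h Y → Up a e P.x P.y)
    (hD : ∀ P ∈ c, Down a e P.x P.y ↔ P ≠ L) : LinEquiv (Pt a e) (chip Y) (chip L) := by
  classical
  refine linEquiv_of_hasSlopes (fun Q => min (h Q) (h Y))
    (fun P u => if P ∈ c ∧ u = Complex.I then (if h P < h Y then 1 else 0) else
      if P ∈ c ∧ u = -Complex.I then (if h P ≤ h Y then -1 else 0) else 0)
    (fun P u hu => ?_) fun P => ?_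
  · beta_reduce
    by_cases hP : P ∈ c ∧ u = Complex.I
    · rw [if_pos hP]
      have hup := hv P hP.1 u (Or.inl hP.2) hu
      rw [hP.2] at hup ⊢
      simp only [Complex.I_im, one_mul] at hup
      split_ifs with hlt
      · have h1 : ∀ᶠ t in 𝓝[≥] (0 : ℝ), t ∈ Icc 0 (h Y - h P) := Icc_mem_nhdsGE (by linarith)
        filter_upwards [hup, h1] with t ht ht' Q hx hy
        rw [ht Q hx hy, min_eq_left hlt.le, min_eq_left (by linarith [ht'.2])]
        simp
      · have h1 : ∀ᶠ t in 𝓝[≥] (0 : ℝ), t ∈ Icc (0 : ℝ) 1 := Icc_mem_nhdsGE one_pos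
        filter_upwards [hup, h1] with t ht ht' Q hx hy
        rw [ht Q hx hy, min_eq_right (by linarith [ht'.1]), min_eq_right (by linarith)]
        simp
    · rw [if_neg hP]
      by_cases hP' : P ∈ c ∧ u = -Complex.I
      · rw [if_pos hP']
        have hup := hv P hP'.1 u (Or.inr hP'.2) hu
        rw [hP'.2] at hup ⊢
        simp only [Complex.neg_im, Complex.I_im, neg_mul, one_mul] at hup
        split_ifs with hle
        · have h1 : ∀ᶠ t in 𝓝[≥] (0 : ℝ), t ∈ Icc (0 : ℝ) 1 := Icc_mem_nhdsGE one_pos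
          filter_upwards [hup, h1] with t ht ht' Q hx hy
          rw [ht Q hx hy, min_eq_left hle, min_eq_left (by linarith [ht'.1])]
          simp
        · have h1 : ∀ᶠ t in 𝓝[≥] (0 : ℝ), t ∈ Icc 0 (h P - h Y) :=
            Icc_mem_nhdsGE (by linarith)
          filter_upwards [hup, h1] with t ht ht' Q hx hy
          rw [ht Q hx hy, min_eq_right (by linarith [ht'.2]), min_eq_right (by linarith)]
          simp
      · rw [if_neg hP']
        filter_upwards [hh P u hu fun h' => h'.2.elim (fun h => hP ⟨h'.1, h⟩)
          fun h => hP' ⟨h'.1, h⟩] with t ht Q hx hy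
        rw [ht Q hx hy]
        simp
  · rw [sum_dirs]
    have n1 : 1 ≠ Complex.I := fun h => by simpa using congrArg Complex.re h
    have n2 : 1 ≠ -Complex.I := fun h => by simpa using congrArg Complex.re h
    have n3 : -1 ≠ Complex.I := fun h => by simpa using congrArg Complex.re h
    have n4 : -1 ≠ -Complex.I := fun h => by simpa using congrArg Complex.re h
    have n5 : -Complex.I ≠ Complex.I := I_ne_neg_I.symm
    simp only [n1, n2, n3, n4, n5, and_false, if_false, add_zero, ite_self, and_true,
      Finsupp.single_apply]
    by_cases hP : P ∈ c
    · have hY' : Y = P ↔ h P = h Y := ⟨fun h => h ▸ rfl, fun h => (hc hP hY h).symm⟩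
      have hL' : L = P ↔ P = L := eq_comm
      simp only [hP, hD P hP, hY', hL', if_true]
      rcases lt_trichotomy (h P) (h Y) with hlt | heq | hgt
      · simp only [hU P hP hlt, hlt, hlt.le, hlt.ne, if_true, if_false]
        split_ifs <;> simp_all
      · have hPL : P ≠ L := fun h' => by rw [h'] at heq; exact hLY.ne heq
        simp [heq, hPL]
      · have hPL : P ≠ L := fun h' => by rw [h'] at hgt; exact (hLY.trans hgt).false
        simp [hPL, hgt.ne', hgt.not_gt, hgt.not_ge]
    · have h1 : Y ≠ P := fun h' => hP (h' ▸ hY)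
      have h2 : L ≠ P := fun h' => hP (h' ▸ hL)
      simp [hP, h1, h2]

lemma linEquiv_of_bottom {c : Set (Pt a e)} {L : Pt a e}
    (h : ∀ Y ∈ c, Y ≠ L → LinEquiv (Pt a e) (chip Y) (chip L)) {P Q : Pt a e} (hP : P ∈ c)
    (hQ : Q ∈ c) : LinEquiv (Pt a e) (chip P) (chip Q) := by
  have hΓ := isMetricGraph a e
  have h' : ∀ Y ∈ c, LinEquiv (Pt a e) (chip Y) (chip L) := by
    intro Y hY
    rcases eq_or_ne Y L with rfl | hne
    · exact hΓ.linEquiv_refl _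
    · exact h Y hY hne
  exact hΓ.linEquiv_trans (h' P hP) (hΓ.linEquiv_symm (h' Q hQ))

/-- The height along the first column. -/
noncomputable def heightA (Q : Pt a e) : ℝ :=
  if Q.x = 0 ∧ -1 / 2 ≤ Q.y then Q.y else max (⌊Q.y⌋ : ℝ) 0

/-- The height along the second column. -/
noncomputable def heightB (Q : Pt a e) : ℝ :=
  if Q.x = (1 : ℝ) ∧ Q.y ≤ 1 / 2 then Q.y else min (⌈Q.y⌉ : ℝ) 0

lemma one_ne_zero_circ : ((1 : ℝ) : Circ) ≠ 0 := by
  rw [Ne, circ_coe_eq_zero (by norm_num)]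
  exact one_ne_zero

lemma Pt.neg_half_le (Q : Pt a e) : -e - 1 / 2 ≤ Q.y := by
  have ha : (0 : ℝ) ≤ a := Nat.cast_nonneg a
  have he : (0 : ℝ) ≤ e := Nat.cast_nonneg e
  rcases Q.mem with ⟨j, h1, h2, h⟩ | ⟨-, h1, h2⟩ | ⟨-, h1, h2⟩
  · have : (-e : ℝ) ≤ j := by exact_mod_cast h1
    linarith
  · linarith
  · linarith

lemma Pt.le_half (Q : Pt a e) : Q.y ≤ a + 1 / 2 := by
  have ha : (0 : ℝ) ≤ a := Nat.cast_nonneg a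
  have he : (0 : ℝ) ≤ e := Nat.cast_nonneg e
  rcases Q.mem with ⟨j, h1, h2, h⟩ | ⟨-, h1, h2⟩ | ⟨-, h1, h2⟩
  · have : (j : ℝ) ≤ a := by exact_mod_cast h2
    linarith
  · linarith
  · linarith

lemma mem_columnA_iff {Q : Pt a e} : Q ∈ columnA ↔ Q.x = 0 ∧ -1 / 2 ≤ Q.y :=
  ⟨fun h => ⟨h.1, h.2.1⟩, fun h => ⟨h.1, h.2, Q.le_half⟩⟩

lemma mem_columnB_iff {Q : Pt a e} : Q ∈ columnB ↔ Q.x = (1 : ℝ) ∧ Q.y ≤ 1 / 2 :=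
  ⟨fun h => ⟨h.1, h.2.2⟩, fun h => ⟨h.1, Q.neg_half_le, h.2⟩⟩

lemma heightA_of_mem {Q : Pt a e} (h : Q ∈ columnA) : heightA Q = Q.y :=
  if_pos (mem_columnA_iff.1 h)

lemma heightB_of_mem {Q : Pt a e} (h : Q ∈ columnB) : heightB Q = Q.y :=
  if_pos (mem_columnB_iff.1 h)

lemma heightA_rung {Q : Pt a e} {j : ℤ} (h : Q.y = j) : heightA Q = max (j : ℝ) 0 := by
  unfold heightA
  split_ifs with h'
  · have h1 := h'.2
    rw [h] at h1 ⊢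
    have h2 : (-1 : ℝ) < j := by linarith
    have h2 : -1 < j := by exact_mod_cast h2
    have h3 : (0 : ℝ) ≤ j := by exact_mod_cast (by omega : 0 ≤ j)
    rw [max_eq_left h3]
  · rw [h, Int.floor_intCast]

lemma heightB_rung {Q : Pt a e} {j : ℤ} (h : Q.y = j) : heightB Q = min (j : ℝ) 0 := by
  unfold heightB
  split_ifs with h'
  · have h1 := h'.2
    rw [h] at h1 ⊢
    have h2 : (j : ℝ) < 1 := by linarith
    have h2 : j < 1 := by exact_mod_cast h2
    have h3 : (j : ℝ) ≤ 0 := by exact_mod_cast (by omega : j ≤ 0)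
    rw [min_eq_left h3]
  · rw [h, Int.ceil_intCast]

lemma heightA_columnB {Q : Pt a e} (h : Q ∈ columnB) : heightA Q = 0 := by
  have h' := mem_columnB_iff.1 h
  unfold heightA
  rw [if_neg fun h0 => one_ne_zero_circ (h'.1.symm.trans h0.1), max_eq_right]
  have : ⌊Q.y⌋ < 1 := by
    rw [Int.floor_lt]
    push_cast
    linarith [h'.2]
  exact_mod_cast (by omega : ⌊Q.y⌋ ≤ 0)

lemma heightB_columnA {Q : Pt a e} (h : Q ∈ columnA) : heightB Q = 0 := by
  have h' := mem_columnA_iff.1 h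
  unfold heightB
  rw [if_neg fun h0 => one_ne_zero_circ (h0.1.symm.trans h'.1), min_eq_right]
  have : -1 < ⌈Q.y⌉ := by
    rw [Int.lt_ceil]
    push_cast
    linarith [h'.2]
  exact_mod_cast (by omega : 0 ≤ ⌈Q.y⌉)

/-- Moving vertically from a point, one remains on a column. -/
lemma vertical_along {P : Pt a e} {u : ℂ} (hu : u ∈ dirs a e P.x P.y)
    (hv : u = Complex.I ∨ u = -Complex.I) :
    (P ∈ columnA ∧ Along P u fun Q t => Q ∈ columnA ∧ Q.y = P.y + u.im * t) ∨
      (P ∈ columnB ∧ Along P u fun Q t => Q ∈ columnB ∧ Q.y = P.y + u.im * t) := by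
  have hx0 : ∀ t : ℝ, P.x + (t * u.re : ℝ) = P.x := by
    rcases hv with rfl | rfl <;> simp
  rcases mem_dirs.1 hu with ⟨-, h⟩ | ⟨h, rfl⟩ | ⟨h, rfl⟩
  · exfalso
    rcases hv with rfl | rfl <;> rcases h with h | h <;> simpa using congrArg Complex.re h
  · rcases h with h | h
    · refine Or.inl ⟨mem_columnA_iff.2 ⟨h.1, h.2.1⟩, along_of_forall one_pos fun t ht Q hx hy => ?_⟩
      rw [hx0] at hx
      simp only [Complex.I_im, mul_one] at hy
      exact ⟨mem_columnA_iff.2 ⟨hx.trans h.1, by linarith [ht.1]⟩, by simp [hy]⟩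
    · refine Or.inr ⟨mem_columnB_iff.2 ⟨h.1, h.2.2.le⟩, along_of_forall
        (ε := 1 / 2 - P.y) (by linarith) fun t ht Q hx hy => ?_⟩
      rw [hx0] at hx
      simp only [Complex.I_im, mul_one] at hy
      exact ⟨mem_columnB_iff.2 ⟨hx.trans h.1, by linarith [ht.2]⟩, by simp [hy]⟩
  · rcases h with h | h
    · refine Or.inl ⟨mem_columnA_iff.2 ⟨h.1, h.2.1.le⟩, along_of_forall
        (ε := P.y + 1 / 2) (by linarith) fun t ht Q hx hy => ?_⟩
      rw [hx0] at hx
      simp only [Complex.neg_im, Complex.I_im, mul_neg, mul_one] at hy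
      exact ⟨mem_columnA_iff.2 ⟨hx.trans h.1, by linarith [ht.2]⟩, by simp [hy]⟩
    · refine Or.inr ⟨mem_columnB_iff.2 ⟨h.1, h.2.2⟩, along_of_forall one_pos fun t ht Q hx hy => ?_⟩
      rw [hx0] at hx
      simp only [Complex.neg_im, Complex.I_im, mul_neg, mul_one] at hy
      exact ⟨mem_columnB_iff.2 ⟨hx.trans h.1, by linarith [ht.1]⟩, by simp [hy]⟩

/-- Moving horizontally from a point, one remains on a level. -/
lemma horizontal_along {P : Pt a e} {u : ℂ} (hu : u ∈ dirs a e P.x P.y)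
    (hv : ¬ (u = Complex.I ∨ u = -Complex.I)) :
    ∃ j : ℤ, Rung a e j ∧ P.y = j ∧ (u = 1 ∨ u = -1) ∧ Along P u fun Q _ => Q.y = j := by
  rcases mem_dirs.1 hu with ⟨⟨j, h1, h2, hj⟩, h⟩ | ⟨-, h⟩ | ⟨-, h⟩
  · refine ⟨j, rung_intCast.2 ⟨h1, h2⟩, hj, h, along_of_forall one_pos fun t _ Q _ hy => ?_⟩
    rcases h with rfl | rfl <;> simpa [hj] using hy
  · exact absurd (Or.inl h) hv
  · exact absurd (Or.inr h) hv

lemma eq_of_columns {P : Pt a e} (hA : P ∈ columnA) (hB : P ∈ columnB) : False :=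
  one_ne_zero_circ (hB.1.symm.trans hA.1)

lemma linEquiv_columnA {P Q : Pt a e} (hP : P ∈ columnA) (hQ : Q ∈ columnA) :
    LinEquiv (Pt a e) (chip P) (chip Q) := by
  have ha : (0 : ℝ) ≤ a := Nat.cast_nonneg a
  have hL : (-1 / 2 : ℝ) ∈ Icc (-1 / 2 : ℝ) (a + 1 / 2) := ⟨le_rfl, by linarith⟩
  refine linEquiv_of_bottom (L := pt 0 (-1 / 2) (mem_columnA hL)) (fun Y hY hne => ?_) hP hQ
  have hinj : ∀ {P Q : Pt a e}, P ∈ columnA → Q ∈ columnA → P.y = Q.y → P = Q :=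
    fun hP hQ h => Pt.ext (hP.1.trans hQ.1.symm) h
  have hLY : ∀ Y : Pt a e, Y ∈ columnA → (-1 / 2 < Y.y ↔ Y ≠ pt 0 (-1 / 2) (mem_columnA hL)) := by
    intro Y hY
    rw [hY.2.1.lt_iff_ne]
    constructor
    · rintro h rfl
      exact h rfl
    · exact fun h h' => h (hinj hY ⟨rfl, hL⟩ h'.symm)
  refine linEquiv_bottom (c := columnA) (h := heightA) ?_ ?_ ?_ ⟨rfl, hL⟩ hY ?_ ?_ ?_
  · intro P hP Q hQ h
    rw [heightA_of_mem hP, heightA_of_mem hQ] at h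
    exact hinj hP hQ h
  · intro P hP u hu hu'
    rcases vertical_along hu' hu with ⟨-, h⟩ | ⟨h, -⟩
    · filter_upwards [h] with t ht Q hx hy
      rw [heightA_of_mem (ht Q hx hy).1, heightA_of_mem hP, (ht Q hx hy).2]
    · exact (eq_of_columns hP h).elim
  · intro P u hu h
    by_cases hu' : u = Complex.I ∨ u = -Complex.I
    · rcases vertical_along hu hu' with ⟨h', -⟩ | ⟨h', hA⟩
      · exact absurd ⟨h', hu'⟩ h
      · filter_upwards [hA] with t ht Q hx hy
        rw [heightA_columnB (ht Q hx hy).1, heightA_columnB h']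
    · obtain ⟨j, -, hj, -, hA⟩ := horizontal_along hu hu'
      filter_upwards [hA] with t ht Q hx hy
      rw [heightA_rung (ht Q hx hy), heightA_rung hj]
  · rw [heightA_of_mem ⟨rfl, hL⟩, heightA_of_mem hY]
    exact (hLY Y hY).2 hne
  · intro P hP h
    rw [heightA_of_mem hP, heightA_of_mem hY] at h
    exact Or.inl ⟨hP.1, hP.2.1, h.trans_le Y.le_half⟩
  · intro P hP
    rw [← hLY P hP]
    refine ⟨fun h => ?_, fun h => Or.inl ⟨hP.1, h, P.le_half⟩⟩
    rcases h with h | h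
    · exact h.2.1
    · exact absurd (h.1.symm.trans hP.1) one_ne_zero_circ

lemma linEquiv_columnB {P Q : Pt a e} (hP : P ∈ columnB) (hQ : Q ∈ columnB) :
    LinEquiv (Pt a e) (chip P) (chip Q) := by
  have he : (0 : ℝ) ≤ e := Nat.cast_nonneg e
  have hL : (-e - 1 / 2 : ℝ) ∈ Icc (-e - 1 / 2 : ℝ) (1 / 2) := ⟨le_rfl, by linarith⟩
  refine linEquiv_of_bottom (L := pt (1 : ℝ) (-e - 1 / 2) (mem_columnB hL))
    (fun Y hY hne => ?_) hP hQ
  have hinj : ∀ {P Q : Pt a e}, P ∈ columnB → Q ∈ columnB → P.y = Q.y → P = Q :=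
    fun hP hQ h => Pt.ext (hP.1.trans hQ.1.symm) h
  have hLY : ∀ Y : Pt a e, Y ∈ columnB →
      (-e - 1 / 2 < Y.y ↔ Y ≠ pt (1 : ℝ) (-e - 1 / 2) (mem_columnB hL)) := by
    intro Y hY
    rw [hY.2.1.lt_iff_ne]
    constructor
    · rintro h rfl
      exact h rfl
    · exact fun h h' => h (hinj hY ⟨rfl, hL⟩ h'.symm)
  refine linEquiv_bottom (c := columnB) (h := heightB) ?_ ?_ ?_ ⟨rfl, hL⟩ hY ?_ ?_ ?_
  · intro P hP Q hQ h
    rw [heightB_of_mem hP, heightB_of_mem hQ] at h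
    exact hinj hP hQ h
  · intro P hP u hu hu'
    rcases vertical_along hu' hu with ⟨h, -⟩ | ⟨-, h⟩
    · exact (eq_of_columns h hP).elim
    · filter_upwards [h] with t ht Q hx hy
      rw [heightB_of_mem (ht Q hx hy).1, heightB_of_mem hP, (ht Q hx hy).2]
  · intro P u hu h
    by_cases hu' : u = Complex.I ∨ u = -Complex.I
    · rcases vertical_along hu hu' with ⟨h', hA⟩ | ⟨h', -⟩
      · filter_upwards [hA] with t ht Q hx hy
        rw [heightB_columnA (ht Q hx hy).1, heightB_columnA h']
      · exact absurd ⟨h', hu'⟩ h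
    · obtain ⟨j, -, hj, -, hA⟩ := horizontal_along hu hu'
      filter_upwards [hA] with t ht Q hx hy
      rw [heightB_rung (ht Q hx hy), heightB_rung hj]
  · rw [heightB_of_mem ⟨rfl, hL⟩, heightB_of_mem hY]
    exact (hLY Y hY).2 hne
  · intro P hP h
    rw [heightB_of_mem hP, heightB_of_mem hY] at h
    exact Or.inr ⟨hP.1, hP.2.1, h.trans_le hY.2.2⟩
  · intro P hP
    rw [← hLY P hP]
    refine ⟨fun h => ?_, fun h => Or.inr ⟨hP.1, h, hP.2.2⟩⟩
    rcases h with h | h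
    · exact absurd (hP.1.symm.trans h.1) one_ne_zero_circ
    · exact h.2.1

lemma up_down_of_x_ne {x : Circ} (h0 : x ≠ 0) (h1 : x ≠ (1 : ℝ)) (y : ℝ) :
    ¬ Up a e x y ∧ ¬ Down a e x y :=
  ⟨fun h => h.elim (fun h => h0 h.1) fun h => h1 h.1,
    fun h => h.elim (fun h => h0 h.1) fun h => h1 h.1⟩

lemma circ_coe_ne {s : ℝ} (hs : 1 < s ∧ s < 4) : (s : Circ) ≠ 0 ∧ (s : Circ) ≠ (1 : ℝ) := by
  constructor
  · rw [Ne, circ_coe_eq_zero (abs_lt.2 ⟨by linarith, by linarith⟩)]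
    linarith
  · rw [Ne, circ_coe_eq (abs_lt.2 ⟨by linarith, by linarith⟩)]
    linarith

/-- Removing from every level one point which is not on a column leaves a skeleton. -/
lemma mem_skeleton_iff {s : ℤ → ℝ} (hs : ∀ j, 1 < s j ∧ s j < 4) (Q : Pt a e) :
    Q ∈ skeleton (fun j => Ioo (s j - 4) (s j)) ↔
      ∀ j : ℤ, Rung a e j → Q ≠ lev (s j : ℝ) j := by
  constructor
  · rintro (⟨k, hk, t, ht, hx⟩ | hA | hB) j hj rfl
    · rw [lev_y hj] at hk
      rw [lev_x hj] at hx
      obtain rfl : j = k := by exact_mod_cast hk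
      rw [circ_coe_eq (abs_lt.2 ⟨by linarith [ht.2], by linarith [ht.1]⟩)] at hx
      exact ht.2.ne hx.symm
    · exact (circ_coe_ne (hs j)).1 ((lev_x hj).symm.trans hA.1)
    · exact (circ_coe_ne (hs j)).2 ((lev_x hj).symm.trans hB.1)
  · intro h
    rcases Q.mem with ⟨j, h1, h2, hj⟩ | hA | hB
    · have hR : Rung a e j := rung_intCast.2 ⟨h1, h2⟩
      refine Or.inl ⟨j, hj, ?_⟩
      have hx : Q.x ∈ ((↑) : ℝ → Circ) '' Ioc (s j - 4) (s j - 4 + 4) := by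
        rw [AddCircle.coe_image_Ioc_eq]
        trivial
      obtain ⟨t, ht, hx⟩ := hx
      refine ⟨t, ⟨ht.1, lt_of_le_of_ne (by linarith [ht.2]) ?_⟩, hx.symm⟩
      rintro rfl
      exact h j hR (((eq_lev_iff hR Q).2 ⟨hx.symm, hj⟩).symm)
    · exact Or.inr (Or.inl hA)
    · exact Or.inr (Or.inr hB)

/-- The sum of one chip on every level. -/
noncomputable def levelSum (a e : ℕ) (s : ℤ → ℝ) : Divisor (Pt a e) :=
  ∑ j ∈ Finset.Icc (-(e : ℤ)) a, chip (lev (s j : ℝ) j)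

lemma levelSum_of_mem {s : ℤ → ℝ} (hs : ∀ j, 1 < s j ∧ s j < 4) {Q : Pt a e}
    (hQ : Q ∈ skeleton (fun j => Ioo (s j - 4) (s j))) : levelSum a e s Q = 0 := by
  rw [levelSum, Finsupp.finsetSum_apply]
  refine Finset.sum_eq_zero fun j hj => Finsupp.single_eq_of_ne ?_
  exact (mem_skeleton_iff hs Q).1 hQ j (rung_intCast.2 (Finset.mem_Icc.1 hj))

lemma levelSum_le_one (s : ℤ → ℝ) (Q : Pt a e) : levelSum a e s Q ≤ 1 := by
  classical
  rw [levelSum, Finsupp.finsetSum_apply]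
  simp only [Finsupp.single_apply]
  rw [← Finset.sum_filter, Finset.sum_const, nsmul_eq_mul, mul_one]
  have : (Finset.filter (fun j => lev (s j : ℝ) j = Q) (Finset.Icc (-(e : ℤ)) a)).card ≤ 1 := by
    refine Finset.card_le_one.2 fun i hi j hj => ?_
    rw [Finset.mem_filter, Finset.mem_Icc, ← rung_intCast] at hi hj
    have h1 := lev_y (x := (s i : ℝ)) hi.1
    have h2 := lev_y (x := (s j : ℝ)) hj.1
    rw [hi.2] at h1
    rw [hj.2] at h2
    exact_mod_cast h1.symm.trans h2
  exact_mod_cast this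

lemma exists_slopes_of_max {f : Pt a e → ℝ} {Q : Pt a e} (hmax : ∀ R, f R ≤ f Q) {m : ℤ}
    (h : HasOrderAt (Pt a e) f Q m) {r : ℝ} {U : Set (Pt a e)}
    (c : StarChart Q (dirs a e Q.x Q.y) r U (chart Q)) :
    ∃ s : dirs a e Q.x Q.y → ℤ, (∀ u, s u ≤ 0) ∧ m = ∑ u, s u ∧
      ∀ u, s u = 0 → ∃ ε > (0 : ℝ), ∀ t ∈ Icc (0 : ℝ) ε, f (c.ray u t) = f Q := by
  obtain ⟨s, hs, hm⟩ := c.completeArcs.hasOrderAt_iff.1 h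
  refine ⟨s, fun u => ?_, hm, fun u hu => ?_⟩
  · obtain ⟨ε, hε, H⟩ := hs u
    have := H ε ⟨hε.le, le_rfl⟩
    have h0 := hmax (c.ray u ε)
    rw [c.ray_zero u.2] at this
    have h1 : (s u : ℝ) * ε ≤ 0 := by linarith
    by_contra! h2
    have h2 : (0 : ℝ) < s u := by exact_mod_cast h2
    linarith [mul_pos h2 hε]
  · obtain ⟨ε, hε, H⟩ := hs u
    refine ⟨ε, hε, fun t ht => ?_⟩
    rw [H t ht, c.ray_zero u.2, hu]
    simp

/-- A sum of chips, one on every level and none of them on a column, is not equivalent to an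
effective divisor containing a further point. -/
lemma not_equivEffective {s : ℤ → ℝ} (hs : ∀ j, 1 < s j ∧ s j < 4) {P : Pt a e}
    (hP : ∀ j : ℤ, Rung a e j → P ≠ lev (s j : ℝ) j) :
    ¬ EquivEffective (Pt a e) (levelSum a e s - chip P) := by
  classical
  rintro ⟨D', hD', f, ⟨hf, -⟩, hord⟩
  obtain ⟨Q₀, -, hQ₀⟩ := isCompact_univ.exists_isMaxOn univ_nonempty hf.continuousOn
  have hmax : ∀ R, f R ≤ f Q₀ := fun R => hQ₀ (mem_univ R)
  let K : Set (Pt a e) := skeleton (fun j => Ioo (s j - 4) (s j))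
  have hK : IsPreconnected K := isPreconnected_skeleton (fun j => isPreconnected_Ioo)
    (fun j => ⟨by linarith [(hs j).2], by linarith [(hs j).1]⟩)
    (fun j => ⟨by linarith [(hs j).2], by linarith [(hs j).1]⟩)
  have hPK : P ∈ K := (mem_skeleton_iff hs P).2 hP
  have hone : ∀ Q : Pt a e, 0 ≤ chip P Q := effective_single P zero_le_one
  have hloc : ∀ Q ∈ K, f Q = f Q₀ → chip P Q = 0 ∧ ∀ᶠ R in 𝓝 Q, f R = f Q₀ := by
    intro Q hQ hfQ
    obtain ⟨r, U, c⟩ := exists_starChart Q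
    obtain ⟨σ, h1, h2, h3⟩ := exists_slopes_of_max (fun R => hfQ ▸ hmax R) (hord Q) c
    rw [Finsupp.sub_apply, levelSum_of_mem hs hQ] at h2
    have h4 : ∑ u, σ u ≤ 0 := Finset.sum_nonpos fun u _ => h1 u
    have h5 := hD' Q
    have h6 := hone Q
    have h7 : ∑ u, σ u = 0 := by linarith
    have h8 := (Finset.sum_eq_zero_iff_of_nonpos fun u _ => h1 u).1 h7
    refine ⟨by linarith, c.eventually fun u hu => ?_⟩
    rw [← hfQ]
    exact h3 ⟨u, hu⟩ (h8 _ (Finset.mem_univ _))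
  have hne : ∃ Q ∈ K, f Q = f Q₀ := by
    by_cases hQK : Q₀ ∈ K
    · exact ⟨Q₀, hQK, rfl⟩
    have hQK' := hQK
    rw [mem_skeleton_iff hs] at hQK'
    push Not at hQK'
    obtain ⟨j, hj, hQj⟩ := hQK'
    obtain ⟨hx, hy⟩ := (eq_lev_iff hj Q₀).1 hQj.symm
    have hR : Rung a e Q₀.y := hy ▸ hj
    have hne := circ_coe_ne (hs j)
    rw [← hx] at hne
    obtain ⟨hU, hD⟩ := up_down_of_x_ne (a := a) (e := e) hne.1 hne.2 Q₀.y
    obtain ⟨r, U, c⟩ := exists_starChart Q₀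
    obtain ⟨σ, h1, h2, h3⟩ := exists_slopes_of_max hmax (hord Q₀) c
    have h4 : ∃ u, σ u = 0 := by
      by_contra! h
      have h4 : ∑ u, σ u ≤ ∑ u : dirs a e Q₀.x Q₀.y, (-1 : ℤ) := Finset.sum_le_sum fun u _ => by
        have := h1 u
        have := h u
        omega
      rw [Finset.sum_const, Finset.card_univ, Fintype.card_coe, card_dirs, if_pos hR, if_neg hU,
        if_neg hD] at h4
      have h5 := hD' Q₀
      have h6 := hone Q₀
      have h7 := levelSum_le_one s Q₀
      rw [Finsupp.sub_apply] at h2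
      have h8 : ∑ u, σ u ≤ -2 := h4.trans (by norm_num)
      linarith
    obtain ⟨⟨u, hu⟩, h4⟩ := h4
    obtain ⟨ε, hε, H⟩ := h3 _ h4
    have hu1 : u = 1 ∨ u = -1 := by
      rcases mem_dirs.1 hu with h | h | h
      exacts [h.2, absurd h.1 hU, absurd h.1 hD]
    have htpos : 0 < min ε (min r 1) := lt_min hε (lt_min c.pos one_pos)
    set t := min ε (min r 1) with ht
    have ht1 : t ≤ ε := min_le_left _ _
    have ht2 : t ≤ r := (min_le_right _ _).trans (min_le_left _ _)
    have ht3 : t ≤ 1 := (min_le_right _ _).trans (min_le_right _ _)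
    obtain ⟨hcx, hcy⟩ := ray_coords c hu ⟨htpos.le, ht2⟩
    refine ⟨c.ray u t, (mem_skeleton_iff hs _).2 fun k hk hck => ?_, H t ⟨htpos.le, ht1⟩⟩
    obtain ⟨hkx, hky⟩ := (eq_lev_iff hk _).1 hck.symm
    have him : u.im = 0 := by rcases hu1 with rfl | rfl <;> simp
    have hre : |t * u.re| = t := by rcases hu1 with rfl | rfl <;> simp [htpos.le]
    rw [him, mul_zero, add_zero] at hcy
    obtain rfl : j = k := by exact_mod_cast hy.symm.trans (hcy.symm.trans hky)
    have hkx := hcx.symm.trans hkx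
    rw [hx, add_eq_left, circ_coe_eq_zero (by linarith), ← abs_eq_zero, hre] at hkx
    exact htpos.ne' hkx
  have := isPreconnected_iff_preconnectedSpace.1 hK
  have hclopen : IsClopen {Q : K | f Q = f Q₀} := by
    refine ⟨isClosed_eq (hf.comp continuous_subtype_val) continuous_const,
      isOpen_iff_mem_nhds.2 fun Q hQ => ?_⟩
    exact (continuous_subtype_val.tendsto Q).eventually (hloc Q Q.2 hQ).2
  obtain ⟨Q₁, hQ₁K, hQ₁⟩ := hne
  have huniv := hclopen.eq_univ ⟨⟨Q₁, hQ₁K⟩, hQ₁⟩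
  have hPmem : (⟨P, hPK⟩ : K) ∈ {Q : K | f Q = f Q₀} := huniv ▸ mem_univ _
  have := (hloc P hPK hPmem).1
  rw [Finsupp.single_eq_same] at this
  exact one_ne_zero this

end Ladder

/-- If a space is covered by disjoint nonempty preconnected open sets, then these sets are its
connected components. -/
lemma card_connectedComponents_eq {X ι κ : Type*} [TopologicalSpace X] {S : ι → Set X}
    (hne : ∀ i, (S i).Nonempty) (hS : ∀ i, IsPreconnected (S i)) (hopen : ∀ i, IsOpen (S i))
    (hcover : ∀ x, ∃ i, x ∈ S i) {key : ι → κ} (hkey : key.Injective) {label : X → κ}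
    (hlabel : ∀ i, ∀ x ∈ S i, label x = key i) :
    Nat.card (ConnectedComponents X) = Nat.card ι := by
  have hdisj : ∀ {i j x}, x ∈ S i → x ∈ S j → i = j := fun hi hj =>
    hkey ((hlabel _ _ hi).symm.trans (hlabel _ _ hj))
  choose x hx using hne
  refine (Nat.card_congr (Equiv.ofBijective (fun i => (x i : ConnectedComponents X)) ⟨?_, ?_⟩)).symm
  · intro i j hij
    have hclopen : IsClopen (S i) := by
      refine ⟨⟨?_⟩, hopen i⟩
      have : (S i)ᶜ = ⋃ k ∈ {k | k ≠ i}, S k := by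
        ext y
        simp only [mem_compl_iff, mem_iUnion, mem_ofPred_eq, exists_prop]
        constructor
        · intro hy
          obtain ⟨k, hk⟩ := hcover y
          exact ⟨k, fun h => hy (h ▸ hk), hk⟩
        · rintro ⟨k, hki, hk⟩ hy
          exact hki (hdisj hk hy)
      rw [this]
      exact isOpen_biUnion fun k _ => hopen k
    have h1 : x j ∈ connectedComponent (x i) := ConnectedComponents.coe_eq_coe'.1 hij.symm
    exact hdisj (hclopen.connectedComponent_subset (hx i) h1) (hx j)
  · intro c
    obtain ⟨y, rfl⟩ := ConnectedComponents.surjective_coe c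
    obtain ⟨i, hi⟩ := hcover y
    exact ⟨i, ConnectedComponents.coe_eq_coe'.2 ((hS i).subset_connectedComponent hi (hx i))⟩

namespace Ladder

variable {a e : ℕ}

lemma isVertex_of_rung {P : Pt a e} (h : Rung a e P.y) :
    IsVertex (Pt a e) P ↔ Up a e P.x P.y := by
  rw [isVertex_iff, card_dirs, if_pos h, ← h.up_iff_down]
  split_ifs with h' <;> simp [h']

lemma isVertex_of_not_rung {P : Pt a e} (h : ¬ Rung a e P.y) :
    IsVertex (Pt a e) P ↔ ¬ (Up a e P.x P.y ∧ Down a e P.x P.y) := by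
  rw [isVertex_iff, card_dirs, if_neg h]
  split_ifs with h1 h2 <;> simp_all

/-- The heights of the vertices on a column with rungs at the heights `lo, …, hi`. -/
noncomputable def vertexHeight (lo hi k : ℤ) : ℝ := max (lo - 1 / 2 : ℝ) (min (k : ℝ) (hi + 1 / 2))

lemma vertexHeight_injOn {lo hi : ℤ} (h : lo ≤ hi) :
    InjOn (vertexHeight lo hi) (Icc (lo - 1) (hi + 1)) := by
  refine StrictMonoOn.injOn fun k hk l hl hkl => ?_
  have h0 : (lo : ℝ) ≤ hi := by exact_mod_cast h
  have h1 : (lo - 1 : ℝ) + 1 ≤ l := by exact_mod_cast (show lo - 1 + 1 ≤ l by linarith [hk.1])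
  have h2 : (k : ℝ) + 1 ≤ hi + 1 := by exact_mod_cast (show k + 1 ≤ hi + 1 by linarith [hl.2])
  have h3 : (k : ℝ) < l := by exact_mod_cast hkl
  refine max_lt ?_ (lt_of_le_of_lt (min_le_left _ _) ?_)
  · exact lt_of_lt_of_le (lt_min (by linarith) (by linarith)) (le_max_right _ _)
  · exact lt_of_lt_of_le (lt_min (by linarith) (by linarith)) (le_max_right _ _)

lemma exists_vertexHeight {lo hi : ℤ} (h : lo ≤ hi) (y : ℝ) :
    (∃ k ∈ Finset.Icc (lo - 1) (hi + 1), y = vertexHeight lo hi k) ↔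
      y = lo - 1 / 2 ∨ y = hi + 1 / 2 ∨ ∃ j : ℤ, lo ≤ j ∧ j ≤ hi ∧ y = j := by
  have h0 : (lo : ℝ) ≤ hi := by exact_mod_cast h
  have hlo : vertexHeight lo hi (lo - 1) = lo - 1 / 2 :=
    max_eq_left ((min_le_left _ _).trans (by push_cast; linarith))
  have hhi : vertexHeight lo hi (hi + 1) = hi + 1 / 2 := by
    rw [vertexHeight, min_eq_right (by push_cast; linarith), max_eq_right (by linarith)]
  have hj : ∀ j : ℤ, lo ≤ j → j ≤ hi → vertexHeight lo hi j = j := by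
    intro j h1 h2
    have h1 : (lo : ℝ) ≤ j := by exact_mod_cast h1
    have h2 : (j : ℝ) ≤ hi := by exact_mod_cast h2
    rw [vertexHeight, min_eq_left (by linarith), max_eq_right (by linarith)]
  constructor
  · rintro ⟨k, hk, rfl⟩
    rw [Finset.mem_Icc] at hk
    rcases eq_or_lt_of_le hk.1 with rfl | h1
    · exact Or.inl hlo
    rcases eq_or_lt_of_le hk.2 with rfl | h2
    · exact Or.inr (Or.inl hhi)
    · exact Or.inr (Or.inr ⟨k, by omega, by omega, hj k (by omega) (by omega)⟩)
  · rintro (rfl | rfl | ⟨j, h1, h2, rfl⟩)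
    · exact ⟨lo - 1, Finset.mem_Icc.2 (by omega), hlo.symm⟩
    · exact ⟨hi + 1, Finset.mem_Icc.2 (by omega), hhi.symm⟩
    · exact ⟨j, Finset.mem_Icc.2 (by omega), (hj j h1 h2).symm⟩

lemma isVertex_iff_vertexHeight (P : Pt a e) : IsVertex (Pt a e) P ↔
    (P.x = 0 ∧ ∃ k ∈ Finset.Icc (0 - 1) ((a : ℤ) + 1), P.y = vertexHeight 0 a k) ∨
    (P.x = (1 : ℝ) ∧ ∃ k ∈ Finset.Icc (-(e : ℤ) - 1) (0 + 1), P.y = vertexHeight (-e) 0 k) := by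
  have ha : (0 : ℝ) ≤ a := Nat.cast_nonneg a
  have he : (0 : ℝ) ≤ e := Nat.cast_nonneg e
  rw [exists_vertexHeight (by omega), exists_vertexHeight (by omega)]
  have h01 := one_ne_zero_circ
  push_cast
  by_cases hR : Rung a e P.y
  · rw [isVertex_of_rung hR]
    obtain ⟨j, h1, h2, hj⟩ := hR
    constructor
    · rintro (⟨hx, h3, h4⟩ | ⟨hx, h3, h4⟩)
      · refine Or.inl ⟨hx, Or.inr (Or.inr ⟨j, ?_, h2, hj⟩)⟩
        have : (-1 : ℝ) < j := by linarith
        have : -1 < j := by exact_mod_cast this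
        omega
      · refine Or.inr ⟨hx, Or.inr (Or.inr ⟨j, h1, ?_, hj⟩)⟩
        have : (j : ℝ) < 1 := by linarith
        have : j < 1 := by exact_mod_cast this
        omega
    · rintro (⟨hx, h | h | ⟨k, h3, h4, hk⟩⟩ | ⟨hx, h | h | ⟨k, h3, h4, hk⟩⟩)
      · exact absurd (hj.symm.trans h) (by have := not_int_half j (-1); push_cast at this; grind)
      · exact absurd (hj.symm.trans h) (not_int_half j a)
      · have h3 : (0 : ℝ) ≤ k := by exact_mod_cast h3
        have h4 : (k : ℝ) ≤ a := by exact_mod_cast h4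
        exact Or.inl ⟨hx, by linarith, by linarith⟩
      · exact absurd (hj.symm.trans h)
          (by have := not_int_half j (-e - 1); push_cast at this; grind)
      · exact absurd (hj.symm.trans h) (by have := not_int_half j 0; push_cast at this; grind)
      · have h3 : (-e : ℝ) ≤ k := by exact_mod_cast h3
        have h4 : (k : ℝ) ≤ 0 := by exact_mod_cast h4
        exact Or.inr ⟨hx, by linarith, by linarith⟩
  · rw [isVertex_of_not_rung hR]
    constructor
    · intro h
      rcases P.mem with h' | ⟨hx, h1, h2⟩ | ⟨hx, h1, h2⟩
      · exact absurd h' hR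
      · refine Or.inl ⟨hx, ?_⟩
        by_contra! hc
        have h3 : P.y ≠ -1 / 2 := fun h' => hc.1 (by linarith)
        have h3 := lt_of_le_of_ne h1 h3.symm
        have h4 := lt_of_le_of_ne h2 hc.2.1
        exact h ⟨Or.inl ⟨hx, h1, h4⟩, Or.inl ⟨hx, h3, h2⟩⟩
      · refine Or.inr ⟨hx, ?_⟩
        by_contra! hc
        have h3 : P.y ≠ 1 / 2 := fun h' => hc.2.1 (by linarith)
        have h3 := lt_of_le_of_ne h2 h3
        have h4 := lt_of_le_of_ne h1 hc.1.symm
        exact h ⟨Or.inr ⟨hx, h1, h3⟩, Or.inr ⟨hx, h4, h2⟩⟩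
    · rintro h ⟨hU, hD⟩
      rcases h with ⟨hx, h⟩ | ⟨hx, h⟩
      · have hU := hU.resolve_right fun h' => h01 (h'.1.symm.trans hx)
        have hD := hD.resolve_right fun h' => h01 (h'.1.symm.trans hx)
        rcases h with h | h | ⟨j, h1, h2, hj⟩
        · linarith [hD.2.1]
        · linarith [hU.2.2]
        · exact hR ⟨j, by omega, h2, hj⟩
      · have hU := hU.resolve_left fun h' => h01 (hx.symm.trans h'.1)
        have hD := hD.resolve_left fun h' => h01 (hx.symm.trans h'.1)
        rcases h with h | h | ⟨j, h1, h2, hj⟩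
        · linarith [hD.2.1]
        · linarith [hU.2.2]
        · exact hR ⟨j, h1, by omega, hj⟩

lemma vertexHeight_mem {lo hi : ℤ} (h : lo ≤ hi) (k : ℤ) :
    vertexHeight lo hi k ∈ Icc (lo - 1 / 2 : ℝ) (hi + 1 / 2) := by
  have h0 : (lo : ℝ) ≤ hi := by exact_mod_cast h
  exact ⟨le_max_left _ _, max_le (by linarith) (min_le_right _ _)⟩

variable (a e) in
lemma card_vertices : Nat.card {P : Pt a e // IsVertex (Pt a e) P} = a + e + 6 := by
  have hA : ∀ k, Mem a e 0 (vertexHeight 0 a k) := fun k => mem_columnA (by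
    have := vertexHeight_mem (lo := 0) (hi := a) (by omega) k
    push_cast at this
    exact ⟨by linarith [this.1], this.2⟩)
  have hB : ∀ k, Mem a e (1 : ℝ) (vertexHeight (-e) 0 k) := fun k => mem_columnB (by
    have := vertexHeight_mem (lo := -e) (hi := 0) (by omega) k
    push_cast at this
    exact ⟨this.1, by linarith [this.2]⟩)
  let F : Finset.Icc (0 - 1) ((a : ℤ) + 1) ⊕ Finset.Icc (-(e : ℤ) - 1) (0 + 1) →
      {P : Pt a e // IsVertex (Pt a e) P} := Sum.elim
    (fun k => ⟨pt _ _ (hA k), (isVertex_iff_vertexHeight _).2 (Or.inl ⟨rfl, k, k.2, rfl⟩)⟩)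
    (fun k => ⟨pt _ _ (hB k), (isVertex_iff_vertexHeight _).2 (Or.inr ⟨rfl, k, k.2, rfl⟩)⟩)
  have hF : F.Bijective := by
    constructor
    · rintro (⟨k, hk⟩ | ⟨k, hk⟩) (⟨l, hl⟩ | ⟨l, hl⟩) h
      · have hy : vertexHeight 0 a k = vertexHeight 0 a l := congrArg (fun P => P.1.y) h
        have := vertexHeight_injOn (by omega) (Finset.mem_Icc.1 hk) (Finset.mem_Icc.1 hl) hy
        simp only [this]
      · have hx : (0 : Circ) = (1 : ℝ) := congrArg (fun P => P.1.x) h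
        exact absurd hx.symm one_ne_zero_circ
      · have hx : ((1 : ℝ) : Circ) = 0 := congrArg (fun P => P.1.x) h
        exact absurd hx one_ne_zero_circ
      · have hy : vertexHeight (-e) 0 k = vertexHeight (-e) 0 l := congrArg (fun P => P.1.y) h
        have := vertexHeight_injOn (by omega) (Finset.mem_Icc.1 hk) (Finset.mem_Icc.1 hl) hy
        simp only [this]
    · rintro ⟨P, hP⟩
      rcases (isVertex_iff_vertexHeight P).1 hP with ⟨hx, k, hk, hy⟩ | ⟨hx, k, hk, hy⟩
      · exact ⟨Sum.inl ⟨k, hk⟩, Subtype.ext (Pt.ext hx.symm hy.symm)⟩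
      · exact ⟨Sum.inr ⟨k, hk⟩, Subtype.ext (Pt.ext hx.symm hy.symm)⟩
  rw [← Nat.card_congr (Equiv.ofBijective F hF), Nat.card_eq_fintype_card, Fintype.card_sum,
    Fintype.card_coe, Fintype.card_coe, Int.card_Icc, Int.card_Icc]
  omega

/-- The set of points of height `y` over an open interval. -/
def levelArc (a e : ℕ) (y α β : ℝ) : Set (Pt a e) := {Q | Q.y = y ∧ ∃ t ∈ Ioo α β, Q.x = (t : ℝ)}

/-- The set of points over `x` whose height lies in an open interval. -/
def columnArc (a e : ℕ) (x : Circ) (α β : ℝ) : Set (Pt a e) := {Q | Q.x = x ∧ Q.y ∈ Ioo α β}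

lemma isOpen_levelArc {y α β : ℝ}
    (h : ∀ Q ∈ levelArc a e y α β, ¬ Up a e Q.x Q.y ∧ ¬ Down a e Q.x Q.y) :
    IsOpen (levelArc a e y α β) := by
  refine isOpen_iff_mem_nhds.2 fun P hP => eventually_of_along fun u hu => ?_
  have hu : u = 1 ∨ u = -1 := by
    rcases mem_dirs.1 hu with h' | h' | h'
    exacts [h'.2, absurd h'.1 (h P hP).1, absurd h'.1 (h P hP).2]
  obtain ⟨hy, s, hs, hx⟩ := hP
  have hs' : 0 < min (s - α) (β - s) := lt_min (sub_pos.2 hs.1) (sub_pos.2 hs.2)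
  refine along_of_forall (half_pos hs') fun t ht Q hQx hQy => ⟨?_, s + t * u.re, ?_, ?_⟩
  · rcases hu with rfl | rfl <;> simpa [hy] using hQy
  · have h1 := min_le_left (s - α) (β - s)
    have h2 := min_le_right (s - α) (β - s)
    have h3 := ht.1
    have h4 := ht.2
    rcases hu with rfl | rfl
    · rw [Complex.one_re]
      exact ⟨by linarith, by linarith⟩
    · rw [Complex.neg_re, Complex.one_re]
      exact ⟨by linarith, by linarith⟩
  · rw [hQx, hx, AddCircle.coe_add]

lemma isOpen_columnArc {x : Circ} {α β : ℝ} (h : ∀ Q ∈ columnArc a e x α β, ¬ Rung a e Q.y) :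
    IsOpen (columnArc a e x α β) := by
  refine isOpen_iff_mem_nhds.2 fun P hP => eventually_of_along fun u hu => ?_
  have hu : u = Complex.I ∨ u = -Complex.I := by
    rcases mem_dirs.1 hu with h' | h' | h'
    exacts [absurd h'.1 (h P hP), Or.inl h'.2, Or.inr h'.2]
  obtain ⟨hx, hs⟩ := hP
  have hs' : 0 < min (P.y - α) (β - P.y) := lt_min (sub_pos.2 hs.1) (sub_pos.2 hs.2)
  refine along_of_forall (half_pos hs') fun t ht Q hQx hQy => ⟨?_, ?_⟩
  · rcases hu with rfl | rfl <;> simpa [hx] using hQx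
  · have h1 := min_le_left (P.y - α) (β - P.y)
    have h2 := min_le_right (P.y - α) (β - P.y)
    have h3 := ht.1
    have h4 := ht.2
    rw [hQy]
    rcases hu with rfl | rfl
    · rw [Complex.I_im]
      exact ⟨by linarith, by linarith⟩
    · rw [Complex.neg_im, Complex.I_im]
      exact ⟨by linarith, by linarith⟩

/-- The index set of the edges of the ladder. -/
abbrev EdgeIndex (a e : ℕ) : Type :=
  (Finset.Icc (-(e : ℤ)) a ⊕ Unit) ⊕ (Finset.Icc (-1) (a : ℤ) ⊕ Finset.Icc (-(e : ℤ) - 1) 0)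

/-- The edges of the ladder. -/
noncomputable def edge (a e : ℕ) : EdgeIndex a e → Set (Pt a e) :=
  Sum.elim
    (Sum.elim (fun j => levelArc a e (j : ℤ) (if (j : ℤ) ≤ 0 then 1 else 0)
      (if (j : ℤ) < 0 then 5 else 4)) fun _ => levelArc a e 0 0 1)
    (Sum.elim (fun k => columnArc a e 0 (max (k : ℤ) (-1 / 2)) (min ((k : ℤ) + 1) (a + 1 / 2)))
      fun k => columnArc a e (1 : ℝ) (max (k : ℤ) (-e - 1 / 2)) (min ((k : ℤ) + 1) (1 / 2)))

/-- An injective key for the edges of the ladder. -/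
def edgeKey (a e : ℕ) : EdgeIndex a e → ℕ × ℤ :=
  Sum.elim (Sum.elim (fun j => (0, j)) fun _ => (1, 0)) (Sum.elim (fun k => (2, k)) fun k => (3, k))

lemma edgeKey_injective : (edgeKey a e).Injective := by
  rintro ((⟨j, hj⟩ | _) | (⟨j, hj⟩ | ⟨j, hj⟩)) ((⟨k, hk⟩ | _) | (⟨k, hk⟩ | ⟨k, hk⟩)) h <;>
    simp_all [edgeKey]

open Classical in
/-- The key of the edge containing a point. -/
noncomputable def edgeLabel (Q : Pt a e) : ℕ × ℤ :=
  if Q.y = ⌊Q.y⌋ then (if Q ∈ levelArc a e 0 0 1 then (1, 0) else (0, ⌊Q.y⌋))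
  else if Q.x = 0 then (2, ⌊Q.y⌋) else (3, ⌊Q.y⌋)

/-- The properties of an edge of the ladder. -/
structure IsEdge (a e : ℕ) (S : Set (Pt a e)) : Prop where
  nonempty : S.Nonempty
  isPreconnected : IsPreconnected S
  isOpen : IsOpen S
  not_isVertex : ∀ Q ∈ S, ¬ IsVertex (Pt a e) Q

lemma isEdge_levelArc {j : ℤ} (hj : Rung a e j) {α β : ℝ} (hαβ : α < β)
    (h : ∀ t ∈ Ioo α β, ¬ Up a e (t : ℝ) j) : IsEdge a e (levelArc a e j α β) := by
  have hU : ∀ Q ∈ levelArc a e j α β, ¬ Up a e Q.x Q.y := by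
    rintro Q ⟨hy, t, ht, hx⟩
    rw [hx, hy]
    exact h t ht
  have hR : ∀ Q ∈ levelArc a e j α β, Rung a e Q.y := fun Q hQ => hQ.1.symm ▸ hj
  refine ⟨?_, isPreconnected_level isPreconnected_Ioo hj, isOpen_levelArc fun Q hQ =>
    ⟨hU Q hQ, fun h' => hU Q hQ (((hR Q hQ).up_iff_down _).2 h')⟩,
    fun Q hQ hv => hU Q hQ ((isVertex_of_rung (hR Q hQ)).1 hv)⟩
  obtain ⟨t, ht⟩ := exists_between hαβ
  exact ⟨lev (t : ℝ) j, lev_y hj, t, ht, lev_x hj⟩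

lemma isEdge_columnArc {x : Circ} {α β : ℝ} (hαβ : α < β)
    (h : ∀ t ∈ Ioo α β, ¬ Rung a e t ∧ Up a e x t ∧ Down a e x t)
    (hm : ∀ t ∈ Ioo α β, Mem a e x t) : IsEdge a e (columnArc a e x α β) := by
  have hR : ∀ Q ∈ columnArc a e x α β, ¬ Rung a e Q.y := fun Q hQ => (h _ hQ.2).1
  refine ⟨?_, isPreconnected_column isPreconnected_Ioo hm, isOpen_columnArc hR,
    fun Q hQ hv => (isVertex_of_not_rung (hR Q hQ)).1 hv (hQ.1.symm ▸ (h _ hQ.2).2)⟩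
  obtain ⟨t, ht⟩ := exists_between hαβ
  exact ⟨pt x t (hm t ht), rfl, ht⟩

lemma not_rung_of_mem_Ioo {k : ℤ} {t : ℝ} (h1 : (k : ℝ) < t) (h2 : t < k + 1) : t ≠ ⌊t⌋ := by
  rw [Int.floor_eq_iff.2 ⟨h1.le, h2⟩]
  exact h1.ne'

lemma Rung.eq_floor {y : ℝ} (h : Rung a e y) : y = ⌊y⌋ := by
  obtain ⟨j, -, -, rfl⟩ := h
  rw [Int.floor_intCast]

lemma not_up_coe {j : ℤ} {x : Circ} (h0 : 0 ≤ j → x ≠ 0) (h1 : j ≤ 0 → x ≠ (1 : ℝ)) :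
    ¬ Up a e x j := by
  rintro (⟨hx, h, -⟩ | ⟨hx, -, h⟩)
  · refine h0 ?_ hx
    have : (-1 : ℝ) < j := by linarith
    have : -1 < j := by exact_mod_cast this
    omega
  · refine h1 ?_ hx
    have : (j : ℝ) < 1 := by linarith
    have : j < 1 := by exact_mod_cast this
    omega

lemma isEdge_edge (i : EdgeIndex a e) : IsEdge a e (edge a e i) := by
  have ha : (0 : ℝ) ≤ a := Nat.cast_nonneg a
  have he : (0 : ℝ) ≤ e := Nat.cast_nonneg e
  rcases i with ((⟨j, hj⟩ | _) | (⟨k, hk⟩ | ⟨k, hk⟩))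
  · rw [Finset.mem_Icc] at hj
    refine isEdge_levelArc (rung_intCast.2 hj) ?_ fun t ht => ?_
    · split_ifs <;> norm_num
    · refine not_up_coe (fun h0 => ?_) fun h0 => ?_
      · rw [if_neg (not_lt.2 h0)] at ht
        have h1 : 0 < t := lt_of_le_of_lt (by split_ifs <;> norm_num) ht.1
        rw [Ne, circ_coe_eq_zero (abs_lt.2 ⟨by linarith, ht.2⟩)]
        exact h1.ne'
      · rw [if_pos h0] at ht
        have h1 : t < 5 := lt_of_lt_of_le ht.2 (by split_ifs <;> norm_num)
        rw [Ne, circ_coe_eq (abs_lt.2 ⟨by linarith [ht.1], by linarith⟩)]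
        exact ht.1.ne'
  · have h := isEdge_levelArc (j := 0) (a := a) (e := e) (rung_intCast.2 (by omega)) one_pos
      fun t ht => not_up_coe (fun _ => ?_) fun _ => ?_
    · rw [Int.cast_zero] at h
      exact h
    · rw [Ne, circ_coe_eq_zero (abs_lt.2 ⟨by linarith [ht.1], by linarith [ht.2]⟩)]
      exact ht.1.ne'
    · rw [Ne, circ_coe_eq (abs_lt.2 ⟨by linarith [ht.1], by linarith [ht.2]⟩)]
      exact ht.2.ne
  · rw [Finset.mem_Icc] at hk
    have h1 : (-1 : ℝ) ≤ k := by exact_mod_cast hk.1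
    have h2 : (k : ℝ) ≤ a := by exact_mod_cast hk.2
    have h3 : ∀ t ∈ Ioo (max (k : ℝ) (-1 / 2)) (min ((k : ℝ) + 1) (a + 1 / 2)),
        ¬ Rung a e t ∧ -1 / 2 < t ∧ t < a + 1 / 2 := fun t ht => by
      obtain ⟨h3, h4⟩ := max_lt_iff.1 ht.1
      obtain ⟨h5, h6⟩ := lt_min_iff.1 ht.2
      exact ⟨fun h => not_rung_of_mem_Ioo h3 h5 h.eq_floor, h4, h6⟩
    refine isEdge_columnArc ?_ (fun t ht => ?_) fun t ht => ?_
    · exact max_lt (lt_min (by linarith) (by linarith)) (lt_min (by linarith) (by linarith))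
    · obtain ⟨h3, h4, h5⟩ := h3 t ht
      exact ⟨h3, Or.inl ⟨rfl, h4.le, h5⟩, Or.inl ⟨rfl, h4, h5.le⟩⟩
    · obtain ⟨h3, h4, h5⟩ := h3 t ht
      exact mem_columnA ⟨h4.le, h5.le⟩
  · rw [Finset.mem_Icc] at hk
    have h1 : (-e - 1 : ℝ) ≤ k := by exact_mod_cast hk.1
    have h2 : (k : ℝ) ≤ 0 := by exact_mod_cast hk.2
    have h3 : ∀ t ∈ Ioo (max (k : ℝ) (-e - 1 / 2)) (min ((k : ℝ) + 1) (1 / 2)),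
        ¬ Rung a e t ∧ -e - 1 / 2 < t ∧ t < 1 / 2 := fun t ht => by
      obtain ⟨h3, h4⟩ := max_lt_iff.1 ht.1
      obtain ⟨h5, h6⟩ := lt_min_iff.1 ht.2
      exact ⟨fun h => not_rung_of_mem_Ioo h3 h5 h.eq_floor, h4, h6⟩
    refine isEdge_columnArc ?_ (fun t ht => ?_) fun t ht => ?_
    · exact max_lt (lt_min (by linarith) (by linarith)) (lt_min (by linarith) (by linarith))
    · obtain ⟨h3, h4, h5⟩ := h3 t ht
      exact ⟨h3, Or.inr ⟨rfl, h4.le, h5⟩, Or.inr ⟨rfl, h4, h5.le⟩⟩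
    · obtain ⟨h3, h4, h5⟩ := h3 t ht
      exact mem_columnB ⟨h4.le, h5.le⟩

lemma edgeLabel_of_mem (i : EdgeIndex a e) : ∀ Q ∈ edge a e i, edgeLabel Q = edgeKey a e i := by
  rcases i with ((⟨j, hj⟩ | _) | (⟨k, hk⟩ | ⟨k, hk⟩))
  · rintro Q ⟨hy, t, ht, hx⟩
    have hfl : ⌊Q.y⌋ = j := by rw [hy, Int.floor_intCast]
    rw [edgeLabel, hfl, if_pos hy, if_neg]
    · rfl
    rintro ⟨hy', s, hs, hx'⟩
    obtain rfl : j = 0 := by exact_mod_cast hy.symm.trans hy'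
    simp only [le_refl, if_true, lt_irrefl, if_false] at ht
    rw [hx, circ_coe_eq (abs_lt.2 ⟨by linarith [ht.1, hs.2], by linarith [ht.2, hs.1]⟩)] at hx'
    linarith [ht.1, hs.2]
  · intro Q (hQ : Q ∈ levelArc a e 0 0 1)
    have hy : Q.y = 0 := hQ.1
    rw [edgeLabel, if_pos (by simp [hy]), if_pos hQ]
    rfl
  · rintro Q ⟨hx, hy⟩
    have h1 := (max_lt_iff.1 hy.1).1
    have h2 := (lt_min_iff.1 hy.2).1
    rw [edgeLabel, if_neg (not_rung_of_mem_Ioo h1 h2), if_pos hx, Int.floor_eq_iff.2 ⟨h1.le, h2⟩]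
    rfl
  · rintro Q ⟨hx, hy⟩
    have h1 := (max_lt_iff.1 hy.1).1
    have h2 := (lt_min_iff.1 hy.2).1
    rw [edgeLabel, if_neg (not_rung_of_mem_Ioo h1 h2), if_neg (hx ▸ one_ne_zero_circ),
      Int.floor_eq_iff.2 ⟨h1.le, h2⟩]
    rfl

lemma exists_mem_edge {Q : Pt a e} (hQ : ¬ IsVertex (Pt a e) Q) : ∃ i, Q ∈ edge a e i := by
  have ha : (0 : ℝ) ≤ a := Nat.cast_nonneg a
  have he : (0 : ℝ) ≤ e := Nat.cast_nonneg e
  by_cases hR : Rung a e Q.y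
  · rw [isVertex_of_rung hR] at hQ
    obtain ⟨j, h1, h2, hj⟩ := hR
    have h1' : (-e : ℝ) ≤ j := by exact_mod_cast h1
    have h2' : (j : ℝ) ≤ a := by exact_mod_cast h2
    have hx0 : 0 ≤ j → Q.x ≠ 0 := fun h hx => by
      have : (0 : ℝ) ≤ j := by exact_mod_cast h
      exact hQ (Or.inl ⟨hx, by linarith, by linarith⟩)
    have hx1 : j ≤ 0 → Q.x ≠ (1 : ℝ) := fun h hx => by
      have : (j : ℝ) ≤ 0 := by exact_mod_cast h
      exact hQ (Or.inr ⟨hx, by linarith, by linarith⟩)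
    have hlift : ∀ α : ℝ, ∃ t ∈ Ico α (α + 4), Q.x = (t : ℝ) := fun α => by
      have : Q.x ∈ ((↑) : ℝ → Circ) '' Ico α (α + 4) := by
        rw [AddCircle.coe_image_Ico_eq]
        trivial
      obtain ⟨t, ht, hx⟩ := this
      exact ⟨t, ht, hx.symm⟩
    have hmem : j ∈ Finset.Icc (-(e : ℤ)) a := Finset.mem_Icc.2 ⟨h1, h2⟩
    by_cases hneg : j < 0
    · refine ⟨Sum.inl (Sum.inl ⟨j, hmem⟩), hj, ?_⟩
      simp only [hneg, hneg.le, if_true]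
      obtain ⟨t, ht, hx⟩ := hlift 1
      refine ⟨t, ⟨lt_of_le_of_ne ht.1 ?_, by linarith [ht.2]⟩, hx⟩
      rintro rfl
      exact hx1 hneg.le hx
    obtain ⟨t, ht, hx⟩ := hlift 0
    have ht0 : 0 < t := lt_of_le_of_ne ht.1 (by
      rintro rfl
      exact hx0 (not_lt.1 hneg) (by simpa using hx))
    have ht4 : t < 4 := by linarith [ht.2]
    by_cases hpos : 0 < j
    · refine ⟨Sum.inl (Sum.inl ⟨j, hmem⟩), hj, ?_⟩
      simp only [hneg, hpos.not_ge, if_false]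
      exact ⟨t, ⟨ht0, ht4⟩, hx⟩
    obtain rfl : j = 0 := by omega
    have ht1 : t ≠ 1 := by
      rintro rfl
      exact hx1 le_rfl hx
    rcases ht1.lt_or_gt with ht1 | ht1
    · exact ⟨Sum.inl (Sum.inr ()), by simpa using hj, t, ⟨ht0, ht1⟩, hx⟩
    · refine ⟨Sum.inl (Sum.inl ⟨0, hmem⟩), hj, ?_⟩
      simp only [le_refl, lt_irrefl, if_true, if_false]
      exact ⟨t, ⟨ht1, ht4⟩, hx⟩
  · have hUD := not_not.1 (mt (isVertex_of_not_rung hR).2 hQ)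
    have hf := lt_of_le_of_ne (Int.floor_le Q.y)
    have hf' := Int.lt_floor_add_one Q.y
    rcases hUD with ⟨⟨hx, h1, h2⟩ | ⟨hx, h1, h2⟩, hD⟩
    · have hD := hD.resolve_right fun h => one_ne_zero_circ (h.1.symm.trans hx)
      have h3 : -1 ≤ ⌊Q.y⌋ := Int.le_floor.2 (by push_cast; linarith)
      have h4 : ⌊Q.y⌋ < (a : ℤ) + 1 := Int.floor_lt.2 (by push_cast; linarith)
      have h5 : (⌊Q.y⌋ : ℝ) ≠ Q.y := fun h => by
        refine hR (h ▸ rung_intCast.2 ⟨?_, by omega⟩)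
        have : (-1 : ℝ) < ⌊Q.y⌋ := by linarith
        have : -1 < ⌊Q.y⌋ := by exact_mod_cast this
        omega
      exact ⟨Sum.inr (Sum.inl ⟨⌊Q.y⌋, Finset.mem_Icc.2 ⟨h3, by omega⟩⟩), hx,
        max_lt (hf h5) hD.2.1, lt_min hf' h2⟩
    · have hD := hD.resolve_left fun h => one_ne_zero_circ (hx.symm.trans h.1)
      have h3 : -(e : ℤ) - 1 ≤ ⌊Q.y⌋ := Int.le_floor.2 (by push_cast; linarith)
      have h4 : ⌊Q.y⌋ < 1 := Int.floor_lt.2 (by push_cast; linarith)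
      have h5 : (⌊Q.y⌋ : ℝ) ≠ Q.y := fun h => by
        refine hR (h ▸ rung_intCast.2 ⟨?_, by omega⟩)
        have : (-e - 1 : ℝ) < ⌊Q.y⌋ := by linarith [hD.2.1]
        have : -(e : ℤ) - 1 < ⌊Q.y⌋ := by exact_mod_cast this
        omega
      exact ⟨Sum.inr (Sum.inr ⟨⌊Q.y⌋, Finset.mem_Icc.2 ⟨h3, by omega⟩⟩), hx,
        max_lt (hf h5) hD.2.1, lt_min hf' h2⟩

variable (a e)

lemma card_edges : Nat.card (ConnectedComponents {P : Pt a e // ¬ IsVertex (Pt a e) P}) =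
    2 * a + 2 * e + 6 := by
  have himage : ∀ i, (Subtype.val : {P : Pt a e // ¬ IsVertex (Pt a e) P} → Pt a e) ''
      (Subtype.val ⁻¹' edge a e i) = edge a e i := fun i =>
    image_preimage_eq_of_subset fun Q hQ => ⟨⟨Q, (isEdge_edge i).not_isVertex Q hQ⟩, rfl⟩
  rw [card_connectedComponents_eq (S := fun i => Subtype.val ⁻¹' edge a e i) (fun i => ?_)
    (fun i => ?_) (fun i => (isEdge_edge i).isOpen.preimage continuous_subtype_val)
    (fun P => exists_mem_edge P.2) edgeKey_injective (label := fun P => edgeLabel P.1)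
    fun i P hP => edgeLabel_of_mem i P hP]
  · rw [Nat.card_eq_fintype_card]
    simp only [Fintype.card_sum, Fintype.card_coe, Int.card_Icc, Fintype.card_unit]
    omega
  · obtain ⟨Q, hQ⟩ := (isEdge_edge i).nonempty
    exact ⟨⟨Q, (isEdge_edge i).not_isVertex Q hQ⟩, hQ⟩
  · refine (IsInducing.induced Subtype.val).isPreconnected_image.1 ?_
    rw [himage]
    exact (isEdge_edge i).isPreconnected

lemma graphGenus_eq : graphGenus (Pt a e) = a + e + 1 := by
  rw [graphGenus, card_edges, card_vertices]
  push_cast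
  ring

end Ladder

lemma Effective.eq_zero {Γ : Type*} {E : Divisor Γ} (hE : Effective E) (hd : divDeg E = 0) :
    E = 0 := by
  ext P
  by_contra hP
  exact hP ((Finset.sum_eq_zero_iff_of_nonneg fun Q _ => hE Q).1 hd P
    (Finsupp.mem_support_iff.2 hP))

namespace Ladder

variable {a e : ℕ}

/-- The divisor consisting of one chip on every negative level and of `2 * n` chips at the
point `(0, 0)`. -/
noncomputable def ladderDivisor (a e n : ℕ) (p : ℤ → Circ) : Divisor (Pt a e) :=
  n • (chip (lev 0 0) + chip (lev 0 0)) + ∑ j ∈ Finset.Icc (-(e : ℤ)) (-1), chip (lev (p j) j)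

lemma rung_of_nonneg {j : ℤ} (h0 : 0 ≤ j) (h : j ≤ a) : Rung a e j := rung_intCast.2 ⟨by omega, h⟩

lemma rung_of_nonpos {j : ℤ} (h0 : j ≤ 0) (h : -(e : ℤ) ≤ j) : Rung a e j :=
  rung_intCast.2 ⟨h, by omega⟩

lemma lev_mem_columnA {j : ℤ} (h0 : 0 ≤ j) (h : j ≤ a) : (lev 0 j : Pt a e) ∈ columnA := by
  have hj := rung_of_nonneg (e := e) h0 h
  rw [mem_columnA_iff, lev_x hj, lev_y hj]
  have : (0 : ℝ) ≤ j := by exact_mod_cast h0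
  exact ⟨rfl, by linarith⟩

lemma lev_mem_columnB {j : ℤ} (h0 : j ≤ 0) (h : -(e : ℤ) ≤ j) :
    (lev (1 : ℝ) j : Pt a e) ∈ columnB := by
  have hj := rung_of_nonpos (a := a) h0 h
  rw [mem_columnB_iff, lev_x hj, lev_y hj]
  have : (j : ℝ) ≤ 0 := by exact_mod_cast h0
  exact ⟨rfl, by linarith⟩

lemma linEquiv_of_nonneg {j : ℤ} (h0 : 0 ≤ j) (h : j ≤ a) {A B : Circ} (hAB : A + B = 0) :
    LinEquiv (Pt a e) (chip (lev 0 0) + chip (lev 0 0)) (chip (lev A j) + chip (lev B j)) := by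
  have hΓ := isMetricGraph a e
  have h1 := linEquiv_columnA (lev_mem_columnA (a := a) (e := e) le_rfl (by omega))
    (lev_mem_columnA h0 h)
  exact hΓ.linEquiv_trans (hΓ.linEquiv_add h1 h1)
    (linEquiv_level (rung_of_nonneg h0 h) (by rw [hAB, add_zero]))

lemma linEquiv_columnB_lev {j : ℤ} (h0 : j ≤ 0) (h : -(e : ℤ) ≤ j) :
    LinEquiv (Pt a e) (chip (lev (1 : ℝ) 0)) (chip (lev (1 : ℝ) j)) :=
  linEquiv_columnB (lev_mem_columnB le_rfl (by omega)) (lev_mem_columnB h0 h)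

lemma exists_linEquiv_sub_chip (p : ℤ → Circ) (Q : Pt a e) : ∃ (p' : ℤ → Circ) (R : Pt a e),
    LinEquiv (Pt a e) (ladderDivisor a e 1 p - chip Q) (ladderDivisor a e 0 p' + chip R) := by
  have hΓ := isMetricGraph a e
  have h00 : LinEquiv (Pt a e) (chip (lev 0 0) + chip (lev 0 0))
      (chip (lev (1 : ℝ) 0) + chip (lev (-(1 : ℝ) : Circ) 0)) :=
    linEquiv_of_nonneg le_rfl (by omega) (by simp)
  simp only [ladderDivisor, one_nsmul, zero_nsmul, zero_add]
  rcases Q.mem with ⟨j, h1, h2, hj⟩ | hA | hB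
  · have hR : Rung a e j := rung_intCast.2 ⟨h1, h2⟩
    have hQ : lev Q.x j = Q := (eq_lev_iff hR Q).2 ⟨rfl, hj⟩
    rcases le_or_gt 0 j with h0 | h0
    · refine ⟨p, lev (-Q.x) j,
        (linEquiv_of_nonneg h0 h2 (add_neg_cancel Q.x)).of_sub_eq ?_⟩
      rw [hQ]
      abel
    · have hmem : j ∈ Finset.Icc (-(e : ℤ)) (-1) := Finset.mem_Icc.2 ⟨h1, by omega⟩
      have h3 := linEquiv_level (A := (1 : ℝ)) (B := p j) (C := Q.x)
        (D := ((1 : ℝ) : Circ) + p j - Q.x) hR (by abel)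
      have h4 := linEquiv_columnB_lev (a := a) h0.le h1
      refine ⟨Function.update p j (((1 : ℝ) : Circ) + p j - Q.x), lev (-(1 : ℝ) : Circ) 0,
        (hΓ.linEquiv_add (hΓ.linEquiv_add h00 h4) h3).of_sub_eq ?_⟩
      rw [← Finset.add_sum_erase _ _ hmem, ← Finset.add_sum_erase _ _ hmem,
        Function.update_self, hQ, Finset.sum_congr rfl fun i hi => by
          rw [Function.update_of_ne (Finset.ne_of_mem_erase hi)]]
      abel
  · refine ⟨p, lev 0 0, (linEquiv_columnA (lev_mem_columnA le_rfl (by omega)) hA).of_sub_eq ?_⟩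
    abel
  · refine ⟨p, lev (-(1 : ℝ) : Circ) 0, (hΓ.linEquiv_add h00
      (linEquiv_columnB (lev_mem_columnB le_rfl (by omega)) hB)).of_sub_eq ?_⟩
    abel

lemma effective_ladderDivisor (n : ℕ) (p : ℤ → Circ) : Effective (ladderDivisor a e n p) := by
  refine Effective.add (fun P => ?_) (.sum fun j _ => effective_single _ zero_le_one)
  rw [Finsupp.smul_apply]
  exact nsmul_nonneg
    ((effective_single _ zero_le_one).add (effective_single (lev 0 0) zero_le_one) P) n

lemma divDeg_ladderDivisor (n : ℕ) (p : ℤ → Circ) :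
    divDeg (ladderDivisor a e n p) = 2 * n + e := by
  have h : n • (chip (lev 0 0) + chip (lev 0 0) : Divisor (Pt a e)) =
      Finsupp.single (lev 0 0) (2 * n : ℤ) := by
    rw [← Finsupp.single_add, Finsupp.smul_single, nsmul_eq_mul]
    congr 1
    ring
  rw [ladderDivisor, divDeg_add, divDeg_sum, h, divDeg_single]
  simp [divDeg_single]

lemma rankGE_ladderDivisor (n : ℕ) (p : ℤ → Circ) :
    RankGE (Pt a e) (ladderDivisor a e n p) n := by
  have hΓ := isMetricGraph a e
  induction n generalizing p with
  | zero =>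
    intro E hE hd
    rw [hE.eq_zero hd, sub_zero]
    exact ⟨_, effective_ladderDivisor 0 p, hΓ.linEquiv_refl _⟩
  | succ n ih =>
    intro E hE hd
    obtain ⟨Q, E', hE', hd', rfl⟩ := hE.exists_sub hd
    obtain ⟨p', R, h⟩ := exists_linEquiv_sub_chip p Q
    refine hΓ.equivEffective_congr (h.of_sub_eq ?_)
      ((ih p' E' hE' hd').add_effective (effective_single R zero_le_one))
    simp only [ladderDivisor, succ_nsmul, zero_nsmul]
    abel

lemma not_equivEffective_sum {s : ℤ → ℝ} (hs : ∀ j, 1 < s j ∧ s j < 4) {P : Pt a e}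
    (hP : ∀ j : ℤ, Rung a e j → P ≠ lev (s j : ℝ) j) {S : Finset ℤ}
    (hS : S ⊆ Finset.Icc (-(e : ℤ)) a) :
    ¬ EquivEffective (Pt a e) (∑ j ∈ S, chip (lev (s j : ℝ) j) - chip P) := by
  intro h
  have := h.add_effective (E := ∑ j ∈ Finset.Icc (-(e : ℤ)) a \ S, chip (lev (s j : ℝ) j))
    (.sum fun j _ => effective_single _ zero_le_one)
  rw [sub_add_eq_add_sub, add_comm (∑ j ∈ S, _), Finset.sum_sdiff hS] at this
  exact not_equivEffective hs hP this

/-- The positions of the chips, given by their positions on the negative and on the other levels. -/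
noncomputable def twoLevels (b c : ℝ) (j : ℤ) : ℝ := if j < 0 then b else c

lemma twoLevels_of_neg {b c : ℝ} {j : ℤ} (h : j < 0) : twoLevels b c j = b := if_pos h

lemma twoLevels_of_nonneg {b c : ℝ} {j : ℤ} (h : 0 ≤ j) : twoLevels b c j = c :=
  if_neg (not_lt.2 h)

lemma sum_twoLevels_neg (b c : ℝ) :
    ∑ j ∈ Finset.Icc (-(e : ℤ)) (-1), chip (lev (twoLevels b c j : Circ) j : Pt a e) =
      ∑ j ∈ Finset.Icc (-(e : ℤ)) (-1), chip (lev (b : Circ) j) :=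
  Finset.sum_congr rfl fun j hj => by
    rw [twoLevels_of_neg (show j < 0 by rw [Finset.mem_Icc] at hj; omega)]

lemma sum_twoLevels_pos (b c : ℝ) (n : ℕ) :
    ∑ j ∈ Finset.Icc (1 : ℤ) n, chip (lev (twoLevels b c j : Circ) j : Pt a e) =
      ∑ j ∈ Finset.Icc (1 : ℤ) n, chip (lev (c : Circ) j) :=
  Finset.sum_congr rfl fun j hj => by
    rw [twoLevels_of_nonneg (show 0 ≤ j by rw [Finset.mem_Icc] at hj; omega)]

lemma linEquiv_nsmul {n : ℕ} (hn : n ≤ a) (c : ℝ) :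
    LinEquiv (Pt a e) (n • (chip (lev 0 0) + chip (lev 0 0)))
      (∑ j ∈ Finset.Icc (1 : ℤ) n, chip (lev (c : Circ) j) +
        ∑ j ∈ Finset.Icc (1 : ℤ) n, chip (lev (-c : Circ) j)) := by
  have h : n • (chip (lev 0 0) + chip (lev 0 0) : Divisor (Pt a e)) =
      ∑ j ∈ Finset.Icc (1 : ℤ) n, (chip (lev 0 0) + chip (lev 0 0)) := by
    rw [Finset.sum_const, Int.card_Icc, add_sub_cancel_right, Int.toNat_natCast]
  rw [h, ← Finset.sum_add_distrib]
  refine (isMetricGraph a e).linEquiv_sum _ fun j hj => ?_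
  rw [Finset.mem_Icc] at hj
  exact linEquiv_of_nonneg (by omega) (by omega) (add_neg_cancel _)

lemma effective_sum_chip (S : Finset ℤ) (p : ℤ → Pt a e) : Effective (∑ j ∈ S, chip (p j)) :=
  .sum fun _ _ => effective_single _ zero_le_one

lemma divDeg_sum_chip (S : Finset ℤ) (p : ℤ → Pt a e) : divDeg (∑ j ∈ S, chip (p j)) = S.card := by
  simp [divDeg_sum, divDeg_single]

lemma not_rankGE_of_ne {n : ℕ} (hn : n ≤ a) {P : Pt a e}
    (hP : ∀ j : ℤ, j < 0 → Rung a e j → P ≠ lev (2 : ℝ) j) :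
    ¬ RankGE (Pt a e) (ladderDivisor a e n (fun _ => (2 : ℝ)) - chip P) n := by
  have hΓ := isMetricGraph a e
  intro h
  obtain ⟨c, hc1, hc2, hc⟩ : ∃ c : ℝ, 1 < c ∧ c < 4 ∧ P.x ≠ (c : ℝ) := by
    by_cases hx : P.x = (2 : ℝ)
    · refine ⟨3, by norm_num, by norm_num, ?_⟩
      rw [hx, Ne, circ_coe_eq (by norm_num [abs_lt])]
      norm_num
    · exact ⟨2, by norm_num, by norm_num, hx⟩
  have hs : ∀ j, 1 < twoLevels 2 c j ∧ twoLevels 2 c j < 4 := fun j => by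
    unfold twoLevels
    split_ifs
    exacts [⟨by norm_num, by norm_num⟩, ⟨hc1, hc2⟩]
  refine not_equivEffective_sum (a := a) (e := e)
    (S := Finset.Icc (-(e : ℤ)) (-1) ∪ Finset.Icc 1 (n : ℤ)) hs
    (P := P) (fun j hj hPj => ?_) ?_ ?_
  · rcases lt_or_ge j 0 with h0 | h0
    · rw [twoLevels_of_neg h0] at hPj
      exact hP j h0 hj hPj
    · rw [twoLevels_of_nonneg h0] at hPj
      exact hc (hPj ▸ lev_x hj)
  · intro j hj
    simp only [Finset.mem_union, Finset.mem_Icc] at hj ⊢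
    omega
  · rw [Finset.sum_union (Finset.disjoint_left.2 fun j h1 h2 => by
      rw [Finset.mem_Icc] at h1 h2
      omega)]
    refine hΓ.equivEffective_congr ((hΓ.linEquiv_symm (linEquiv_nsmul hn c)).of_sub_eq ?_)
      (h (∑ j ∈ Finset.Icc (1 : ℤ) n, chip (lev (-c : Circ) j)) (effective_sum_chip _ _) ?_)
    · rw [ladderDivisor, sum_twoLevels_neg, sum_twoLevels_pos]
      abel
    · rw [divDeg_sum_chip, Int.card_Icc]
      simp

lemma not_rankGE_of_eq {n : ℕ} (hn : n + 1 ≤ a) {i : ℤ} (hi : i < 0) (hR : Rung a e i) :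
    ¬ RankGE (Pt a e) (ladderDivisor a e (n + 1) (fun _ => (2 : ℝ)) - chip (lev (2 : ℝ) i))
      (n + 1) := by
  have hΓ := isMetricGraph a e
  intro h
  have hi' := (rung_intCast.1 hR).1
  have hs : ∀ j, 1 < twoLevels 2 3 j ∧ twoLevels 2 3 j < 4 := fun j => by
    unfold twoLevels
    split_ifs <;> norm_num
  have h4 : ((1 : ℝ) : Circ) + (3 : ℝ) = 0 := by
    rw [← AddCircle.coe_add]
    exact (AddCircle.coe_eq_zero_iff 4).2 ⟨1, by norm_num⟩
  refine not_equivEffective_sum (a := a) (e := e)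
    (S := Finset.Icc (-(e : ℤ)) (-1) ∪ ({0} ∪ Finset.Icc 1 (n : ℤ))) hs
    (P := lev (1 : ℝ) 0) (fun j hj hPj => ?_) ?_ ?_
  · refine (circ_coe_ne (hs j)).2 ?_
    have h0 := lev_x (x := (1 : ℝ))
      (rung_intCast (a := a) (e := e).2 (show -(e : ℤ) ≤ 0 ∧ _ by omega))
    rw [← lev_x (x := (twoLevels 2 3 j : Circ)) hj, ← hPj, h0]
  · intro j hj
    simp only [Finset.mem_union, Finset.mem_Icc, Finset.mem_singleton] at hj ⊢
    omega
  · rw [Finset.sum_union (Finset.disjoint_left.2 fun j h1 h2 => by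
      simp only [Finset.mem_union, Finset.mem_Icc, Finset.mem_singleton] at h1 h2
      omega), Finset.sum_union (Finset.disjoint_left.2 fun j h1 h2 => by
      simp only [Finset.mem_Icc, Finset.mem_singleton] at h1 h2
      omega), Finset.sum_singleton]
    have h1 := linEquiv_nsmul (a := a) (e := e) (show n ≤ a by omega) 3
    have h2 := linEquiv_of_nonneg (a := a) (e := e) le_rfl (by omega) h4
    have h3 := linEquiv_columnB_lev (a := a) hi.le hi'
    have h4 := linEquiv_level (A := (1 : ℝ)) (B := (1 : ℝ)) (C := 0) (D := (2 : ℝ)) hR (by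
      rw [← AddCircle.coe_add, zero_add]
      norm_num)
    refine hΓ.equivEffective_congr ((hΓ.linEquiv_symm
      (hΓ.linEquiv_add (hΓ.linEquiv_add (hΓ.linEquiv_add h1 h2)
        (hΓ.linEquiv_add h3 h3)) h4)).of_sub_eq ?_)
      (h (∑ j ∈ Finset.Icc (1 : ℤ) n, chip (lev (-(3 : ℝ) : Circ) j) + chip (lev 0 i))
        ((effective_sum_chip _ _).add (effective_single _ zero_le_one)) ?_)
    · rw [ladderDivisor, sum_twoLevels_neg, sum_twoLevels_pos,
        twoLevels_of_nonneg le_rfl, succ_nsmul]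
      generalize n • (chip (lev 0 0) + chip (lev 0 0) : Divisor (Pt a e)) = X,
        (chip (lev (1 : ℝ) 0) : Divisor (Pt a e)) = A,
        (chip (lev (1 : ℝ) i) : Divisor (Pt a e)) = B,
        ∑ j ∈ Finset.Icc (1 : ℤ) n, (chip (lev (3 : ℝ) j) : Divisor (Pt a e)) = S,
        ∑ j ∈ Finset.Icc (1 : ℤ) n, (chip (lev (-(3 : ℝ) : Circ) j) : Divisor (Pt a e)) = T,
        ∑ j ∈ Finset.Icc (-(e : ℤ)) (-1), (chip (lev (2 : ℝ) j) : Divisor (Pt a e)) = U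
      abel
    · rw [divDeg_add, divDeg_sum_chip, divDeg_single, Int.card_Icc]
      simp

lemma not_rankGE {n : ℕ} (h0 : 1 ≤ n) (hn : n ≤ a) (P : Pt a e) :
    ¬ RankGE (Pt a e) (ladderDivisor a e n (fun _ => (2 : ℝ)) - chip P) n := by
  by_cases hP : ∀ j : ℤ, j < 0 → Rung a e j → P ≠ lev (2 : ℝ) j
  · exact not_rankGE_of_ne hn hP
  · push Not at hP
    obtain ⟨j, hj, hR, rfl⟩ := hP
    obtain ⟨m, rfl⟩ := Nat.exists_eq_add_of_le' h0
    exact not_rankGE_of_eq hn hj hR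

end Ladder

end

/-- For all integers `r, d, g` with `r ≥ 1`, `2r ≤ d` and `d ≤ r + g - 2`,
there exists a metric graph `Γ` of genus `g` and an effective divisor `D` on `Γ` of
degree `d` such that `rk(D) = r` and `D` is a free divisor on `Γ`. -/
theorem statement0 (r d g : ℤ) (hr : 1 ≤ r) (hrd : 2 * r ≤ d) (hdg : d ≤ r + g - 2) :
    ∃ (G : MetricGraph) (D : Divisor G.carrier),
      graphGenus G.carrier = g ∧ Effective D ∧ divDeg D = d ∧
      divRank G.carrier D = r ∧ IsFreeDivisor G.carrier D := by
  obtain ⟨n, rfl⟩ := Int.eq_ofNat_of_zero_le (show 0 ≤ r by omega)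
  obtain ⟨e, he⟩ := Int.eq_ofNat_of_zero_le (show 0 ≤ d - 2 * n by omega)
  obtain ⟨a, ha⟩ := Int.eq_ofNat_of_zero_le (show 0 ≤ g - 1 - e by omega)
  have heff := Ladder.effective_ladderDivisor (a := a) (e := e) n fun _ => (2 : ℝ)
  have hrank := divRank_eq_of_free
    (Ladder.rankGE_ladderDivisor (a := a) (e := e) n fun _ => (2 : ℝ))
    (Ladder.not_rankGE (by omega) (by omega))
  refine ⟨⟨Ladder.Pt a e, Ladder.isMetricGraph a e⟩,
    Ladder.ladderDivisor a e n fun _ => (2 : ℝ), ?_, heff, ?_, hrank.1, heff, ?_, fun P => ?_⟩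
  · rw [Ladder.graphGenus_eq]
    omega
  · rw [Ladder.divDeg_ladderDivisor]
    omega
  · rw [hrank.1]
    omega
  · rw [hrank.1]
    exact hrank.2 P
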